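/- arXiv:2412.02319 — 3 statements merged into one kernel-verified Lean document; each statement's English description precedes it below -/
import Mathlib

section
/- Let F ∈ ℝ[x₀,x₁,x₂] be homogeneous of degree 4 such that F(a) ≥ 0 for all a ∈ ℝ³ and such that the complex zero set of F is smooth, i.e., there is no 0 ≠ a ∈ ℂ³ with F(a) = 0 and all three partial derivatives of F vanishing at a. Then F has a positive quadratic representation: there exists a symmetric 2×2 matrix M whose entries are real homogeneous polynomials of degree two such that F = det(M) and M(a) is positive semidefinite for every a ∈ ℝ³. -/
open MvPolynomial

noncomputable section

namespace TernaryQuartic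

open Filter Topology Set

/-- The value at `x` of the ternary linear form with coefficient vector `a`. -/
def linEval {R : Type*} [CommRing R] (a x : Fin 3 → R) : R :=
  a 0 * x 0 + a 1 * x 1 + a 2 * x 2

/-- The value at `x` of the ternary quadratic form with coefficient vector `q`, in the monomial
basis `x₀², x₁², x₂², x₀x₁, x₀x₂, x₁x₂`. -/
def quadEval {R : Type*} [CommRing R] (q : Fin 6 → R) (x : Fin 3 → R) : R :=
  q 0 * x 0 ^ 2 + q 1 * x 1 ^ 2 + q 2 * x 2 ^ 2 + q 3 * (x 0 * x 1) + q 4 * (x 0 * x 2) +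
    q 5 * (x 1 * x 2)

/-- The value at `x` of the ternary quartic form with coefficient vector `w`, in the monomial basis
`x₀⁴, x₁⁴, x₂⁴, x₀³x₁, x₀³x₂, x₀x₁³, x₁³x₂, x₀x₂³, x₁x₂³, x₀²x₁², x₀²x₂², x₁²x₂², x₀²x₁x₂,
x₀x₁²x₂, x₀x₁x₂²`. -/
def quarticEval {R : Type*} [CommRing R] (w : Fin 15 → R) (x : Fin 3 → R) : R :=
  w 0 * x 0 ^ 4 + w 1 * x 1 ^ 4 + w 2 * x 2 ^ 4 + w 3 * (x 0 ^ 3 * x 1) + w 4 * (x 0 ^ 3 * x 2) +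
    w 5 * (x 0 * x 1 ^ 3) + w 6 * (x 1 ^ 3 * x 2) + w 7 * (x 0 * x 2 ^ 3) +
    w 8 * (x 1 * x 2 ^ 3) + w 9 * (x 0 ^ 2 * x 1 ^ 2) + w 10 * (x 0 ^ 2 * x 2 ^ 2) +
    w 11 * (x 1 ^ 2 * x 2 ^ 2) + w 12 * (x 0 ^ 2 * x 1 * x 2) + w 13 * (x 0 * x 1 ^ 2 * x 2) +
    w 14 * (x 0 * x 1 * x 2 ^ 2)

/-- The product of two linear forms. -/
def linMul {R : Type*} [CommRing R] (a b : Fin 3 → R) : Fin 6 → R :=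
  ![a 0 * b 0,
    a 1 * b 1,
    a 2 * b 2,
    a 0 * b 1 + a 1 * b 0,
    a 0 * b 2 + a 2 * b 0,
    a 1 * b 2 + a 2 * b 1]

/-- The product of two quadratic forms. -/
def quadMul {R : Type*} [CommRing R] (a b : Fin 6 → R) : Fin 15 → R :=
  ![a 0 * b 0,
    a 1 * b 1,
    a 2 * b 2,
    a 0 * b 3 + a 3 * b 0,
    a 0 * b 4 + a 4 * b 0,
    a 1 * b 3 + a 3 * b 1,
    a 1 * b 5 + a 5 * b 1,
    a 2 * b 4 + a 4 * b 2,
    a 2 * b 5 + a 5 * b 2,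
    a 0 * b 1 + a 1 * b 0 + a 3 * b 3,
    a 0 * b 2 + a 2 * b 0 + a 4 * b 4,
    a 1 * b 2 + a 2 * b 1 + a 5 * b 5,
    a 0 * b 5 + a 3 * b 4 + a 4 * b 3 + a 5 * b 0,
    a 1 * b 4 + a 3 * b 5 + a 4 * b 1 + a 5 * b 3,
    a 2 * b 3 + a 3 * b 2 + a 4 * b 5 + a 5 * b 4]

section Eval

variable {R : Type*} [CommRing R]

lemma quadEval_linMul (a b x : Fin 3 → R) :
    quadEval (linMul a b) x = linEval a x * linEval b x := by
  simp only [quadEval, linMul, linEval, Matrix.cons_val]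
  ring

lemma quarticEval_quadMul (a b : Fin 6 → R) (x : Fin 3 → R) :
    quarticEval (quadMul a b) x = quadEval a x * quadEval b x := by
  simp only [quarticEval, quadMul, quadEval, Matrix.cons_val]
  ring

lemma linEval_add (a b x : Fin 3 → R) : linEval (a + b) x = linEval a x + linEval b x := by
  simp only [linEval, Pi.add_apply]; ring

lemma linEval_smul (c : R) (a x : Fin 3 → R) : linEval (c • a) x = c * linEval a x := by
  simp only [linEval, Pi.smul_apply, smul_eq_mul]; ring

lemma quadEval_add (a b : Fin 6 → R) (x : Fin 3 → R) :
    quadEval (a + b) x = quadEval a x + quadEval b x := by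
  simp only [quadEval, Pi.add_apply]; ring

lemma quadEval_sub (a b : Fin 6 → R) (x : Fin 3 → R) :
    quadEval (a - b) x = quadEval a x - quadEval b x := by
  simp only [quadEval, Pi.sub_apply]; ring

lemma quadEval_smul (c : R) (a : Fin 6 → R) (x : Fin 3 → R) :
    quadEval (c • a) x = c * quadEval a x := by
  simp only [quadEval, Pi.smul_apply, smul_eq_mul]; ring

lemma quarticEval_add (a b : Fin 15 → R) (x : Fin 3 → R) :
    quarticEval (a + b) x = quarticEval a x + quarticEval b x := by
  simp only [quarticEval, Pi.add_apply]; ring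

lemma quarticEval_sub (a b : Fin 15 → R) (x : Fin 3 → R) :
    quarticEval (a - b) x = quarticEval a x - quarticEval b x := by
  simp only [quarticEval, Pi.sub_apply]; ring

lemma quarticEval_smul (c : R) (a : Fin 15 → R) (x : Fin 3 → R) :
    quarticEval (c • a) x = c * quarticEval a x := by
  simp only [quarticEval, Pi.smul_apply, smul_eq_mul]; ring

lemma quadEval_smul_point (c : R) (a : Fin 6 → R) (x : Fin 3 → R) :
    quadEval a (c • x) = c ^ 2 * quadEval a x := by
  simp only [quadEval, Pi.smul_apply, smul_eq_mul]; ring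

lemma quarticEval_smul_point (c : R) (a : Fin 15 → R) (x : Fin 3 → R) :
    quarticEval a (c • x) = c ^ 4 * quarticEval a x := by
  simp only [quarticEval, Pi.smul_apply, smul_eq_mul]; ring

/-- The quadratic form `q` after the linear substitution `x ↦ P x`. -/
def quadComp (P : Matrix (Fin 3) (Fin 3) R) (q : Fin 6 → R) : Fin 6 → R :=
  q 0 • linMul (P 0) (P 0) + q 1 • linMul (P 1) (P 1) + q 2 • linMul (P 2) (P 2) +
    q 3 • linMul (P 0) (P 1) + q 4 • linMul (P 0) (P 2) + q 5 • linMul (P 1) (P 2)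

/-- The quartic form `w` after the linear substitution `x ↦ P x`. -/
def quarticComp (P : Matrix (Fin 3) (Fin 3) R) (w : Fin 15 → R) : Fin 15 → R :=
  let a := linMul (P 0) (P 0)
  let b := linMul (P 1) (P 1)
  let c := linMul (P 2) (P 2)
  let d := linMul (P 0) (P 1)
  let e := linMul (P 0) (P 2)
  let f := linMul (P 1) (P 2)
  w 0 • quadMul a a + w 1 • quadMul b b + w 2 • quadMul c c + w 3 • quadMul a d +
    w 4 • quadMul a e + w 5 • quadMul b d + w 6 • quadMul b f + w 7 • quadMul c e +
    w 8 • quadMul c f + w 9 • quadMul a b + w 10 • quadMul a c + w 11 • quadMul b c +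
    w 12 • quadMul a f + w 13 • quadMul b e + w 14 • quadMul c d

lemma mulVec_apply_eq_linEval (P : Matrix (Fin 3) (Fin 3) R) (x : Fin 3 → R) (i : Fin 3) :
    (P.mulVec x) i = linEval (P i) x := by
  simp [Matrix.mulVec, dotProduct, Fin.sum_univ_three, linEval]

lemma quadEval_quadComp (P : Matrix (Fin 3) (Fin 3) R) (q : Fin 6 → R) (x : Fin 3 → R) :
    quadEval (quadComp P q) x = quadEval q (P.mulVec x) := by
  simp only [quadComp, quadEval_add, quadEval_smul, quadEval_linMul]
  simp only [quadEval, mulVec_apply_eq_linEval]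
  ring

lemma quarticEval_quarticComp (P : Matrix (Fin 3) (Fin 3) R) (w : Fin 15 → R) (x : Fin 3 → R) :
    quarticEval (quarticComp P w) x = quarticEval w (P.mulVec x) := by
  simp only [quarticComp, quarticEval_add, quarticEval_smul, quarticEval_quadMul, quadEval_linMul]
  simp only [quarticEval, mulVec_apply_eq_linEval]
  ring

end Eval

lemma quarticEval_injective {v w : Fin 15 → ℝ} (h : ∀ x, quarticEval v x = quarticEval w x) :
    v = w := by
  have key : ∀ x : Fin 3 → ℝ, quarticEval (v - w) x = 0 := fun x => by
    rw [quarticEval_sub, h, sub_self]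
  rw [← sub_eq_zero]
  generalize v - w = u at key
  simp only [quarticEval] at key
  have h1 := key ![1, 0, 0]
  have h2 := key ![0, 1, 0]
  have h3 := key ![0, 0, 1]
  have a1 := key ![1, 1, 0]
  have a2 := key ![1, -1, 0]
  have a3 := key ![1, 2, 0]
  have b1 := key ![1, 0, 1]
  have b2 := key ![1, 0, -1]
  have b3 := key ![1, 0, 2]
  have c1 := key ![0, 1, 1]
  have c2 := key ![0, 1, -1]
  have c3 := key ![0, 1, 2]
  have d1 := key ![1, 1, 1]
  have d2 := key ![1, 1, -1]
  have d3 := key ![1, -1, 1]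
  clear key
  simp only [Matrix.cons_val] at h1 h2 h3 a1 a2 a3 b1 b2 b3 c1 c2 c3 d1 d2 d3
  norm_num at h1 h2 h3 a1 a2 a3 b1 b2 b3 c1 c2 c3 d1 d2 d3
  ext i
  fin_cases i <;> simp only [Pi.zero_apply, Fin.reduceFinMk, Fin.zero_eta, Fin.mk_one] <;> linarith

lemma quadEval_injective {v w : Fin 6 → ℝ} (h : ∀ x, quadEval v x = quadEval w x) :
    v = w := by
  have key : ∀ x : Fin 3 → ℝ, quadEval (v - w) x = 0 := fun x => by
    rw [quadEval_sub, h, sub_self]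
  rw [← sub_eq_zero]
  generalize v - w = u at key
  simp only [quadEval] at key
  have h1 := key ![1, 0, 0]
  have h2 := key ![0, 1, 0]
  have h3 := key ![0, 0, 1]
  have a1 := key ![1, 1, 0]
  have b1 := key ![1, 0, 1]
  have c1 := key ![0, 1, 1]
  clear key
  simp only [Matrix.cons_val] at h1 h2 h3 a1 b1 c1
  norm_num at h1 h2 h3 a1 b1 c1
  ext i
  fin_cases i <;> simp only [Pi.zero_apply, Fin.reduceFinMk, Fin.zero_eta, Fin.mk_one] <;> linarith

/-- The determinant of the symmetric `2 × 2` matrix of quadratic forms with entries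
`M 0, M 1, M 2` (upper left, off-diagonal, lower right). -/
def detForm (M : Fin 3 → Fin 6 → ℝ) : Fin 15 → ℝ :=
  quadMul (M 0) (M 2) - quadMul (M 1) (M 1)

/-- The derivative of `detForm` at `M` in the direction `A`. -/
def detFormDeriv (M A : Fin 3 → Fin 6 → ℝ) : Fin 15 → ℝ :=
  quadMul (A 0) (M 2) + quadMul (M 0) (A 2) - (2 : ℝ) • quadMul (M 1) (A 1)

lemma quarticEval_detForm (M : Fin 3 → Fin 6 → ℝ) (x : Fin 3 → ℝ) :
    quarticEval (detForm M) x = quadEval (M 0) x * quadEval (M 2) x - quadEval (M 1) x ^ 2 := by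
  simp only [detForm, quarticEval_sub, quarticEval_quadMul]; ring

lemma quarticEval_detFormDeriv (M A : Fin 3 → Fin 6 → ℝ) (x : Fin 3 → ℝ) :
    quarticEval (detFormDeriv M A) x = quadEval (A 0) x * quadEval (M 2) x +
      quadEval (M 0) x * quadEval (A 2) x - 2 * (quadEval (M 1) x * quadEval (A 1) x) := by
  simp only [detFormDeriv, quarticEval_sub, quarticEval_add, quarticEval_smul, quarticEval_quadMul]

lemma detForm_smul (c : ℝ) (M : Fin 3 → Fin 6 → ℝ) : detForm (c • M) = c ^ 2 • detForm M :=
  quarticEval_injective fun x => by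
    simp only [quarticEval_detForm, quarticEval_smul, Pi.smul_apply, quadEval_smul]; ring

lemma detForm_quadComp (P : Matrix (Fin 3) (Fin 3) ℝ) (M : Fin 3 → Fin 6 → ℝ) :
    detForm (fun i => quadComp P (M i)) = quarticComp P (detForm M) :=
  quarticEval_injective fun x => by
    simp only [quarticEval_detForm, quarticEval_quarticComp, quadEval_quadComp]

lemma quadComp_quadComp (P Q : Matrix (Fin 3) (Fin 3) ℝ) (q : Fin 6 → ℝ) :
    quadComp Q (quadComp P q) = quadComp (P * Q) q :=
  quadEval_injective fun x => by simp only [quadEval_quadComp, Matrix.mulVec_mulVec]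

lemma quarticComp_quarticComp (P Q : Matrix (Fin 3) (Fin 3) ℝ) (q : Fin 15 → ℝ) :
    quarticComp Q (quarticComp P q) = quarticComp (P * Q) q :=
  quarticEval_injective fun x => by simp only [quarticEval_quarticComp, Matrix.mulVec_mulVec]

lemma quadComp_one (q : Fin 6 → ℝ) : quadComp 1 q = q :=
  quadEval_injective fun x => by simp only [quadEval_quadComp, Matrix.one_mulVec]

lemma quarticComp_one (q : Fin 15 → ℝ) : quarticComp 1 q = q :=
  quarticEval_injective fun x => by simp only [quarticEval_quarticComp, Matrix.one_mulVec]

lemma contDiff_linMul {E : Type*} [NormedAddCommGroup E] [NormedSpace ℝ E] {n : WithTop ℕ∞}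
    {f g : E → Fin 3 → ℝ} (hf : ContDiff ℝ n f) (hg : ContDiff ℝ n g) :
    ContDiff ℝ n fun t => linMul (f t) (g t) := by
  have hf' := fun i => contDiff_pi.1 hf i
  have hg' := fun i => contDiff_pi.1 hg i
  rw [contDiff_pi]
  intro i
  fin_cases i <;> simp only [linMul, Fin.reduceFinMk, Fin.zero_eta, Fin.mk_one, Matrix.cons_val] <;>
    fun_prop

lemma contDiff_quadMul {E : Type*} [NormedAddCommGroup E] [NormedSpace ℝ E] {n : WithTop ℕ∞}
    {f g : E → Fin 6 → ℝ} (hf : ContDiff ℝ n f) (hg : ContDiff ℝ n g) :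
    ContDiff ℝ n fun t => quadMul (f t) (g t) := by
  have hf' := fun i => contDiff_pi.1 hf i
  have hg' := fun i => contDiff_pi.1 hg i
  rw [contDiff_pi]
  intro i
  fin_cases i <;> simp only [quadMul, Fin.reduceFinMk, Fin.zero_eta, Fin.mk_one,
    Matrix.cons_val] <;> fun_prop

lemma continuous_linMul : Continuous fun p : (Fin 3 → ℝ) × (Fin 3 → ℝ) => linMul p.1 p.2 :=
  (contDiff_linMul (n := 0) contDiff_fst contDiff_snd).continuous

lemma continuous_quadMul : Continuous fun p : (Fin 6 → ℝ) × (Fin 6 → ℝ) => quadMul p.1 p.2 :=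
  (contDiff_quadMul (n := 0) contDiff_fst contDiff_snd).continuous

lemma continuous_quadEval : Continuous fun p : (Fin 6 → ℝ) × (Fin 3 → ℝ) => quadEval p.1 p.2 := by
  unfold quadEval; fun_prop

lemma continuous_quarticEval :
    Continuous fun p : (Fin 15 → ℝ) × (Fin 3 → ℝ) => quarticEval p.1 p.2 := by
  unfold quarticEval; fun_prop

lemma contDiff_quarticComp (P : Matrix (Fin 3) (Fin 3) ℝ) {n : WithTop ℕ∞} :
    ContDiff ℝ n (quarticComp P) := by
  unfold quarticComp; fun_prop

lemma continuous_quadComp (P : Matrix (Fin 3) (Fin 3) ℝ) : Continuous (quadComp P) := by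
  unfold quadComp; fun_prop

lemma contDiff_detForm {n : WithTop ℕ∞} : ContDiff ℝ n detForm :=
  (contDiff_quadMul (contDiff_apply ℝ _ 0) (contDiff_apply ℝ _ 2)).sub
    (contDiff_quadMul (contDiff_apply ℝ _ 1) (contDiff_apply ℝ _ 1))

open scoped MatrixOrder in
lemma exists_simultaneous_diagonalization {A B : Matrix (Fin 3) (Fin 3) ℝ} (hA : A.PosDef)
    (hB : B.IsHermitian) : ∃ (P : Matrix (Fin 3) (Fin 3) ℝ) (α : Fin 3 → ℝ), IsUnit P ∧
      P.transpose * A * P = 1 ∧ P.transpose * B * P = Matrix.diagonal α := by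
  obtain ⟨y, hy, hAy⟩ := CStarAlgebra.isStrictlyPositive_iff_eq_star_mul_self.1 hA.isStrictlyPositive
  have hy' : IsUnit y.det := (Matrix.isUnit_iff_isUnit_det y).1 hy
  have hC : (y⁻¹.transpose * B * y⁻¹).IsHermitian := by
    have := Matrix.isHermitian_conjTranspose_mul_mul (y⁻¹) hB
    simpa [Matrix.conjTranspose_eq_transpose_of_trivial] using this
  set U : Matrix (Fin 3) (Fin 3) ℝ := hC.eigenvectorUnitary.1 with hU
  have hUU : U.transpose * U = 1 := by
    have := (Matrix.mem_unitaryGroup_iff').1 hC.eigenvectorUnitary.2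
    simpa [Matrix.star_eq_conjTranspose, Matrix.conjTranspose_eq_transpose_of_trivial] using this
  have hspec := hC.spectral_theorem
  rw [Unitary.conjStarAlgAut_apply] at hspec
  have hspec' : y⁻¹.transpose * B * y⁻¹ = U * Matrix.diagonal hC.eigenvalues * U.transpose := by
    simpa [Matrix.star_eq_conjTranspose, Matrix.conjTranspose_eq_transpose_of_trivial,
      Function.comp_def] using hspec
  have hAy' : A = y.transpose * y := by
    simpa [Matrix.star_eq_conjTranspose, Matrix.conjTranspose_eq_transpose_of_trivial] using hAy
  generalize hC.eigenvalues = α at hspec'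
  clear_value U
  refine ⟨y⁻¹ * U, α, ?_, ?_, ?_⟩
  · exact ((Matrix.isUnit_nonsing_inv_iff).2 hy).mul (IsUnit.of_mul_eq_one_right _ hUU)
  · have h1 : y * y⁻¹ = 1 := Matrix.mul_nonsing_inv y hy'
    have h2 : y⁻¹.transpose * y.transpose = 1 := by
      rw [← Matrix.transpose_mul, h1, Matrix.transpose_one]
    calc (y⁻¹ * U).transpose * A * (y⁻¹ * U)
        = U.transpose * (y⁻¹.transpose * y.transpose) * (y * y⁻¹) * U := by
          rw [hAy', Matrix.transpose_mul]; simp only [Matrix.mul_assoc]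
      _ = 1 := by rw [h1, h2, Matrix.mul_one, Matrix.mul_one, hUU]
  · calc (y⁻¹ * U).transpose * B * (y⁻¹ * U)
        = U.transpose * (y⁻¹.transpose * B * y⁻¹) * U := by
          rw [Matrix.transpose_mul]; simp only [Matrix.mul_assoc]
      _ = (U.transpose * U) * Matrix.diagonal α * (U.transpose * U) := by
          rw [hspec']; simp only [Matrix.mul_assoc]
      _ = Matrix.diagonal α := by rw [hUU, Matrix.one_mul, Matrix.mul_one]

/-- The Gram matrix of a ternary quadratic form. -/
def gramMatrix (q : Fin 6 → ℝ) : Matrix (Fin 3) (Fin 3) ℝ :=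
  !![q 0, q 3 / 2, q 4 / 2; q 3 / 2, q 1, q 5 / 2; q 4 / 2, q 5 / 2, q 2]

lemma quadEval_eq_dotProduct (q : Fin 6 → ℝ) (x : Fin 3 → ℝ) :
    quadEval q x = x ⬝ᵥ (gramMatrix q).mulVec x := by
  simp [quadEval, gramMatrix, Matrix.mulVec, dotProduct, Fin.sum_univ_three]
  ring

lemma isHermitian_gramMatrix (q : Fin 6 → ℝ) : (gramMatrix q).IsHermitian := by
  ext i j
  fin_cases i <;> fin_cases j <;> simp [gramMatrix]

lemma quadEval_quadComp_eq_dotProduct (P : Matrix (Fin 3) (Fin 3) ℝ) (q : Fin 6 → ℝ)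
    (x : Fin 3 → ℝ) : quadEval (quadComp P q) x =
      x ⬝ᵥ (P.transpose * gramMatrix q * P).mulVec x := by
  rw [quadEval_quadComp, quadEval_eq_dotProduct, ← Matrix.mulVec_mulVec, ← Matrix.mulVec_mulVec,
    Matrix.dotProduct_mulVec x, Matrix.vecMul_transpose]

/-- The diagonal quadratic form with coefficients `α`. -/
def diagQuad (α : Fin 3 → ℝ) : Fin 6 → ℝ := ![α 0, α 1, α 2, 0, 0, 0]

lemma exists_quadComp_eq_diagQuad {q : Fin 6 → ℝ} (hq : ∀ x ≠ 0, 0 < quadEval q x)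
    (q' : Fin 6 → ℝ) : ∃ (P : Matrix (Fin 3) (Fin 3) ℝ) (α : Fin 3 → ℝ), IsUnit P ∧
      quadComp P q = diagQuad 1 ∧ quadComp P q' = diagQuad α := by
  have hA : (gramMatrix q).PosDef := by
    refine Matrix.PosDef.of_dotProduct_mulVec_pos (isHermitian_gramMatrix q) fun x hx => ?_
    simpa [← quadEval_eq_dotProduct] using hq x hx
  obtain ⟨P, α, hP, h1, h2⟩ := exists_simultaneous_diagonalization hA (isHermitian_gramMatrix q')
  refine ⟨P, α, hP, quadEval_injective fun x => ?_, quadEval_injective fun x => ?_⟩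
  · rw [quadEval_quadComp_eq_dotProduct, h1]
    simp [quadEval, diagQuad, dotProduct, Fin.sum_univ_three]
    ring
  · rw [quadEval_quadComp_eq_dotProduct, h2]
    simp [quadEval, diagQuad, Matrix.mulVec_diagonal, dotProduct, Fin.sum_univ_three]
    ring

/-- The three real ternary quadratic forms `M i` have a common nontrivial complex zero. -/
def HasCommonZero (M : Fin 3 → Fin 6 → ℝ) : Prop :=
  ∃ z : Fin 3 → ℂ, z ≠ 0 ∧ ∀ i, quadEval (fun j => (M i j : ℂ)) z = 0

/-- Every quartic form lies in the ideal generated by the quadratic forms `M i`. -/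
def GeneratesQuartics (M : Fin 3 → Fin 6 → ℝ) : Prop :=
  ∀ w, ∃ A : Fin 3 → Fin 6 → ℝ,
    quadMul (A 0) (M 0) + quadMul (A 1) (M 1) + quadMul (A 2) (M 2) = w

lemma ofReal_quadComp (P : Matrix (Fin 3) (Fin 3) ℝ) (q : Fin 6 → ℝ) :
    (fun j => ((quadComp P q j : ℝ) : ℂ)) =
      quadComp (P.map fun r : ℝ => (r : ℂ)) fun j => (q j : ℂ) := by
  ext j
  fin_cases j <;>
    simp only [quadComp, linMul, Pi.add_apply, Pi.smul_apply, smul_eq_mul, Matrix.map_apply,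
      Fin.reduceFinMk, Fin.zero_eta, Fin.mk_one, Matrix.cons_val] <;> push_cast <;> rfl

lemma HasCommonZero.of_quadComp {P : Matrix (Fin 3) (Fin 3) ℝ} (hP : IsUnit P)
    {M : Fin 3 → Fin 6 → ℝ} (h : HasCommonZero fun i => quadComp P (M i)) : HasCommonZero M := by
  obtain ⟨z, hz, h⟩ := h
  refine ⟨(P.map fun r : ℝ => (r : ℂ)).mulVec z, fun h0 => hz ?_, fun i => ?_⟩
  · have : IsUnit (P.map fun r : ℝ => (r : ℂ)) := hP.map (Complex.ofRealHom.mapMatrix)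
    refine Matrix.mulVec_injective_of_isUnit this ?_
    simp only [h0, Matrix.mulVec_zero]
  · have := h i
    rwa [ofReal_quadComp, quadEval_quadComp] at this

lemma GeneratesQuartics.of_quadComp {P : Matrix (Fin 3) (Fin 3) ℝ} (hP : IsUnit P)
    {M : Fin 3 → Fin 6 → ℝ} (h : GeneratesQuartics fun i => quadComp P (M i)) :
    GeneratesQuartics M := by
  intro w
  have hP' : P * P⁻¹ = 1 := Matrix.mul_nonsing_inv P ((Matrix.isUnit_iff_isUnit_det P).1 hP)
  obtain ⟨A, hA⟩ := h (quarticComp P w)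
  refine ⟨fun i => quadComp P⁻¹ (A i), quarticEval_injective fun x => ?_⟩
  have := congrArg (fun v => quarticEval v (P⁻¹.mulVec x)) hA
  simpa only [quarticEval_add, quarticEval_quadMul, quadEval_quadComp, quarticEval_quarticComp,
    Matrix.mulVec_mulVec, hP', Matrix.one_mulVec] using this

lemma HasCommonZero.swap {M : Fin 3 → Fin 6 → ℝ} (h : HasCommonZero ![M 0, M 2, M 1]) :
    HasCommonZero M := by
  obtain ⟨z, hz, h⟩ := h
  refine ⟨z, hz, fun i => ?_⟩
  fin_cases i
  exacts [h 0, h 2, h 1]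

lemma GeneratesQuartics.swap {M : Fin 3 → Fin 6 → ℝ} (h : GeneratesQuartics ![M 0, M 2, M 1]) :
    GeneratesQuartics M := by
  intro w
  obtain ⟨A, hA⟩ := h w
  exact ⟨![A 0, A 2, A 1], by rw [← hA]; exact add_right_comm _ _ _⟩

/-- The matrix of multiplication by the quadratic form `q` from the span of `x₂², x₀x₂, x₁x₂, x₀x₁`
to the span of `x₂⁴, x₀x₂³, x₁x₂³, x₀x₁x₂²`, modulo `x₀² - s x₂²` and `x₁² - t x₂²`. -/
def reducedMulMatrix (s t : ℝ) (q : Fin 6 → ℝ) : Matrix (Fin 4) (Fin 4) ℝ :=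
  let d := q 2 + s * q 0 + t * q 1
  !![d, q 4 * s, q 5 * t, q 3 * s * t;
     q 4, d, q 3 * t, q 5 * t;
     q 5, q 3 * s, d, q 4 * s;
     q 3, q 5, q 4, d]

lemma exists_zero_of_det_reducedMulMatrix {s t : ℝ} {q : Fin 6 → ℝ}
    (h : (reducedMulMatrix s t q).det = 0) : ∃ σ τ : ℂ, σ ^ 2 = s ∧ τ ^ 2 = t ∧
      quadEval (fun j => (q j : ℂ)) ![σ, τ, 1] = 0 := by
  obtain ⟨σ, hσ⟩ := IsAlgClosed.exists_pow_nat_eq (s : ℂ) (n := 2) (by norm_num)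
  obtain ⟨τ, hτ⟩ := IsAlgClosed.exists_pow_nat_eq (t : ℂ) (n := 2) (by norm_num)
  have key : quadEval (fun j => (q j : ℂ)) ![σ, τ, 1] * quadEval (fun j => (q j : ℂ)) ![-σ, τ, 1] *
      quadEval (fun j => (q j : ℂ)) ![σ, -τ, 1] * quadEval (fun j => (q j : ℂ)) ![-σ, -τ, 1] =
      ((reducedMulMatrix s t q).det : ℂ) := by
    have hdet : ((reducedMulMatrix s t q).det : ℂ) =
        ((reducedMulMatrix s t q).map (fun r : ℝ => (r : ℂ))).det :=
      RingHom.map_det Complex.ofRealHom _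
    rw [hdet]
    simp [reducedMulMatrix, Matrix.det_succ_row_zero, Fin.sum_univ_succ, quadEval,
      Fin.succAbove, ← hσ, ← hτ]
    ring
  rw [h, Complex.ofReal_zero, mul_eq_zero, mul_eq_zero, mul_eq_zero] at key
  rcases key with ((key | key) | key) | key
  · exact ⟨σ, τ, hσ, hτ, key⟩
  · exact ⟨-σ, τ, by rw [neg_sq, hσ], hτ, key⟩
  · exact ⟨σ, -τ, hσ, by rw [neg_sq, hτ], key⟩
  · exact ⟨-σ, -τ, by rw [neg_sq, hσ], by rw [neg_sq, hτ], key⟩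

/-- The normal form of a quartic form modulo `x₀² - s x₂²` and `x₁² - t x₂²`, in terms of
`x₂⁴, x₀x₂³, x₁x₂³, x₀x₁x₂²`. -/
def normalForm (s t : ℝ) (w : Fin 15 → ℝ) : Fin 4 → ℝ :=
  ![w 2 + s * w 10 + t * w 11 + s ^ 2 * w 0 + t ^ 2 * w 1 + s * t * w 9,
    w 7 + s * w 4 + t * w 13,
    w 8 + t * w 6 + s * w 12,
    w 14 + s * w 3 + t * w 5]

lemma normalForm_quadMul (s t : ℝ) (q : Fin 6 → ℝ) (c : Fin 4 → ℝ) :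
    normalForm s t (quadMul ![0, 0, c 0, c 3, c 1, c 2] q) =
      (reducedMulMatrix s t q).mulVec c := by
  ext i
  fin_cases i <;> simp [normalForm, quadMul, reducedMulMatrix, Matrix.mulVec, dotProduct,
    Fin.sum_univ_four] <;> ring

lemma eq_of_normalForm_eq_zero {s t : ℝ} {w : Fin 15 → ℝ} (h : normalForm s t w = 0) :
    quadMul ![w 0, w 9, w 10 + w 0 * s, w 3, w 4, w 12] ![1, 0, -s, 0, 0, 0] +
      quadMul ![0, w 1, w 11 + s * w 9 + t * w 1, w 5, w 13, w 6] ![0, 1, -t, 0, 0, 0] = w := by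
  have h0 := congrFun h 0
  have h1 := congrFun h 1
  have h2 := congrFun h 2
  have h3 := congrFun h 3
  simp only [normalForm, Matrix.cons_val, Pi.zero_apply] at h0 h1 h2 h3
  ext i
  fin_cases i <;> simp only [Pi.add_apply, quadMul, Fin.reduceFinMk, Fin.zero_eta, Fin.mk_one,
    Matrix.cons_val] <;> linarith

lemma generatesQuartics_of_diagQuad {M : Fin 3 → Fin 6 → ℝ} (hM : ¬ HasCommonZero M)
    {α : Fin 3 → ℝ} (h0 : M 0 = diagQuad 1) (h1 : M 1 = diagQuad α) (hα : α 0 ≠ α 1) :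
    GeneratesQuartics M := by
  have hα' : α 0 - α 1 ≠ 0 := sub_ne_zero.2 hα
  set s := (α 1 - α 2) / (α 0 - α 1) with hs
  set t := (α 2 - α 0) / (α 0 - α 1) with ht
  have hst : s + t + 1 = 0 := by rw [hs, ht]; field_simp; ring
  have hst' : α 0 * s + α 1 * t + α 2 = 0 := by rw [hs, ht]; field_simp; ring
  have hdet : (reducedMulMatrix s t (M 2)).det ≠ 0 := by
    intro h
    obtain ⟨σ, τ, hσ, hτ, hz⟩ := exists_zero_of_det_reducedMulMatrix h
    refine hM ⟨![σ, τ, 1], fun h => one_ne_zero (congrFun h 2), fun i => ?_⟩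
    have e0 : (s : ℂ) + t + 1 = 0 := by exact_mod_cast hst
    have e1 : (α 0 : ℂ) * s + α 1 * t + α 2 = 0 := by exact_mod_cast hst'
    fin_cases i
    · simp [h0, diagQuad, quadEval, hσ, hτ, e0]
    · simp [h1, diagQuad, quadEval, hσ, hτ, e1]
    · exact hz
  intro w
  obtain ⟨c, hc⟩ := (Matrix.mulVec_surjective_iff_isUnit.2
    ((Matrix.isUnit_iff_isUnit_det _).2 hdet.isUnit)) (normalForm s t w)
  set C : Fin 6 → ℝ := ![0, 0, c 0, c 3, c 1, c 2] with hC
  have hnf : normalForm s t (w - quadMul C (M 2)) = 0 := by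
    have e : normalForm s t (w - quadMul C (M 2)) =
        normalForm s t w - normalForm s t (quadMul C (M 2)) := by
      ext i
      fin_cases i <;> simp only [normalForm, Pi.sub_apply, Fin.reduceFinMk, Fin.zero_eta,
        Fin.mk_one, Matrix.cons_val] <;> ring
    rw [e, normalForm_quadMul, hc, sub_self]
  have hdec := eq_of_normalForm_eq_zero hnf
  obtain ⟨a, b, hab⟩ : ∃ a b, quadMul a ![1, 0, -s, 0, 0, 0] + quadMul b ![0, 1, -t, 0, 0, 0] =
      w - quadMul C (M 2) := ⟨_, _, hdec⟩
  have hp1 : ![1, 0, -s, 0, 0, 0] = (α 0 - α 1)⁻¹ • (M 1 - α 1 • M 0) := by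
    ext i
    fin_cases i <;> simp [h0, h1, diagQuad, hs] <;> field_simp
    ring
  have hp2 : ![0, 1, -t, 0, 0, 0] = (α 0 - α 1)⁻¹ • (α 0 • M 0 - M 1) := by
    ext i
    fin_cases i <;> simp [h0, h1, diagQuad, ht] <;> field_simp
    ring
  refine ⟨![(α 0 - α 1)⁻¹ • (α 0 • b - α 1 • a), (α 0 - α 1)⁻¹ • (a - b), C],
    quarticEval_injective fun x => ?_⟩
  have hx := congrArg (fun v => quarticEval v x) hab
  simp only [hp1, hp2, quarticEval_add, quarticEval_sub, quarticEval_quadMul, quadEval_smul,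
    quadEval_sub, Matrix.cons_val] at hx ⊢
  linear_combination hx

lemma exists_isUnit_quadComp_diagQuad {α : Fin 3 → ℝ} (hα : ¬ (α 0 = α 1 ∧ α 1 = α 2)) :
    ∃ (P : Matrix (Fin 3) (Fin 3) ℝ) (β : Fin 3 → ℝ), IsUnit P ∧
      quadComp P (diagQuad 1) = diagQuad 1 ∧ quadComp P (diagQuad α) = diagQuad β ∧
      β 0 ≠ β 1 := by
  by_cases h01 : α 0 = α 1
  · refine ⟨!![1, 0, 0; 0, 0, 1; 0, 1, 0], ![α 0, α 2, α 1], ?_, ?_, ?_, ?_⟩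
    · exact IsUnit.of_mul_eq_one (!![1, 0, 0; 0, 0, 1; 0, 1, 0]) (by
        ext i j; fin_cases i <;> fin_cases j <;> simp [Matrix.mul_apply, Fin.sum_univ_three])
    · ext i; fin_cases i <;> simp [quadComp, diagQuad, linMul]
    · ext i; fin_cases i <;> simp [quadComp, diagQuad, linMul]
    · simp only [Matrix.cons_val]
      exact fun h => hα ⟨h01, h01.symm.trans h⟩
  · exact ⟨1, α, isUnit_one, quadComp_one _, quadComp_one _, h01⟩

lemma generatesQuartics_of_not_proportional {M : Fin 3 → Fin 6 → ℝ} (hM : ¬ HasCommonZero M)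
    (h0 : ∀ x ≠ 0, 0 < quadEval (M 0) x) (h1 : ∀ c : ℝ, M 1 ≠ c • M 0) : GeneratesQuartics M := by
  obtain ⟨P, α, hP, hP0, hP1⟩ := exists_quadComp_eq_diagQuad h0 (M 1)
  have hα : ¬ (α 0 = α 1 ∧ α 1 = α 2) := by
    rintro ⟨h01, h12⟩
    refine h1 (α 0) ?_
    have hPP : P * P⁻¹ = 1 := Matrix.mul_nonsing_inv P ((Matrix.isUnit_iff_isUnit_det P).1 hP)
    have hd : quadComp P (M 1) = quadComp P (α 0 • M 0) := by
      refine quadEval_injective fun x => ?_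
      rw [quadEval_quadComp P (α 0 • M 0), quadEval_smul, ← quadEval_quadComp, hP0, hP1]
      simp only [quadEval, diagQuad, Matrix.cons_val, ← h12, ← h01, Pi.one_apply]
      ring
    rw [← quadComp_one (M 1), ← hPP, ← quadComp_quadComp, hd, quadComp_quadComp, hPP, quadComp_one]
  obtain ⟨Q, β, hQ, hQ0, hQ1, hβ⟩ := exists_isUnit_quadComp_diagQuad hα
  have hPQ : IsUnit (P * Q) := hP.mul hQ
  refine GeneratesQuartics.of_quadComp hPQ (generatesQuartics_of_diagQuad
    (fun h => hM (HasCommonZero.of_quadComp hPQ h)) (α := β) ?_ ?_ hβ)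
  · rw [← quadComp_quadComp, hP0, hQ0]
  · rw [← quadComp_quadComp, hP1, hQ1]

lemma generatesQuartics_of_not_hasCommonZero {M : Fin 3 → Fin 6 → ℝ} (hM : ¬ HasCommonZero M)
    (h0 : ∀ x ≠ 0, 0 < quadEval (M 0) x) : GeneratesQuartics M := by
  by_cases h1 : ∀ c : ℝ, M 1 ≠ c • M 0
  · exact generatesQuartics_of_not_proportional hM h0 h1
  by_cases h2 : ∀ c : ℝ, M 2 ≠ c • M 0
  · exact GeneratesQuartics.swap
      (generatesQuartics_of_not_proportional (fun h => hM h.swap) h0 h2)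
  push Not at h1 h2
  obtain ⟨c, hc⟩ := h1
  obtain ⟨d, hd⟩ := h2
  obtain ⟨P, -, hP, hP0, -⟩ := exists_quadComp_eq_diagQuad h0 (M 1)
  refine absurd (HasCommonZero.of_quadComp hP ⟨![1, Complex.I, 0], fun h =>
    one_ne_zero (congrFun h 0), ?_⟩) hM
  have key : ∀ r : ℝ, quadComp P (r • M 0) = r • diagQuad 1 := fun r =>
    quadEval_injective fun x => by
      rw [quadEval_quadComp, quadEval_smul, ← quadEval_quadComp, hP0, quadEval_smul]
  intro i
  obtain ⟨r, hr⟩ : ∃ r : ℝ, M i = r • M 0 := by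
    fin_cases i
    exacts [⟨1, (one_smul ℝ (M 0)).symm⟩, ⟨c, hc⟩, ⟨d, hd⟩]
  simp only [hr, key]
  simp [quadEval, diagQuad]

lemma fderiv_detForm_apply (M A : Fin 3 → Fin 6 → ℝ) :
    fderiv ℝ detForm M A = detFormDeriv M A := by
  have h1 : HasDerivAt (fun t : ℝ => detForm (M + t • A)) (fderiv ℝ detForm M A) 0 := by
    have hd : HasFDerivAt detForm (fderiv ℝ detForm M) (M + (0 : ℝ) • A) := by
      rw [zero_smul, add_zero]
      exact (contDiff_detForm (n := 1)).differentiable (by norm_num) M |>.hasFDerivAt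
    have hl : HasDerivAt (fun t : ℝ => M + t • A) A 0 := by
      simpa using ((hasDerivAt_id (0 : ℝ)).smul_const A).const_add M
    exact hd.comp_hasDerivAt 0 hl
  have h2 : HasDerivAt (fun t : ℝ => detForm (M + t • A)) (detFormDeriv M A) 0 := by
    have e : (fun t : ℝ => detForm (M + t • A)) =
        fun t => detForm M + t • detFormDeriv M A + t ^ 2 • detForm A := by
      ext1 t
      refine quarticEval_injective fun x => ?_
      simp only [quarticEval_add, quarticEval_smul, quarticEval_detForm, quarticEval_detFormDeriv,
        Pi.add_apply, Pi.smul_apply, quadEval_add, quadEval_smul]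
      ring
    rw [e]
    refine HasDerivAt.congr_deriv ((((hasDerivAt_id (0 : ℝ)).smul_const
      (detFormDeriv M A)).const_add (detForm M)).add
        (((hasDerivAt_id (0 : ℝ)).pow 2).smul_const (detForm A))) ?_
    simp
  exact h1.unique h2

lemma range_detForm_mem_nhds {M : Fin 3 → Fin 6 → ℝ} (hM : ¬ HasCommonZero M)
    (h0 : ∀ x ≠ 0, 0 < quadEval (M 0) x) : range detForm ∈ 𝓝 (detForm M) := by
  have hs : HasStrictFDerivAt detForm (fderiv ℝ detForm M) M :=
    (contDiff_detForm (n := 1)).contDiffAt.hasStrictFDerivAt (by norm_num)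
  rw [← hs.map_nhds_eq_of_surj]
  · exact image_univ (f := detForm) ▸ image_mem_map univ_mem
  · rw [LinearMap.range_eq_top]
    intro w
    obtain ⟨A, hA⟩ := generatesQuartics_of_not_hasCommonZero hM h0 w
    refine ⟨![A 2, (-1 / 2 : ℝ) • A 1, A 0], ?_⟩
    rw [ContinuousLinearMap.coe_coe, fderiv_detForm_apply, ← hA]
    refine quarticEval_injective fun x => ?_
    simp only [quarticEval_detFormDeriv, quarticEval_add, quarticEval_quadMul, Matrix.cons_val,
      quadEval_smul]
    ring

/-- A 13-parameter family of quartic forms containing, up to a permutation of the coordinates, the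
determinants of the matrices whose entries have a common nonreal zero. -/
def degenerateForm (p : Fin 13 → ℝ) : Fin 15 → ℝ :=
  let L : Fin 3 → ℝ := ![p 0, p 1, 1]
  let Q : Fin 6 → ℝ := ![1, p 3, 0, p 2, 0, 0]
  quadMul (linMul L L) ![p 7, p 8, p 9, p 10, p 11, p 12] +
    quadMul (linMul L ![p 4, p 5, 0]) Q + p 6 • quadMul Q Q

lemma contDiff_degenerateForm : ContDiff ℝ 1 degenerateForm := by
  have hL : ContDiff ℝ 1 fun p : Fin 13 → ℝ => (![p 0, p 1, 1] : Fin 3 → ℝ) := by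
    rw [contDiff_pi]
    intro i
    fin_cases i <;> simp <;> fun_prop
  have hl : ContDiff ℝ 1 fun p : Fin 13 → ℝ => (![p 4, p 5, 0] : Fin 3 → ℝ) := by
    rw [contDiff_pi]
    intro i
    fin_cases i <;> simp <;> fun_prop
  have hQ : ContDiff ℝ 1 fun p : Fin 13 → ℝ => (![1, p 3, 0, p 2, 0, 0] : Fin 6 → ℝ) := by
    rw [contDiff_pi]
    intro i
    fin_cases i <;> simp <;> fun_prop
  have hq : ContDiff ℝ 1 fun p : Fin 13 → ℝ =>
      (![p 7, p 8, p 9, p 10, p 11, p 12] : Fin 6 → ℝ) := by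
    rw [contDiff_pi]
    intro i
    fin_cases i <;> simp <;> fun_prop
  exact ((contDiff_quadMul (contDiff_linMul hL hL) hq).add
    (contDiff_quadMul (contDiff_linMul hL hl) hQ)).add
      ((contDiff_apply ℝ ℝ 6).smul (contDiff_quadMul hQ hQ))

lemma detForm_mem_range_degenerateForm_of_eq {M : Fin 3 → Fin 6 → ℝ} {a b g h : ℝ} (f : Fin 3 → ℝ)
    (m : Fin 3 → Fin 3 → ℝ)
    (hM : ∀ i, M i = f i • ![1, h, 0, g, 0, 0] + linMul ![a, b, 1] (m i)) :
    detForm M ∈ range degenerateForm := by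
  set k : Fin 3 → ℝ := f 0 • m 2 + f 2 • m 0 - (2 * f 1) • m 1 with hk
  set q : Fin 6 → ℝ := linMul (m 0) (m 2) - linMul (m 1) (m 1) + k 2 • ![1, h, 0, g, 0, 0] with hq
  refine ⟨![a, b, g, h, k 0 - k 2 * a, k 1 - k 2 * b, f 0 * f 2 - f 1 ^ 2, q 0, q 1, q 2, q 3, q 4,
    q 5], quarticEval_injective fun x => ?_⟩
  have hqx : ![q 0, q 1, q 2, q 3, q 4, q 5] = q := by
    ext i; fin_cases i <;> rfl
  simp only [degenerateForm, Matrix.cons_val, hqx]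
  rw [quarticEval_detForm]
  simp only [quarticEval_add, quarticEval_quadMul, quarticEval_smul, quadEval_linMul, hM,
    quadEval_add, quadEval_smul, hq, quadEval_sub]
  generalize quadEval ![1, h, 0, g, 0, 0] x = Q
  have hl : linEval ![k 0 - k 2 * a, k 1 - k 2 * b, 0] x =
      f 0 * linEval (m 2) x + f 2 * linEval (m 0) x - 2 * f 1 * linEval (m 1) x -
        k 2 * linEval ![a, b, 1] x := by
    simp only [hk, linEval, Matrix.cons_val, Pi.add_apply, Pi.sub_apply, Pi.smul_apply, smul_eq_mul]
    ring
  rw [hl]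
  ring

lemma detForm_mem_range_degenerateForm {M : Fin 3 → Fin 6 → ℝ} {u v : Fin 3 → ℝ}
    (h1 : ∀ i, quadEval (M i) u = quadEval (M i) v)
    (h2 : ∀ i, quadEval (M i) (u + v) = quadEval (M i) u + quadEval (M i) v)
    (hn : u 0 * v 1 - u 1 * v 0 ≠ 0) : detForm M ∈ range degenerateForm := by
  set n := u 0 * v 1 - u 1 * v 0 with hn'
  set D := u 1 ^ 2 + v 1 ^ 2 with hD'
  have hD : D ≠ 0 := by
    intro h
    have hu : u 1 = 0 := by nlinarith [sq_nonneg (u 1), sq_nonneg (v 1)]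
    have hv : v 1 = 0 := by nlinarith [sq_nonneg (u 1), sq_nonneg (v 1)]
    exact hn (by rw [hn', hu, hv]; ring)
  obtain ⟨a, ha⟩ : ∃ a, a * n = u 1 * v 2 - u 2 * v 1 := ⟨_ / n, div_mul_cancel₀ _ hn⟩
  obtain ⟨b, hb⟩ : ∃ b, b * n = u 2 * v 0 - u 0 * v 2 := ⟨_ / n, div_mul_cancel₀ _ hn⟩
  have hu2 : u 2 = -a * u 0 - b * u 1 := by
    apply mul_right_cancel₀ hn
    linear_combination u 0 * ha + u 1 * hb + u 2 * hn'
  have hv2 : v 2 = -a * v 0 - b * v 1 := by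
    apply mul_right_cancel₀ hn
    linear_combination v 0 * ha + v 1 * hb + v 2 * hn'
  refine detForm_mem_range_degenerateForm_of_eq (a := a) (b := b)
    (g := -2 * (u 0 * u 1 + v 0 * v 1) / D) (h := (u 0 ^ 2 + v 0 ^ 2) / D)
    (fun i => M i 0 + a ^ 2 * M i 2 - a * M i 4)
    (fun i => ![M i 4 - a * M i 2, M i 5 - b * M i 2, M i 2]) fun i => ?_
  have h1 := h1 i
  have h2 := h2 i
  generalize M i = q at h1 h2 ⊢
  simp only [quadEval, Pi.add_apply, hu2, hv2] at h1 h2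
  set f := q 0 + a ^ 2 * q 2 - a * q 4 with hf
  have eg : q 3 + 2 * a * b * q 2 - b * q 4 - a * q 5 =
      f * (-2 * (u 0 * u 1 + v 0 * v 1) / D) := by
    rw [← mul_div_assoc, eq_div_iff hD]
    apply mul_right_cancel₀ hn
    rw [hf, hD', hn']
    linear_combination (2 * u 1 * v 1) * h1 - (u 1 ^ 2 - v 1 ^ 2) * h2
  have eh : q 1 + b ^ 2 * q 2 - b * q 5 = f * ((u 0 ^ 2 + v 0 ^ 2) / D) := by
    rw [← mul_div_assoc, eq_div_iff hD]
    apply mul_right_cancel₀ hn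
    rw [hf, hD', hn']
    linear_combination (u 0 * u 1 - v 0 * v 1) * h2 - (u 0 * v 1 + u 1 * v 0) * h1
  ext j
  fin_cases j <;> simp [linMul, hf]
  · ring
  · linear_combination eh
  · linear_combination eg

/-- The permutation matrix exchanging the coordinates `k` and `2`. -/
def swapMatrix (k : Fin 3) : Matrix (Fin 3) (Fin 3) ℝ := (Equiv.swap k 2).permMatrix ℝ

lemma swapMatrix_mulVec (k : Fin 3) (x : Fin 3 → ℝ) :
    (swapMatrix k).mulVec x = x ∘ Equiv.swap k 2 := by
  rw [swapMatrix, Matrix.permMatrix_mulVec]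

lemma swapMatrix_mul_self (k : Fin 3) : swapMatrix k * swapMatrix k = 1 := by
  rw [swapMatrix, ← Matrix.permMatrix_mul, Equiv.swap_mul_self, Matrix.permMatrix_one]

/-- The quartic forms that `degenerateForm` parametrizes, up to a permutation of coordinates. -/
def degenerateSet : Set (Fin 15 → ℝ) :=
  ⋃ k : Fin 3, range fun p => quarticComp (swapMatrix k) (degenerateForm p)

lemma exists_real_of_hasCommonZero {M : Fin 3 → Fin 6 → ℝ} (h : HasCommonZero M) :
    ∃ u v : Fin 3 → ℝ, (u ≠ 0 ∨ v ≠ 0) ∧ (∀ i, quadEval (M i) u = quadEval (M i) v) ∧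
      ∀ i, quadEval (M i) (u + v) = quadEval (M i) u + quadEval (M i) v := by
  obtain ⟨z, hz, h⟩ := h
  refine ⟨fun j => (z j).re, fun j => (z j).im, ?_, fun i => ?_, fun i => ?_⟩
  · by_contra! hc
    exact hz (funext fun j => Complex.ext (congrFun hc.1 j) (congrFun hc.2 j))
  · have := congrArg Complex.re (h i)
    simp [quadEval, pow_two] at this
    simp only [quadEval]
    linear_combination this
  · have := congrArg Complex.im (h i)
    simp [quadEval, pow_two] at this
    simp only [quadEval, Pi.add_apply]
    linear_combination this

lemma exists_cross_ne_zero {M : Fin 3 → Fin 6 → ℝ} (hM : ∀ x ≠ 0, 0 < quarticEval (detForm M) x)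
    {u v : Fin 3 → ℝ} (h0 : u ≠ 0 ∨ v ≠ 0) (h1 : ∀ i, quadEval (M i) u = quadEval (M i) v)
    (h2 : ∀ i, quadEval (M i) (u + v) = quadEval (M i) u + quadEval (M i) v) :
    ∃ i j, u i * v j - u j * v i ≠ 0 := by
  by_contra! hc
  have hzero : ∀ i, quadEval (M i) u = 0 := by
    intro i
    have h1 := h1 i
    have h2 := h2 i
    obtain ⟨k, hk⟩ : ∃ k, u k ^ 2 + v k ^ 2 ≠ 0 := by
      by_contra! hk
      rcases h0 with h0 | h0
      · exact h0 (funext fun k => pow_eq_zero_iff two_ne_zero |>.1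
          (by nlinarith [hk k, sq_nonneg (u k), sq_nonneg (v k)]))
      · exact h0 (funext fun k => pow_eq_zero_iff two_ne_zero |>.1
          (by nlinarith [hk k, sq_nonneg (u k), sq_nonneg (v k)]))
    have hv : u k • v = v k • u := funext fun j => by
      simp only [Pi.smul_apply, smul_eq_mul]; linear_combination hc k j
    have e1 : u k ^ 2 * quadEval (M i) v = v k ^ 2 * quadEval (M i) u := by
      rw [← quadEval_smul_point, hv, quadEval_smul_point]
    have e2 : u k ^ 2 * quadEval (M i) (u + v) = (u k + v k) ^ 2 * quadEval (M i) u := by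
      rw [← quadEval_smul_point, smul_add, hv, ← add_smul, quadEval_smul_point]
    rw [h2, ← h1] at e2
    rw [← h1] at e1
    have e3 : (u k ^ 2 + v k ^ 2) ^ 2 * quadEval (M i) u = 0 := by
      linear_combination (u k ^ 2 - v k ^ 2) * e1 - 2 * u k * v k * (e2 - e1)
    exact (mul_eq_zero.1 e3).resolve_left (pow_ne_zero 2 hk)
  rcases h0 with h0 | h0
  · have := hM u h0
    simp [quarticEval_detForm, hzero] at this
  · have := hM v h0
    simp [quarticEval_detForm, ← h1, hzero] at this

lemma detForm_mem_degenerateSet {M : Fin 3 → Fin 6 → ℝ}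
    (hM : ∀ x ≠ 0, 0 < quarticEval (detForm M) x) (h : HasCommonZero M) :
    detForm M ∈ degenerateSet := by
  obtain ⟨u, v, h0, h1, h2⟩ := exists_real_of_hasCommonZero h
  obtain ⟨i, j, hij⟩ := exists_cross_ne_zero hM h0 h1 h2
  have hcomp : ∀ (k : Fin 3) (l : Fin 3) (x : Fin 3 → ℝ),
      quadEval (quadComp (swapMatrix k) (M l)) (x ∘ Equiv.swap k 2) = quadEval (M l) x := by
    intro k l x
    rw [← swapMatrix_mulVec, quadEval_quadComp, Matrix.mulVec_mulVec, swapMatrix_mul_self,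
      Matrix.one_mulVec]
  obtain ⟨k, hk⟩ : ∃ k : Fin 3, (u ∘ Equiv.swap k 2) 0 * (v ∘ Equiv.swap k 2) 1 -
      (u ∘ Equiv.swap k 2) 1 * (v ∘ Equiv.swap k 2) 0 ≠ 0 := by
    by_contra! hc
    have c0 := hc 0
    have c1 := hc 1
    have c2 := hc 2
    have s0 : Equiv.swap (0 : Fin 3) 2 0 = 2 := by decide
    have s1 : Equiv.swap (0 : Fin 3) 2 1 = 1 := by decide
    have s2 : Equiv.swap (1 : Fin 3) 2 0 = 0 := by decide
    have s3 : Equiv.swap (1 : Fin 3) 2 1 = 2 := by decide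
    simp only [Function.comp_apply, s0, s1, s2, s3, Equiv.swap_self, Equiv.refl_apply] at c0 c1 c2
    apply hij
    fin_cases i <;> fin_cases j <;>
      simp only [Fin.reduceFinMk, Fin.zero_eta, Fin.mk_one] <;> linarith
  refine mem_iUnion.2 ⟨k, ?_⟩
  obtain ⟨p, hp⟩ := detForm_mem_range_degenerateForm
    (M := fun i => quadComp (swapMatrix k) (M i)) (u := u ∘ Equiv.swap k 2)
    (v := v ∘ Equiv.swap k 2) (fun i => by rw [hcomp, hcomp, h1])
    (fun i => by
      rw [hcomp, hcomp, ← h2, ← hcomp k i (u + v)]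
      rfl) hk
  refine ⟨p, ?_⟩
  change quarticComp (swapMatrix k) (degenerateForm p) = detForm M
  rw [hp, detForm_quadComp, quarticComp_quarticComp, swapMatrix_mul_self, quarticComp_one]

/-- The union of the lines joining `F` to the points of `degenerateSet`. -/
def degenerateCone (F : Fin 15 → ℝ) : Set (Fin 15 → ℝ) :=
  {G | ∃ S ∈ degenerateSet, ∃ s : ℝ, G = F + s • (S - F)}

lemma dense_compl_degenerateCone (F : Fin 15 → ℝ) : Dense (degenerateCone F)ᶜ := by
  refine dense_compl_of_dimH_lt_finrank ?_
  have hsub : degenerateCone F ⊆ ⋃ k : Fin 3, range fun p : (Fin 13 → ℝ) × ℝ =>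
      F + p.2 • (quarticComp (swapMatrix k) (degenerateForm p.1) - F) := by
    rintro G ⟨S, hS, s, rfl⟩
    obtain ⟨k, p, rfl⟩ := mem_iUnion.1 hS
    exact mem_iUnion.2 ⟨k, (p, s), rfl⟩
  refine (dimH_mono hsub).trans_lt ?_
  rw [dimH_iUnion]
  refine (iSup_le fun k => ?_ : _ ≤ (14 : ENNReal)).trans_lt (by simp; norm_num)
  refine (ContDiff.dimH_range_le ?_).trans (by simp)
  exact contDiff_const.add (contDiff_snd.smul ((((contDiff_quarticComp (swapMatrix k)).comp
    contDiff_degenerateForm).comp contDiff_fst).sub contDiff_const))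

/-- The positive definite quartic forms. -/
def posQuartics : Set (Fin 15 → ℝ) := {w | ∀ x ≠ 0, 0 < quarticEval w x}

lemma quadEval_pos_or_neg {M : Fin 3 → Fin 6 → ℝ} (hM : detForm M ∈ posQuartics) :
    (∀ x ≠ 0, 0 < quadEval (M 0) x) ∨ ∀ x ≠ 0, quadEval (M 0) x < 0 := by
  have hne : ∀ x ≠ 0, quadEval (M 0) x ≠ 0 := by
    intro x hx h
    have := hM x hx
    rw [quarticEval_detForm, h] at this
    nlinarith [sq_nonneg (quadEval (M 1) x)]
  by_contra! h
  obtain ⟨⟨x, hx, hx'⟩, y, hy, hy'⟩ := h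
  have hcon : IsPreconnected ({0}ᶜ : Set (Fin 3 → ℝ)) :=
    (isConnected_compl_singleton_of_one_lt_rank (by simp) 0).isPreconnected
  have hcont : Continuous (quadEval (M 0)) :=
    continuous_quadEval.comp (continuous_const.prodMk continuous_id)
  obtain ⟨z, hz, hz'⟩ := hcon.intermediate_value hx hy hcont.continuousOn ⟨hx', hy'⟩
  exact hne z hz hz'

lemma exists_pos_of_mem_range_detForm {w : Fin 15 → ℝ} (hw : w ∈ posQuartics)
    (h : w ∈ range detForm) :
    ∃ M, detForm M = w ∧ ∀ x ≠ 0, 0 < quadEval (M 0) x := by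
  obtain ⟨M, rfl⟩ := h
  rcases quadEval_pos_or_neg hw with h | h
  · exact ⟨M, rfl, h⟩
  · refine ⟨(-1 : ℝ) • M, by rw [detForm_smul]; norm_num, fun x hx => ?_⟩
    rw [Pi.smul_apply, quadEval_smul]
    linarith [h x hx]

/-- The trace of a ternary quadratic form. -/
def quadTrace (q : Fin 6 → ℝ) : ℝ := q 0 + q 1 + q 2

/-- The positive semidefinite matrices of quadratic forms whose matrix of traces is the
identity. -/
def normalizedPencils : Set (Fin 3 → Fin 6 → ℝ) :=
  {N | quadTrace (N 0) = 1 ∧ quadTrace (N 1) = 0 ∧ quadTrace (N 2) = 1 ∧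
    ∀ x, 0 ≤ quadEval (N 0) x ∧ 0 ≤ quadEval (N 2) x ∧
      quadEval (N 1) x ^ 2 ≤ quadEval (N 0) x * quadEval (N 2) x}

lemma isCompact_normalizedPencils : IsCompact normalizedPencils := by
  refine Metric.isCompact_of_isClosed_isBounded ?_ ?_
  · have hq : ∀ i x, Continuous fun N : Fin 3 → Fin 6 → ℝ => quadEval (N i) x := fun i x => by
      unfold quadEval; fun_prop
    have ht : ∀ i, Continuous fun N : Fin 3 → Fin 6 → ℝ => quadTrace (N i) := fun i => by
      unfold quadTrace; fun_prop
    simp only [normalizedPencils, ofPred_and, ofPred_forall]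
    refine (isClosed_eq (ht 0) continuous_const).inter <|
      (isClosed_eq (ht 1) continuous_const).inter <|
      (isClosed_eq (ht 2) continuous_const).inter <| isClosed_iInter fun x =>
      (isClosed_le continuous_const (hq 0 x)).inter <|
      (isClosed_le continuous_const (hq 2 x)).inter <|
      isClosed_le ((hq 1 x).pow 2) ((hq 0 x).mul (hq 2 x))
  · refine (Metric.isBounded_closedBall (x := (0 : Fin 3 → Fin 6 → ℝ)) (r := 4)).subset ?_
    rintro N ⟨h0, h1, h2, h⟩
    rw [mem_closedBall_zero_iff, pi_norm_le_iff_of_nonneg (by norm_num)]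
    intro i
    rw [pi_norm_le_iff_of_nonneg (by norm_num)]
    intro j
    have h' : ∀ x, 0 ≤ quadEval (N 0) x ∧ 0 ≤ quadEval (N 2) x ∧
        2 * quadEval (N 1) x ≤ quadEval (N 0) x + quadEval (N 2) x ∧
        -(quadEval (N 0) x + quadEval (N 2) x) ≤ 2 * quadEval (N 1) x := by
      intro x
      obtain ⟨p0, p2, p1⟩ := h x
      have := abs_le_of_sq_le_sq' (a := 2 * quadEval (N 1) x)
        (b := quadEval (N 0) x + quadEval (N 2) x)
        (by nlinarith [sq_nonneg (quadEval (N 0) x - quadEval (N 2) x)]) (by linarith)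
      exact ⟨p0, p2, this.2, this.1⟩
    clear h
    simp only [quadEval] at h'
    simp only [quadTrace] at h0 h1 h2
    have a1 := h' ![1, 0, 0]
    have a2 := h' ![0, 1, 0]
    have a3 := h' ![0, 0, 1]
    have b1 := h' ![1, 1, 0]
    have b2 := h' ![1, -1, 0]
    have b3 := h' ![1, 0, 1]
    have b4 := h' ![1, 0, -1]
    have b5 := h' ![0, 1, 1]
    have b6 := h' ![0, 1, -1]
    clear h'
    simp only [Matrix.cons_val] at a1 a2 a3 b1 b2 b3 b4 b5 b6
    ring_nf at a1 a2 a3 b1 b2 b3 b4 b5 b6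
    rw [Real.norm_eq_abs, abs_le]
    fin_cases i <;> fin_cases j <;> simp only [Fin.reduceFinMk, Fin.zero_eta, Fin.mk_one] <;>
      constructor <;> linarith

lemma quadTrace_det_pos {M : Fin 3 → Fin 6 → ℝ} (h0 : ∀ x ≠ 0, 0 < quadEval (M 0) x)
    (hM : detForm M ∈ posQuartics) : 0 < quadTrace (M 0) ∧
      0 < quadTrace (M 0) * quadTrace (M 2) - quadTrace (M 1) ^ 2 := by
  have he : ∀ (i : Fin 3), (Pi.single i 1 : Fin 3 → ℝ) ≠ 0 := fun i => by simp
  have ha : ∀ i : Fin 3, 0 < quadEval (M 0) (Pi.single i 1) := fun i => h0 _ (he i)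
  have hd : ∀ i : Fin 3, 0 < quadEval (M 0) (Pi.single i 1) * quadEval (M 2) (Pi.single i 1) -
      quadEval (M 1) (Pi.single i 1) ^ 2 := fun i => by
    rw [← quarticEval_detForm]; exact hM _ (he i)
  have htr : ∀ q, quadTrace q = quadEval q (Pi.single 0 1) + quadEval q (Pi.single 1 1) +
      quadEval q (Pi.single 2 1) := fun q => by
    simp [quadTrace, quadEval]
  rw [htr, htr, htr]
  set a := fun i : Fin 3 => quadEval (M 0) (Pi.single i 1)
  set b := fun i : Fin 3 => quadEval (M 1) (Pi.single i 1)
  set d := fun i : Fin 3 => quadEval (M 2) (Pi.single i 1)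
  change 0 < a 0 + a 1 + a 2 ∧
    0 < (a 0 + a 1 + a 2) * (d 0 + d 1 + d 2) - (b 0 + b 1 + b 2) ^ 2
  replace ha : ∀ i, 0 < a i := ha
  replace hd : ∀ i, 0 < a i * d i - b i ^ 2 := hd
  have hA : 0 < a 0 + a 1 + a 2 := add_pos (add_pos (ha 0) (ha 1)) (ha 2)
  refine ⟨hA, ?_⟩
  set t := -(b 0 + b 1 + b 2) / (a 0 + a 1 + a 2) with ht
  have hpos : ∀ i, 0 < a i * t ^ 2 + 2 * b i * t + d i := by
    intro i
    refine pos_of_mul_pos_right ?_ (ha i).le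
    nlinarith [hd i, sq_nonneg (a i * t + b i)]
  have hsum : (a 0 + a 1 + a 2) * (d 0 + d 1 + d 2) - (b 0 + b 1 + b 2) ^ 2 =
      (a 0 + a 1 + a 2) * ((a 0 * t ^ 2 + 2 * b 0 * t + d 0) +
        (a 1 * t ^ 2 + 2 * b 1 * t + d 1) + (a 2 * t ^ 2 + 2 * b 2 * t + d 2)) := by
    rw [ht]
    field_simp
    ring
  rw [hsum]
  exact mul_pos hA (add_pos (add_pos (hpos 0) (hpos 1)) (hpos 2))

lemma exists_mem_normalizedPencils {M : Fin 3 → Fin 6 → ℝ} (h0 : ∀ x ≠ 0, 0 < quadEval (M 0) x)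
    (hM : detForm M ∈ posQuartics) :
    ∃ N ∈ normalizedPencils, ∃ c > (0 : ℝ), detForm M = c • detForm N := by
  obtain ⟨ha, hD⟩ := quadTrace_det_pos h0 hM
  set a := quadTrace (M 0) with ha'
  set b := quadTrace (M 1) with hb'
  set d := quadTrace (M 2) with hd'
  set D := a * d - b ^ 2 with hD'
  have hs : √D ^ 2 = D := Real.sq_sqrt hD.le
  have hs0 : √D ≠ 0 := (Real.sqrt_pos.2 hD).ne'
  have htr : ∀ (r : ℝ) p q, quadTrace (r • (p - q)) = r * (quadTrace p - quadTrace q) :=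
    fun r p q => by simp only [quadTrace, Pi.smul_apply, Pi.sub_apply, smul_eq_mul]; ring
  have htr' : ∀ (r : ℝ) p, quadTrace (r • p) = r * quadTrace p :=
    fun r p => by simp only [quadTrace, Pi.smul_apply, smul_eq_mul]; ring
  set N : Fin 3 → Fin 6 → ℝ := ![a⁻¹ • M 0, (√D)⁻¹ • (M 1 - (b / a) • M 0),
    (a / D) • (M 2 - ((2 * (b / a)) • M 1 - (b / a) ^ 2 • M 0))] with hN
  have hdet : detForm M = D • detForm N := by
    refine quarticEval_injective fun x => ?_
    simp only [quarticEval_smul, quarticEval_detForm, hN, Matrix.cons_val, quadEval_smul,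
      quadEval_sub, mul_pow, inv_pow, hs]
    field_simp
    ring
  refine ⟨N, ⟨?_, ?_, ?_, fun x => ?_⟩, D, hD, hdet⟩
  · simp only [hN, Matrix.cons_val, htr', ← ha', inv_mul_cancel₀ ha.ne']
  · simp only [hN, Matrix.cons_val, htr, htr', ← ha', ← hb', div_mul_cancel₀ _ ha.ne', sub_self,
      mul_zero]
  · have e : quadTrace ((2 * (b / a)) • M 1 - (b / a) ^ 2 • M 0) = b ^ 2 / a := by
      have := htr 1 ((2 * (b / a)) • M 1) ((b / a) ^ 2 • M 0)
      rw [one_smul, htr', htr', ← ha', ← hb'] at this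
      rw [this]
      field_simp
      ring
    simp only [hN, Matrix.cons_val, htr, e, ← hd']
    rw [hD'] at hD ⊢
    field_simp
  · rcases eq_or_ne x 0 with rfl | hx
    · simp [quadEval]
    have p0 : 0 < quadEval (N 0) x := by
      simp only [hN, Matrix.cons_val, quadEval_smul]
      exact mul_pos (inv_pos.2 ha) (h0 x hx)
    have p1 : quadEval (N 1) x ^ 2 < quadEval (N 0) x * quadEval (N 2) x := by
      have := hM x hx
      rw [hdet, quarticEval_smul, quarticEval_detForm] at this
      exact sub_pos.1 (pos_of_mul_pos_right this hD.le)
    exact ⟨p0.le, (pos_of_mul_pos_right ((sq_nonneg _).trans_lt p1) p0.le).le, p1.le⟩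

/-- The linear form `x ↦ q (x + e) - q x - q e`. -/
def polarForm (q : Fin 6 → ℝ) (e : Fin 3 → ℝ) : Fin 3 → ℝ :=
  ![2 * q 0 * e 0 + q 3 * e 1 + q 4 * e 2, q 3 * e 0 + 2 * q 1 * e 1 + q 5 * e 2,
    q 4 * e 0 + q 5 * e 1 + 2 * q 2 * e 2]

lemma quadEval_add_smul (q : Fin 6 → ℝ) (x e : Fin 3 → ℝ) (t : ℝ) : quadEval q (x + t • e) =
    quadEval q x + t * linEval (polarForm q e) x + t ^ 2 * quadEval q e := by
  simp only [quadEval, linEval, polarForm, Matrix.cons_val, Pi.add_apply, Pi.smul_apply,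
    smul_eq_mul]
  ring

lemma quadEval_eq_zero_of_linEval_mul {l : Fin 3 → ℝ} {q : Fin 6 → ℝ} {y : Fin 3 → ℝ}
    (hy : linEval l y ≠ 0) (h : ∀ x, linEval l x * quadEval q x = 0) (x : Fin 3 → ℝ) :
    quadEval q x = 0 := by
  have hne : ∀ x, linEval l x ≠ 0 → quadEval q x = 0 := fun x hx =>
    (mul_eq_zero.1 (h x)).resolve_left hx
  by_cases hx : linEval l x = 0
  · have hl : ∀ t : ℝ, linEval l (x + t • y) = t * linEval l y := fun t => by
      have : linEval l (x + t • y) = linEval l x + t * linEval l y := by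
        simp only [linEval, Pi.add_apply, Pi.smul_apply, smul_eq_mul]; ring
      rw [this, hx, zero_add]
    have h1 := hne (x + (1 : ℝ) • y) (by rw [hl]; simpa using hy)
    have h2 := hne (x + (-1 : ℝ) • y) (by rw [hl]; simpa using hy)
    rw [quadEval_add_smul, hne y hy] at h1 h2
    linarith
  · exact hne x hx

lemma exists_eq_linMul_of_apply_eq_zero {p q r : Fin 6 → ℝ} {e : Fin 3 → ℝ}
    (hp : 0 < quadEval p e) (hq : quadEval q e = 0)
    (h : ∀ x, quadEval p x * quadEval r x = quadEval q x ^ 2) :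
    (q = 0 ∧ r = 0) ∨ ∃ l m : Fin 3 → ℝ, p = linMul l l ∧ q = linMul l m ∧ r = linMul m m := by
  set a := quadEval p e with ha
  have hr : quadEval r e = 0 := by
    have := h e
    rw [hq] at this
    exact (mul_eq_zero.1 (this.trans (zero_pow two_ne_zero))).resolve_left hp.ne'
  set κ := polarForm p e
  set μ := polarForm q e
  set ν := polarForm r e
  have key : ∀ x, quadEval r x = linEval μ x ^ 2 / a ∧
      linEval κ x * quadEval r x = 2 * (quadEval q x * linEval μ x) := by
    intro x
    have ht : ∀ t : ℝ, (quadEval p x + t * linEval κ x + t ^ 2 * a) *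
        (quadEval r x + t * linEval ν x) = (quadEval q x + t * linEval μ x) ^ 2 := by
      intro t
      have := h (x + t • e)
      rw [quadEval_add_smul, quadEval_add_smul, quadEval_add_smul, hq, hr] at this
      linear_combination this
    have t0 := ht 0
    have t1 := ht 1
    have t2 := ht (-1)
    have t3 := ht 2
    have hν : linEval ν x = 0 := by
      refine (mul_eq_zero.1 (?_ : a * linEval ν x = 0)).resolve_left hp.ne'
      linear_combination (t3 - 3 * t1 - t2 + 3 * t0) / 6
    rw [hν] at t0 t1 t2
    refine ⟨?_, ?_⟩
    · rw [eq_div_iff hp.ne']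
      linear_combination (t1 + t2 - 2 * t0) / 2
    · linear_combination (t1 - t2) / 2
  by_cases hμ : ∀ x, linEval μ x = 0
  · left
    have hr' : ∀ x, quadEval r x = 0 := fun x => by rw [(key x).1, hμ]; simp
    refine ⟨quadEval_injective fun x => ?_, quadEval_injective fun x => ?_⟩
    · have := h x
      rw [hr', mul_zero] at this
      rw [pow_eq_zero_iff two_ne_zero |>.1 this.symm]
      simp [quadEval]
    · rw [hr']
      simp [quadEval]
  · right
    push Not at hμ
    obtain ⟨y, hy⟩ := hμ
    have hq' : ∀ x, quadEval (linMul κ μ - (2 * a) • q) x = 0 := by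
      refine quadEval_eq_zero_of_linEval_mul hy fun x => ?_
      obtain ⟨k1, k2⟩ := key x
      rw [eq_div_iff hp.ne'] at k1
      simp only [quadEval_sub, quadEval_smul, quadEval_linMul]
      linear_combination a * k2 - linEval κ x * k1
    have hp' : ∀ x, quadEval (linMul κ κ - (4 * a) • p) x = 0 := by
      refine quadEval_eq_zero_of_linEval_mul hy fun x => ?_
      by_cases hx : linEval μ x = 0
      · rw [hx, zero_mul]
      obtain ⟨k1, -⟩ := key x
      rw [eq_div_iff hp.ne'] at k1
      have k2 := hq' x
      have k3 := h x
      simp only [quadEval_sub, quadEval_smul, quadEval_linMul] at k2 ⊢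
      refine (mul_eq_zero.1 (?_ : linEval μ x * _ = 0)).resolve_left hx
      linear_combination (linEval κ x * linEval μ x + 2 * a * quadEval q x) * k2 -
        4 * a ^ 2 * k3 + 4 * a * quadEval p x * k1
    have hs : √a ^ 2 = a := Real.sq_sqrt hp.le
    have hs0 : √a ≠ 0 := (Real.sqrt_pos.2 hp).ne'
    refine ⟨(2 * √a)⁻¹ • κ, (√a)⁻¹ • μ, ?_, ?_, ?_⟩ <;> refine quadEval_injective fun x => ?_
    · have := hp' x
      simp only [quadEval_sub, quadEval_smul, quadEval_linMul, linEval_smul] at this ⊢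
      field_simp
      rw [hs]
      linear_combination -this
    · have := hq' x
      simp only [quadEval_sub, quadEval_smul, quadEval_linMul, linEval_smul] at this ⊢
      field_simp
      rw [hs]
      linear_combination -this
    · have := (key x).1
      simp only [quadEval_linMul, linEval_smul] at this ⊢
      rw [this]
      field_simp
      rw [hs]

lemma exists_linMul_of_detForm_eq_zero {N : Fin 3 → Fin 6 → ℝ} {e : Fin 3 → ℝ}
    (hN : detForm N = 0) (he : 0 < quadEval (N 0) e) :
    (∃ c : ℝ, N 1 = c • N 0 ∧ N 2 = c ^ 2 • N 0) ∨
      ∃ l m : Fin 3 → ℝ, N 0 = linMul l l ∧ N 1 = linMul l m ∧ N 2 = linMul m m := by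
  set c := quadEval (N 1) e / quadEval (N 0) e with hc
  have hdet : ∀ x, quadEval (N 0) x * quadEval (N 2) x = quadEval (N 1) x ^ 2 := fun x => by
    have := congrArg (fun w => quarticEval w x) hN
    simp only [quarticEval_detForm] at this
    have h0 : quarticEval (0 : Fin 15 → ℝ) x = 0 := by simp [quarticEval]
    linarith
  rcases exists_eq_linMul_of_apply_eq_zero (q := N 1 - c • N 0)
    (r := N 2 - ((2 * c) • N 1 - c ^ 2 • N 0)) he
    (by rw [quadEval_sub, quadEval_smul, hc, div_mul_cancel₀ _ he.ne', sub_self])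
    (fun x => by
      simp only [quadEval_sub, quadEval_smul]
      linear_combination hdet x) with ⟨h1, h2⟩ | ⟨l, m, h0, h1, h2⟩
  · left
    refine ⟨c, sub_eq_zero.1 h1, ?_⟩
    rw [sub_eq_zero.1 h2, sub_eq_zero.1 h1, smul_smul, ← sub_smul]
    congr 1
    ring
  · right
    rw [sub_eq_iff_eq_add] at h1 h2
    refine ⟨l, m + c • l, h0, ?_, ?_⟩ <;> refine quadEval_injective fun x => ?_
    · rw [h1, h0]
      simp only [quadEval_add, quadEval_smul, quadEval_linMul, linEval_add, linEval_smul]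
      ring
    · rw [h2, h1, h0]
      simp only [quadEval_add, quadEval_sub, quadEval_smul, quadEval_linMul, linEval_add,
        linEval_smul]
      ring

/-- The matrix `(x₀², x₀x₁; x₀x₁, x₁²)` of quadratic forms of vanishing determinant. -/
def rankOnePencil : Fin 3 → Fin 6 → ℝ :=
  ![![1, 0, 0, 0, 0, 0], ![0, 0, 0, 1, 0, 0], ![0, 1, 0, 0, 0, 0]]

lemma exists_quadComp_eq_rankOnePencil {N : Fin 3 → Fin 6 → ℝ} (hN : N ∈ normalizedPencils)
    (hdet : detForm N = 0) : ∃ P : Matrix (Fin 3) (Fin 3) ℝ,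
      (fun i => quadComp P (N i)) = rankOnePencil ∧ P.mulVec ![0, 0, 1] ≠ 0 := by
  obtain ⟨h0, h1, h2, -⟩ := hN
  obtain ⟨e, he⟩ : ∃ e, 0 < quadEval (N 0) e := by
    by_contra! hc
    have c0 := hc ![1, 0, 0]
    have c1 := hc ![0, 1, 0]
    have c2 := hc ![0, 0, 1]
    simp [quadEval] at c0 c1 c2
    rw [quadTrace] at h0
    linarith
  rcases exists_linMul_of_detForm_eq_zero hdet he with ⟨c, e1, e2⟩ | ⟨l, m, e0, e1, e2⟩
  · have htr : ∀ r : ℝ, quadTrace (r • N 0) = r := fun r => by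
      have : quadTrace (r • N 0) = r * quadTrace (N 0) := by
        simp only [quadTrace, Pi.smul_apply, smul_eq_mul]; ring
      rw [this, h0, mul_one]
    rw [e1, htr] at h1
    rw [e2, htr, h1] at h2
    norm_num at h2
  rw [e0] at h0
  rw [e1] at h1
  rw [e2] at h2
  simp only [quadTrace, linMul, Matrix.cons_val] at h0 h1 h2
  have hP : ∀ x, (!![l 0, m 0, l 1 * m 2 - l 2 * m 1; l 1, m 1, l 2 * m 0 - l 0 * m 2;
      l 2, m 2, l 0 * m 1 - l 1 * m 0]).mulVec x = ![
        l 0 * x 0 + m 0 * x 1 + (l 1 * m 2 - l 2 * m 1) * x 2,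
        l 1 * x 0 + m 1 * x 1 + (l 2 * m 0 - l 0 * m 2) * x 2,
        l 2 * x 0 + m 2 * x 1 + (l 0 * m 1 - l 1 * m 0) * x 2] := fun x => by
    ext i
    fin_cases i <;> simp [Matrix.mulVec, dotProduct, Fin.sum_univ_three]
  refine ⟨!![l 0, m 0, l 1 * m 2 - l 2 * m 1; l 1, m 1, l 2 * m 0 - l 0 * m 2;
      l 2, m 2, l 0 * m 1 - l 1 * m 0], ?_, fun h => ?_⟩
  · have hlx : ∀ x : Fin 3 → ℝ, linEval l ![
        l 0 * x 0 + m 0 * x 1 + (l 1 * m 2 - l 2 * m 1) * x 2,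
        l 1 * x 0 + m 1 * x 1 + (l 2 * m 0 - l 0 * m 2) * x 2,
        l 2 * x 0 + m 2 * x 1 + (l 0 * m 1 - l 1 * m 0) * x 2] = x 0 := fun x => by
      simp only [linEval, Matrix.cons_val]
      linear_combination x 0 * h0 + x 1 * h1
    have hmx : ∀ x : Fin 3 → ℝ, linEval m ![
        l 0 * x 0 + m 0 * x 1 + (l 1 * m 2 - l 2 * m 1) * x 2,
        l 1 * x 0 + m 1 * x 1 + (l 2 * m 0 - l 0 * m 2) * x 2,
        l 2 * x 0 + m 2 * x 1 + (l 0 * m 1 - l 1 * m 0) * x 2] = x 1 := fun x => by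
      simp only [linEval, Matrix.cons_val]
      linear_combination x 0 * h1 + x 1 * h2
    ext1 i
    refine quadEval_injective fun x => ?_
    rw [quadEval_quadComp, hP]
    fin_cases i <;> simp only [Fin.reduceFinMk, Fin.zero_eta, Fin.mk_one, e0, e1, e2,
      quadEval_linMul, hlx, hmx, rankOnePencil, Matrix.cons_val] <;> simp [quadEval] <;> ring
  · rw [hP] at h
    have n0 := congrFun h 0
    have n1 := congrFun h 1
    have n2 := congrFun h 2
    simp only [Matrix.cons_val, Pi.zero_apply, mul_zero, zero_add, mul_one] at n0 n1 n2
    have : (1 : ℝ) = 0 := by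
      linear_combination -(m 0 * m 0 + m 1 * m 1 + m 2 * m 2) * h0 - h2 + (l 0 * m 0 + l 1 * m 1 + l 2 * m 2) * h1 +
        (l 1 * m 2 - l 2 * m 1) * n0 + (l 2 * m 0 - l 0 * m 2) * n1 +
        (l 0 * m 1 - l 1 * m 0) * n2
    norm_num at this

/-- The linear form whose square has the same `x₀²`, `x₀x₁` and `x₀x₂` coefficients as `q`. -/
def squareRootZero (q : Fin 6 → ℝ) : Fin 3 → ℝ :=
  ![√(q 0), q 3 / (2 * √(q 0)), q 4 / (2 * √(q 0))]

/-- The linear form whose square has the same `x₀x₁`, `x₁²` and `x₁x₂` coefficients as `q`. -/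
def squareRootOne (q : Fin 6 → ℝ) : Fin 3 → ℝ :=
  ![q 3 / (2 * √(q 1)), √(q 1), q 5 / (2 * √(q 1))]

lemma linMul_squareRootZero {q : Fin 6 → ℝ} (hq : 0 < q 0) :
    (q - linMul (squareRootZero q) (squareRootZero q)) 0 = 0 ∧
    (q - linMul (squareRootZero q) (squareRootZero q)) 3 = 0 ∧
    (q - linMul (squareRootZero q) (squareRootZero q)) 4 = 0 := by
  have hs : √(q 0) ≠ 0 := (Real.sqrt_pos.2 hq).ne'
  simp only [Pi.sub_apply, linMul, squareRootZero, Matrix.cons_val, Real.mul_self_sqrt hq.le,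
    sub_self, true_and]
  constructor <;> field_simp <;> ring

lemma linMul_squareRootOne {q : Fin 6 → ℝ} (hq : 0 < q 1) :
    (q - linMul (squareRootOne q) (squareRootOne q)) 1 = 0 ∧
    (q - linMul (squareRootOne q) (squareRootOne q)) 3 = 0 ∧
    (q - linMul (squareRootOne q) (squareRootOne q)) 5 = 0 := by
  have hs : √(q 1) ≠ 0 := (Real.sqrt_pos.2 hq).ne'
  simp only [Pi.sub_apply, linMul, squareRootOne, Matrix.cons_val, Real.mul_self_sqrt hq.le,
    sub_self, true_and]
  constructor <;> field_simp <;> ring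

lemma continuousAt_squareRootZero {q : Fin 6 → ℝ} (hq : 0 < q 0) :
    ContinuousAt squareRootZero q := by
  have hs : 2 * √(q 0) ≠ 0 := mul_ne_zero two_ne_zero (Real.sqrt_pos.2 hq).ne'
  have h0 : ContinuousAt (fun q : Fin 6 → ℝ => √(q 0)) q :=
    Real.continuous_sqrt.continuousAt.comp (continuousAt_apply 0 q)
  refine continuousAt_pi.2 fun i => ?_
  fin_cases i
  · exact h0
  · exact (continuousAt_apply 3 q).div (h0.const_mul 2) hs
  · exact (continuousAt_apply 4 q).div (h0.const_mul 2) hs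

lemma continuousAt_squareRootOne {q : Fin 6 → ℝ} (hq : 0 < q 1) :
    ContinuousAt squareRootOne q := by
  have hs : 2 * √(q 1) ≠ 0 := mul_ne_zero two_ne_zero (Real.sqrt_pos.2 hq).ne'
  have h0 : ContinuousAt (fun q : Fin 6 → ℝ => √(q 1)) q :=
    Real.continuous_sqrt.continuousAt.comp (continuousAt_apply 1 q)
  refine continuousAt_pi.2 fun i => ?_
  fin_cases i
  · exact (continuousAt_apply 3 q).div (h0.const_mul 2) hs
  · exact h0
  · exact (continuousAt_apply 5 q).div (h0.const_mul 2) hs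

/-- The difference between `N` and the matrix `(l², lm; lm, m²)`. -/
def residual (l m : Fin 3 → ℝ) (N : Fin 3 → Fin 6 → ℝ) : Fin 3 → Fin 6 → ℝ :=
  ![N 0 - linMul l l, N 1 - linMul l m, N 2 - linMul m m]

lemma smul_detForm_eq (l m : Fin 3 → ℝ) (N : Fin 3 → Fin 6 → ℝ) {r : ℝ} (hr : r ≠ 0) :
    r⁻¹ • detForm N = detFormDeriv ![linMul l l, linMul l m, linMul m m] (r⁻¹ • residual l m N) +
      r • detForm (r⁻¹ • residual l m N) := by
  refine quarticEval_injective fun x => ?_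
  simp only [quarticEval_add, quarticEval_smul, quarticEval_detForm, quarticEval_detFormDeriv,
    residual, Pi.smul_apply, Matrix.cons_val, quadEval_smul, quadEval_sub, quadEval_linMul]
  field_simp
  ring

lemma eq_zero_of_detFormDeriv_rankOnePencil {E : Fin 3 → Fin 6 → ℝ}
    (h : detFormDeriv rankOnePencil E = 0) (h0 : E 0 0 = 0 ∧ E 0 3 = 0 ∧ E 0 4 = 0)
    (h2 : E 2 1 = 0 ∧ E 2 3 = 0 ∧ E 2 5 = 0) : E = 0 := by
  have h' := fun i => congrFun h i
  simp only [Fin.forall_fin_succ, detFormDeriv, rankOnePencil, quadMul, Pi.add_apply,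
    Pi.sub_apply, Pi.smul_apply, Pi.zero_apply, smul_eq_mul] at h'
  simp [Fin.succ] at h'
  obtain ⟨a0, a3, a4⟩ := h0
  obtain ⟨b1, b3, b5⟩ := h2
  ext i j
  fin_cases i <;> fin_cases j <;> simp only [Fin.reduceFinMk, Fin.zero_eta, Fin.mk_one,
    Pi.zero_apply] <;> linarith

lemma tendsto_residual {N : ℕ → Fin 3 → Fin 6 → ℝ} (hN : Tendsto N atTop (𝓝 rankOnePencil)) :
    Tendsto (fun n => linMul (squareRootZero (N n 0)) (squareRootZero (N n 0))) atTop
      (𝓝 (rankOnePencil 0)) ∧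
    Tendsto (fun n => linMul (squareRootZero (N n 0)) (squareRootOne (N n 2))) atTop
      (𝓝 (rankOnePencil 1)) ∧
    Tendsto (fun n => linMul (squareRootOne (N n 2)) (squareRootOne (N n 2))) atTop
      (𝓝 (rankOnePencil 2)) := by
  have hN' := fun i => tendsto_pi_nhds.1 hN i
  have hl : Tendsto (fun n => squareRootZero (N n 0)) atTop (𝓝 ![1, 0, 0]) := by
    have h := (continuousAt_squareRootZero (q := rankOnePencil 0)
      (by simp [rankOnePencil])).tendsto.comp (hN' 0)
    have e : squareRootZero (rankOnePencil 0) = ![1, 0, 0] := by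
      simp [squareRootZero, rankOnePencil]
    rwa [e] at h
  have hm : Tendsto (fun n => squareRootOne (N n 2)) atTop (𝓝 ![0, 1, 0]) := by
    have h := (continuousAt_squareRootOne (q := rankOnePencil 2)
      (by simp [rankOnePencil])).tendsto.comp (hN' 2)
    have e : squareRootOne (rankOnePencil 2) = ![0, 1, 0] := by
      simp [squareRootOne, rankOnePencil]
    rwa [e] at h
  refine ⟨?_, ?_, ?_⟩
  · have e : rankOnePencil 0 = linMul ![1, 0, 0] ![1, 0, 0] := by simp [rankOnePencil, linMul]
    rw [e]
    exact (continuous_linMul.tendsto (_, _)).comp (hl.prodMk_nhds hl)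
  · have e : rankOnePencil 1 = linMul ![1, 0, 0] ![0, 1, 0] := by simp [rankOnePencil, linMul]
    rw [e]
    exact (continuous_linMul.tendsto (_, _)).comp (hl.prodMk_nhds hm)
  · have e : rankOnePencil 2 = linMul ![0, 1, 0] ![0, 1, 0] := by simp [rankOnePencil, linMul]
    rw [e]
    exact (continuous_linMul.tendsto (_, _)).comp (hm.prodMk_nhds hm)

lemma continuous_detFormDeriv : Continuous fun p : (Fin 3 → Fin 6 → ℝ) × (Fin 3 → Fin 6 → ℝ) =>
    detFormDeriv p.1 p.2 := by
  unfold detFormDeriv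
  refine ((continuous_quadMul.comp (.prodMk ?_ ?_)).add
    (continuous_quadMul.comp (.prodMk ?_ ?_))).sub
    ((continuous_quadMul.comp (.prodMk ?_ ?_)).const_smul (2 : ℝ)) <;> fun_prop

lemma not_tendsto_rankOnePencil_of_pos {N : ℕ → Fin 3 → Fin 6 → ℝ} {F : ℕ → Fin 15 → ℝ}
    {w : Fin 15 → ℝ} {c : ℕ → ℝ} (hF : Tendsto F atTop (𝓝 w))
    (hw : 0 < quarticEval w ![0, 0, 1]) (h : ∀ n, detForm (N n) = c n • F n)
    (hc : ∀ n, c n ≠ 0) (hN0 : ∀ n, 0 < N n 0 0) (hN2 : ∀ n, 0 < N n 2 1) (hF0 : ∀ n, F n ≠ 0) :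
    ¬ Tendsto N atTop (𝓝 rankOnePencil) := by
  intro hN
  set R : ℕ → Fin 3 → Fin 6 → ℝ := fun n =>
    ![linMul (squareRootZero (N n 0)) (squareRootZero (N n 0)),
      linMul (squareRootZero (N n 0)) (squareRootOne (N n 2)),
      linMul (squareRootOne (N n 2)) (squareRootOne (N n 2))] with hR
  set E : ℕ → Fin 3 → Fin 6 → ℝ := fun n =>
    residual (squareRootZero (N n 0)) (squareRootOne (N n 2)) (N n) with hE
  obtain ⟨t0, t1, t2⟩ := tendsto_residual hN
  have hRlim : Tendsto R atTop (𝓝 rankOnePencil) := by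
    refine tendsto_pi_nhds.2 fun i => ?_
    fin_cases i
    exacts [t0, t1, t2]
  have hER : E = N - R := by
    ext n i
    fin_cases i <;> rfl
  have hElim : Tendsto E atTop (𝓝 0) := by
    rw [hER, ← sub_self rankOnePencil]
    exact hN.sub hRlim
  have hE0 : ∀ n, ‖E n‖ ≠ 0 := by
    intro n hn
    rw [norm_eq_zero, hER, Pi.sub_apply, sub_eq_zero] at hn
    have : detForm (N n) = 0 := by
      rw [hn]
      refine quarticEval_injective fun x => ?_
      simp only [quarticEval_detForm, hR, Matrix.cons_val, quadEval_linMul]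
      simp only [quarticEval, Pi.zero_apply]
      ring
    rw [h] at this
    exact (smul_ne_zero (hc n) (hF0 n)) this
  obtain ⟨A, hA, φ, hφ, hlim⟩ := (isCompact_sphere (0 : Fin 3 → Fin 6 → ℝ) 1).tendsto_subseq
    (x := fun n => ‖E n‖⁻¹ • E n) (fun n => by
      rw [mem_sphere_zero_iff_norm, norm_smul, norm_inv, norm_norm, inv_mul_cancel₀ (hE0 n)])
  have hG : Tendsto (fun n => (‖E (φ n)‖⁻¹ * c (φ n)) • F (φ n)) atTop
      (𝓝 (detFormDeriv rankOnePencil A)) := by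
    have e : ∀ n, (‖E (φ n)‖⁻¹ * c (φ n)) • F (φ n) =
        detFormDeriv (R (φ n)) (‖E (φ n)‖⁻¹ • E (φ n)) +
          ‖E (φ n)‖ • detForm (‖E (φ n)‖⁻¹ • E (φ n)) := fun n => by
      rw [mul_smul, ← h, smul_detForm_eq _ _ _ (hE0 (φ n))]
    simp only [e]
    have l1 := (continuous_detFormDeriv.tendsto (rankOnePencil, A)).comp
      ((hRlim.comp hφ.tendsto_atTop).prodMk_nhds hlim)
    have l2 := ((contDiff_detForm (n := 0)).continuous.tendsto A).comp hlim
    have l3 := (hElim.comp hφ.tendsto_atTop).norm.smul l2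
    rw [norm_zero, zero_smul] at l3
    simpa using l1.add l3
  have hFφ := hF.comp hφ.tendsto_atTop
  have hev : Continuous fun w : Fin 15 → ℝ => quarticEval w ![0, 0, 1] := by
    unfold quarticEval; fun_prop
  have hk : Tendsto (fun n => ‖E (φ n)‖⁻¹ * c (φ n)) atTop (𝓝 0) := by
    have l1 := (hev.tendsto _).comp hG
    have l2 := (hev.tendsto _).comp hFφ
    have z : quarticEval (detFormDeriv rankOnePencil A) ![0, 0, 1] = 0 := by
      simp [quarticEval_detFormDeriv, rankOnePencil, quadEval]
    have l3 := l1.div l2 hw.ne'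
    rw [z, zero_div] at l3
    refine l3.congr' ?_
    filter_upwards [l2.eventually_ne hw.ne'] with n hn
    simp only [Pi.div_apply, Function.comp_apply, quarticEval_smul] at hn ⊢
    exact mul_div_cancel_right₀ _ hn
  have hG0 : detFormDeriv rankOnePencil A = 0 := by
    have := hk.smul hFφ
    rw [zero_smul] at this
    exact tendsto_nhds_unique hG this
  have hlim' : ∀ i j, (∀ n, E n i j = 0) → A i j = 0 := fun i j hij => by
    have := tendsto_pi_nhds.1 (tendsto_pi_nhds.1 hlim i) j
    refine tendsto_nhds_unique this ?_
    simp [hij]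
  have hA0 : A = 0 := eq_zero_of_detFormDeriv_rankOnePencil hG0
    ⟨hlim' 0 0 fun n => (linMul_squareRootZero (hN0 n)).1,
      hlim' 0 3 fun n => (linMul_squareRootZero (hN0 n)).2.1,
      hlim' 0 4 fun n => (linMul_squareRootZero (hN0 n)).2.2⟩
    ⟨hlim' 2 1 fun n => (linMul_squareRootOne (hN2 n)).1,
      hlim' 2 3 fun n => (linMul_squareRootOne (hN2 n)).2.1,
      hlim' 2 5 fun n => (linMul_squareRootOne (hN2 n)).2.2⟩
  rw [hA0] at hA
  simp at hA

lemma not_tendsto_rankOnePencil {N : ℕ → Fin 3 → Fin 6 → ℝ} {F : ℕ → Fin 15 → ℝ}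
    {w : Fin 15 → ℝ} {c : ℕ → ℝ} (hF : Tendsto F atTop (𝓝 w))
    (hw : 0 < quarticEval w ![0, 0, 1]) (h : ∀ n, detForm (N n) = c n • F n)
    (hc : ∀ n, c n ≠ 0) : ¬ Tendsto N atTop (𝓝 rankOnePencil) := by
  intro hN
  have h0 : ∀ᶠ n in atTop, 0 < N n 0 0 :=
    (tendsto_pi_nhds.1 (tendsto_pi_nhds.1 hN 0) 0).eventually_const_lt (by simp [rankOnePencil])
  have h2 : ∀ᶠ n in atTop, 0 < N n 2 1 :=
    (tendsto_pi_nhds.1 (tendsto_pi_nhds.1 hN 2) 1).eventually_const_lt (by simp [rankOnePencil])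
  have hF0 : ∀ᶠ n in atTop, F n ≠ 0 := hF.eventually_ne (by
    rintro rfl
    simp [quarticEval] at hw)
  obtain ⟨k, hk⟩ := eventually_atTop.1 (h0.and (h2.and hF0))
  have hs : Tendsto (fun n => n + k) atTop atTop := tendsto_add_atTop_nat k
  exact not_tendsto_rankOnePencil_of_pos (N := fun n => N (n + k)) (hF.comp hs) hw
    (fun n => h (n + k)) (fun n => hc (n + k)) (fun n => (hk (n + k) (by omega)).1)
    (fun n => (hk (n + k) (by omega)).2.1) (fun n => (hk (n + k) (by omega)).2.2) (hN.comp hs)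

lemma continuous_quarticEval_left (x : Fin 3 → ℝ) : Continuous fun w : Fin 15 → ℝ => quarticEval w x := by
  unfold quarticEval; fun_prop

lemma mem_range_detForm_of_tendsto {F : ℕ → Fin 15 → ℝ} {w : Fin 15 → ℝ}
    (hF : Tendsto F atTop (𝓝 w)) (hw : w ∈ posQuartics) (hFpos : ∀ n, F n ∈ posQuartics)
    (hr : ∀ n, F n ∈ range detForm) : w ∈ range detForm := by
  have hN : ∀ n, ∃ N ∈ normalizedPencils, ∃ c > (0 : ℝ), F n = c • detForm N := by
    intro n
    obtain ⟨M, hM, h0⟩ := exists_pos_of_mem_range_detForm (hFpos n) (hr n)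
    rw [← hM]
    exact exists_mem_normalizedPencils h0 (hM ▸ hFpos n)
  choose N hNK c hc hFN using hN
  obtain ⟨A, hA, φ, hφ, hlim⟩ := isCompact_normalizedPencils.tendsto_subseq hNK
  have hFφ := hF.comp hφ.tendsto_atTop
  have hdet : ∀ n, detForm (N n) = (c n)⁻¹ • F n := fun n => by
    rw [hFN, inv_smul_smul₀ (hc n).ne']
  have hd := ((contDiff_detForm (n := 0)).continuous.tendsto A).comp hlim
  have he : (![1, 0, 0] : Fin 3 → ℝ) ≠ 0 := fun h => one_ne_zero (congrFun h 0)
  have hwe : 0 < quarticEval w ![1, 0, 0] := hw _ he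
  have hk : Tendsto (fun n => (c (φ n))⁻¹) atTop
      (𝓝 (quarticEval (detForm A) ![1, 0, 0] / quarticEval w ![1, 0, 0])) := by
    refine ((((continuous_quarticEval_left ![1, 0, 0]).tendsto _).comp hd).div
      (((continuous_quarticEval_left ![1, 0, 0]).tendsto _).comp hFφ) hwe.ne').congr fun n => ?_
    simp only [Pi.div_apply, Function.comp_apply, hdet, quarticEval_smul]
    exact mul_div_cancel_right₀ _ (hFpos (φ n) _ he).ne'
  set k := quarticEval (detForm A) ![1, 0, 0] / quarticEval w ![1, 0, 0]
  have hk0 : 0 ≤ k := ge_of_tendsto' hk fun n => (inv_pos.2 (hc (φ n))).le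
  have hAw : detForm A = k • w := by
    refine tendsto_nhds_unique hd ((hk.smul hFφ).congr fun n => ?_)
    simp only [Function.comp_apply, hdet]
  rcases hk0.eq_or_lt with hk0 | hk0
  · exfalso
    rw [← hk0, zero_smul] at hAw
    obtain ⟨P, hP, hPe⟩ := exists_quadComp_eq_rankOnePencil hA hAw
    refine not_tendsto_rankOnePencil (N := fun n i => quadComp P (N (φ n) i))
      (F := fun n => quarticComp P (F (φ n))) (w := quarticComp P w) (c := fun n => (c (φ n))⁻¹)
      (((contDiff_quarticComp P (n := 0)).continuous.tendsto w).comp hFφ) ?_ ?_ ?_ ?_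
    · rw [quarticEval_quarticComp]
      exact hw _ hPe
    · intro n
      rw [detForm_quadComp, hdet]
      refine quarticEval_injective fun x => ?_
      simp only [quarticEval_quarticComp, quarticEval_smul]
    · exact fun n => (inv_pos.2 (hc (φ n))).ne'
    · rw [← hP]
      refine tendsto_pi_nhds.2 fun i => ?_
      exact ((continuous_quadComp P).tendsto _).comp (tendsto_pi_nhds.1 hlim i)
  · refine ⟨√k⁻¹ • A, ?_⟩
    rw [detForm_smul, Real.sq_sqrt (inv_pos.2 hk0).le, hAw, inv_smul_smul₀ hk0.ne']

lemma isOpen_posQuartics : IsOpen posQuartics := by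
  rw [isOpen_iff_mem_nhds]
  intro w hw
  have h := (isCompact_sphere (0 : Fin 3 → ℝ) 1).eventually_forall_of_forall_eventually (x₀ := w)
    (P := fun w x => 0 < quarticEval w x) fun x hx =>
      (continuous_quarticEval.tendsto (w, x)).eventually_const_lt
        (hw x (ne_zero_of_mem_unit_sphere ⟨x, hx⟩))
  filter_upwards [h] with v hv x hx
  have hx' : 0 < ‖x‖ := norm_pos_iff.2 hx
  have := hv (‖x‖⁻¹ • x) (by
    rw [mem_sphere_zero_iff_norm, norm_smul, norm_inv, norm_norm, inv_mul_cancel₀ hx'.ne'])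
  rw [quarticEval_smul_point] at this
  exact pos_of_mul_pos_right this (by positivity)

/-- A matrix of quadratic forms with positive definite determinant and no common complex zero. -/
def basePencil : Fin 3 → Fin 6 → ℝ :=
  ![![1, 1, 1, 0, 0, 0], ![1 / 2, 0, 0, 0, 0, 0], ![1, 2, 3, 0, 0, 0]]

lemma sum_sq_pos {x : Fin 3 → ℝ} (hx : x ≠ 0) : 0 < x 0 ^ 2 + x 1 ^ 2 + x 2 ^ 2 := by
  obtain ⟨i, hi⟩ := Function.ne_iff.1 hx
  have := sq_pos_of_ne_zero hi
  fin_cases i <;> simp only [Fin.reduceFinMk, Fin.zero_eta, Fin.mk_one] at this <;>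
    nlinarith [sq_nonneg (x 0), sq_nonneg (x 1), sq_nonneg (x 2)]

lemma quadEval_basePencil_zero_pos : ∀ x ≠ 0, 0 < quadEval (basePencil 0) x := fun x hx => by
  simpa [quadEval, basePencil] using sum_sq_pos hx

lemma detForm_basePencil_mem_posQuartics : detForm basePencil ∈ posQuartics := fun x hx => by
  have := pow_pos (sum_sq_pos hx) 2
  rw [quarticEval_detForm]
  simp [quadEval, basePencil]
  nlinarith [sq_nonneg (x 0 * x 1), sq_nonneg (x 0 * x 2), sq_nonneg (x 1 * x 2),
    sq_nonneg (x 0 ^ 2), sq_nonneg (x 1 ^ 2), sq_nonneg (x 2 ^ 2)]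

lemma not_hasCommonZero_basePencil : ¬ HasCommonZero basePencil := by
  rintro ⟨z, hz, h⟩
  have h0 := h 0
  have h1 := h 1
  have h2 := h 2
  simp [quadEval, basePencil] at h0 h1 h2
  rw [h1] at h0 h2
  have e1 : z 1 = 0 := pow_eq_zero_iff two_ne_zero |>.1 (by linear_combination 3 * h0 - h2)
  have e2 : z 2 = 0 := pow_eq_zero_iff two_ne_zero |>.1 (by linear_combination h2 - 2 * h0)
  refine hz (funext fun i => ?_)
  fin_cases i
  · exact h1
  · exact e1
  · exact e2

lemma add_smul_sub_mem_posQuartics {v w : Fin 15 → ℝ} (hv : v ∈ posQuartics)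
    (hw : w ∈ posQuartics) {t : ℝ} (ht : t ∈ Icc (0 : ℝ) 1) : v + t • (w - v) ∈ posQuartics := by
  intro x hx
  rw [quarticEval_add, quarticEval_smul, quarticEval_sub]
  rcases ht.1.eq_or_lt with h | h
  · rw [← h]; simpa using hv x hx
  · nlinarith [hv x hx, hw x hx, mul_pos h (hw x hx), mul_nonneg (sub_nonneg.2 ht.2) (hv x hx).le]

lemma mem_range_detForm_of_not_mem_degenerateCone {w : Fin 15 → ℝ} (hw : w ∈ posQuartics)
    (hdeg : w ∉ degenerateCone (detForm basePencil)) : w ∈ range detForm := by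
  set v := detForm basePencil with hv
  have hseg : ∀ t ∈ Icc (0 : ℝ) 1, v + t • (w - v) ∈ posQuartics := fun t ht =>
    add_smul_sub_mem_posQuartics detForm_basePencil_mem_posQuartics hw ht
  have hcont : Continuous fun t : ℝ => v + t • (w - v) := by fun_prop
  have key : Icc (0 : ℝ) 1 ⊆ {t | v + t • (w - v) ∈ range detForm} := by
    refine IsClosed.Icc_subset_of_forall_mem_nhdsWithin ?_ ?_ ?_
    · refine IsSeqClosed.isClosed fun u t hu ht => ?_
      have htI : t ∈ Icc (0 : ℝ) 1 := isClosed_Icc.isSeqClosed (fun n => (hu n).2) ht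
      exact ⟨mem_range_detForm_of_tendsto ((hcont.tendsto t).comp ht) (hseg t htI)
        (fun n => hseg _ (hu n).2) (fun n => (hu n).1), htI⟩
    · exact ⟨basePencil, by rw [zero_smul, add_zero]⟩
    · rintro t ⟨hr, ht0, ht1⟩
      refine mem_nhdsWithin_of_mem_nhds (hcont.continuousAt.preimage_mem_nhds ?_)
      rcases ht0.eq_or_lt with rfl | ht0
      · rw [zero_smul, add_zero]
        exact range_detForm_mem_nhds not_hasCommonZero_basePencil quadEval_basePencil_zero_pos
      · have hp := hseg t ⟨ht0.le, ht1.le⟩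
        obtain ⟨M, hM, hM0⟩ := exists_pos_of_mem_range_detForm hp hr
        rw [← hM]
        refine range_detForm_mem_nhds (fun hz => hdeg ⟨_, detForm_mem_degenerateSet
          (hM ▸ hp : detForm M ∈ posQuartics) hz, t⁻¹, ?_⟩) hM0
        rw [hM, add_sub_cancel_left, inv_smul_smul₀ ht0.ne', add_sub_cancel]
  have := key (right_mem_Icc.2 zero_le_one)
  rwa [mem_ofPred_eq, one_smul, add_sub_cancel] at this

theorem mem_range_detForm_of_mem_posQuartics {w : Fin 15 → ℝ} (hw : w ∈ posQuartics) :
    w ∈ range detForm := by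
  obtain ⟨u, hu, hlim⟩ := mem_closure_iff_seq_limit.1
    ((dense_compl_degenerateCone (detForm basePencil)).open_subset_closure_inter
      isOpen_posQuartics hw)
  exact mem_range_detForm_of_tendsto hlim hw (fun n => (hu n).1) fun n =>
    mem_range_detForm_of_not_mem_degenerateCone (hu n).1 (hu n).2

lemma exists_quarticEval_eq_eval_monomial {d : Fin 3 →₀ ℕ} (hd : d.degree = 4) (c : ℝ) :
    ∃ w : Fin 15 → ℝ, ∀ x, eval x (monomial d c) = quarticEval w x := by
  rw [Finsupp.degree_eq_sum, Fin.sum_univ_three] at hd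
  simp only [eval_monomial, Finsupp.prod_fintype _ _ fun _ => pow_zero _,
    Fin.prod_univ_three]
  obtain ⟨i, hi⟩ : ∃ i : Fin 15, ∀ x : Fin 3 → ℝ,
      x 0 ^ d 0 * x 1 ^ d 1 * x 2 ^ d 2 = quarticEval (Pi.single i 1) x := by
    generalize d 0 = k at *
    generalize d 1 = l at *
    obtain ⟨hm, hk, hl⟩ : d 2 = 4 - k - l ∧ k ≤ 4 ∧ l ≤ 4 - k := by omega
    rw [hm]
    clear hm hd
    interval_cases k <;> interval_cases l
    map_tacs [use 2; use 8; use 11; use 6; use 1; use 7; use 14; use 13; use 5; use 10; use 12;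
      use 9; use 4; use 3; use 0]
    all_goals intro x; simp [quarticEval]
  refine ⟨c • Pi.single i 1, fun x => ?_⟩
  rw [quarticEval_smul, hi]

lemma exists_quarticEval_eq_eval {F : MvPolynomial (Fin 3) ℝ} (hF : F.IsHomogeneous 4) :
    ∃ w : Fin 15 → ℝ, ∀ x, eval x F = quarticEval w x := by
  rw [F.as_sum]
  refine Finset.sum_induction _ (fun p => ∃ w : Fin 15 → ℝ, ∀ x, eval x p = quarticEval w x) ?_ ?_ ?_
  · rintro p q ⟨v, hv⟩ ⟨w, hw⟩
    exact ⟨v + w, fun x => by rw [map_add, hv, hw, quarticEval_add]⟩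
  · exact ⟨0, fun x => by simp [quarticEval]⟩
  · intro d hd
    exact exists_quarticEval_eq_eval_monomial
      ((DFunLike.congr_fun Finsupp.degree_eq_weight_one d).trans (hF (mem_support_iff.1 hd))) _

lemma hasDerivAt_eval_add_single (a : Fin 3 → ℝ) (i : Fin 3) (p : MvPolynomial (Fin 3) ℝ) :
    HasDerivAt (fun t : ℝ => eval (a + Pi.single i t) p) (eval a (pderiv i p)) 0 := by
  induction p using MvPolynomial.induction_on with
  | C c => simpa using hasDerivAt_const (0 : ℝ) c
  | add p q hp hq => simp only [map_add]; exact hp.add hq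
  | mul_X p j hp =>
    have hX : HasDerivAt (fun t : ℝ => (a + Pi.single i t : Fin 3 → ℝ) j)
        ((Pi.single i 1 : Fin 3 → ℝ) j) 0 := by
      rcases eq_or_ne j i with rfl | h
      · simpa using (hasDerivAt_id (0 : ℝ)).const_add (a j)
      · simpa [h] using hasDerivAt_const (0 : ℝ) (a j)
    simp only [map_mul, eval_X, Derivation.leibniz, pderiv_X, smul_eq_mul, map_add]
    refine (hp.mul hX).congr_deriv ?_
    obtain rfl | h := eq_or_ne j i <;> simp [*] <;> ring

lemma eval_pderiv_eq_zero {F : MvPolynomial (Fin 3) ℝ} (hpos : ∀ x, 0 ≤ eval x F)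
    {a : Fin 3 → ℝ} (ha : eval a F = 0) (i : Fin 3) : eval a (pderiv i F) = 0 := by
  refine IsLocalMin.hasDerivAt_eq_zero (Eventually.of_forall fun t => ?_)
    (hasDerivAt_eval_add_single a i F)
  simpa [ha] using hpos _

/-- The ternary quadratic form with coefficient vector `q`, as a polynomial. -/
def quadPoly (q : Fin 6 → ℝ) : MvPolynomial (Fin 3) ℝ := quadEval (fun i => C (q i)) X

lemma eval_quadPoly (q : Fin 6 → ℝ) (x : Fin 3 → ℝ) : eval x (quadPoly q) = quadEval q x := by
  simp [quadPoly, quadEval]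

lemma isHomogeneous_quadPoly (q : Fin 6 → ℝ) : (quadPoly q).IsHomogeneous 2 := by
  have hX := fun i => isHomogeneous_X ℝ (i : Fin 3)
  have hXX := fun i j => (hX i).mul (hX j)
  unfold quadPoly quadEval
  simp only [sq]
  exact (((((((hXX 0 0).C_mul _).add ((hXX 1 1).C_mul _)).add ((hXX 2 2).C_mul _)).add
    ((hXX 0 1).C_mul _)).add ((hXX 0 2).C_mul _)).add ((hXX 1 2).C_mul _))

lemma posSemidef_fin_two_of {p q r : ℝ} (hp : 0 < p) (h : 0 ≤ p * r - q ^ 2) :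
    (!![p, q; q, r]).PosSemidef := by
  refine .of_dotProduct_mulVec_nonneg ?_ fun x => ?_
  · ext i j
    fin_cases i <;> fin_cases j <;> simp
  · simp only [dotProduct, Matrix.mulVec, Fin.sum_univ_two, Pi.star_apply, star_trivial,
      Matrix.of_apply, Matrix.cons_val]
    refine (mul_nonneg_iff_of_pos_left hp).1 ?_
    nlinarith [sq_nonneg (p * x 0 + q * x 1), mul_nonneg h (sq_nonneg (x 1))]

end TernaryQuartic

open TernaryQuartic

/-- Every smooth positive ternary quartic has a positive quadratic representation: if
`F ∈ ℝ[x₀,x₁,x₂]` is homogeneous of degree `4`, nonnegative on `ℝ³`, and its complex zero set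
is smooth, then `F` is the determinant of a symmetric `2 × 2` matrix of real homogeneous
quadratic forms which is positive semidefinite at every real point. -/
theorem smooth_positive_ternary_quartic_has_positive_quadratic_representation
    (F : MvPolynomial (Fin 3) ℝ)
    (hdeg : F.IsHomogeneous 4)
    (hpos : ∀ a : Fin 3 → ℝ, 0 ≤ MvPolynomial.eval a F)
    (hsmooth : ¬ ∃ a : Fin 3 → ℂ, a ≠ 0 ∧ MvPolynomial.aeval a F = 0 ∧
        ∀ i : Fin 3, MvPolynomial.aeval a (MvPolynomial.pderiv i F) = 0) :
    ∃ M : Matrix (Fin 2) (Fin 2) (MvPolynomial (Fin 3) ℝ),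
      M.IsSymm ∧ (∀ i j, (M i j).IsHomogeneous 2) ∧ M.det = F ∧
      ∀ a : Fin 3 → ℝ, (M.map (MvPolynomial.eval a)).PosSemidef := by
  obtain ⟨w, hw⟩ := exists_quarticEval_eq_eval hdeg
  have hwpos : w ∈ posQuartics := by
    intro a ha
    rw [← hw]
    refine (hpos a).lt_of_ne' fun h => hsmooth ⟨algebraMap ℝ ℂ ∘ a, ?_, ?_, fun i => ?_⟩
    · exact fun h0 => ha (funext fun i => by simpa using congrFun h0 i)
    · rw [aeval_algebraMap_apply, aeval_eq_eval, h, map_zero]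
    · rw [aeval_algebraMap_apply, aeval_eq_eval,
        eval_pderiv_eq_zero hpos h, map_zero]
  obtain ⟨M, hM, hM0⟩ := exists_pos_of_mem_range_detForm hwpos
    (mem_range_detForm_of_mem_posQuartics hwpos)
  have hdet : ∀ a, quadEval (M 0) a * quadEval (M 2) a - quadEval (M 1) a ^ 2 = eval a F :=
    fun a => by rw [hw, ← hM, quarticEval_detForm]
  refine ⟨!![quadPoly (M 0), quadPoly (M 1); quadPoly (M 1), quadPoly (M 2)], ?_, ?_, ?_, ?_⟩
  · ext i j
    fin_cases i <;> fin_cases j <;> rfl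
  · intro i j
    fin_cases i <;> fin_cases j <;> exact isHomogeneous_quadPoly _
  · refine MvPolynomial.funext fun a => ?_
    rw [Matrix.det_fin_two_of, map_sub, map_mul, map_mul, ← hdet]
    simp only [eval_quadPoly]
    ring
  · intro a
    have hM : ((!![quadPoly (M 0), quadPoly (M 1); quadPoly (M 1), quadPoly (M 2)]).map (eval a)) =
        !![quadEval (M 0) a, quadEval (M 1) a; quadEval (M 1) a, quadEval (M 2) a] := by
      ext i j
      fin_cases i <;> fin_cases j <;> exact eval_quadPoly _ a
    rw [hM]
    obtain rfl | ha := eq_or_ne a 0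
    · convert Matrix.PosSemidef.zero using 1
      ext i j
      fin_cases i <;> fin_cases j <;> simp [quadEval]
    · exact posSemidef_fin_two_of (hM0 a ha) (by rw [hdet]; exact hpos a)
end
end

section
/- Let M be a symmetric 3×3 matrix whose entries are real homogeneous polynomials of degree two in x₀, x₁, x₂, such that M(b) is positive semidefinite for all b ∈ ℝ³ and F = det(M) is not identically zero. If there exists 0 ≠ a ∈ ℝ³ such that the kernel of the real matrix M(a) has dimension at least two, then F is a sum of squares of real homogeneous polynomials of degree three. -/
open MvPolynomial

noncomputable section

open scoped Quaternion

namespace Polynomial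

/-- A real polynomial is nonnegative if a nonzero nonnegative multiple of it is. -/
lemma eval_nonneg_of_mul {A B : ℝ[X]} (hA0 : A ≠ 0) (hA : ∀ t, 0 ≤ A.eval t)
    (hAB : ∀ t, 0 ≤ (A * B).eval t) (t : ℝ) : 0 ≤ B.eval t := by
  have hfin : {t : ℝ | A.eval t = 0}.Finite := by
    refine A.roots.toFinset.finite_toSet.subset fun x hx => ?_
    simpa [hA0] using hx
  have hd : Dense {t : ℝ | A.eval t = 0}ᶜ := hfin.countable.dense_compl ℝ
  have hcl : IsClosed {t : ℝ | 0 ≤ B.eval t} := isClosed_le continuous_const B.continuous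
  have hsub : {t : ℝ | A.eval t = 0}ᶜ ⊆ {t : ℝ | 0 ≤ B.eval t} := fun x hx => by
    have h1 : 0 < A.eval x := lt_of_le_of_ne (hA x) (Ne.symm hx)
    have h2 := hAB x
    rw [eval_mul] at h2
    exact nonneg_of_mul_nonneg_right h2 h1
  exact hcl.closure_subset_iff.2 hsub (hd t)

/-- A nonnegative real univariate polynomial is a sum of two squares. -/
lemma exists_sq_add_sq_of_nonneg (P : ℝ[X]) (hP : ∀ t, 0 ≤ P.eval t) :
    ∃ u v : ℝ[X], P = u ^ 2 + v ^ 2 := by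
  induction hn : P.natDegree using Nat.strong_induction_on generalizing P with
  | _ n ih =>
  by_cases h0 : P.natDegree = 0
  · obtain ⟨c, rfl⟩ := natDegree_eq_zero.1 h0
    have hc : 0 ≤ c := by simpa using hP 0
    refine ⟨C (Real.sqrt c), 0, ?_⟩
    rw [← C_pow, Real.sq_sqrt hc]
    simp
  have hP0 : P ≠ 0 := fun h => h0 (by simp [h])
  -- it suffices to split off a factor which is itself a sum of two squares
  suffices ∃ (a b Q : ℝ[X]), a ^ 2 + b ^ 2 ≠ 0 ∧ (a ^ 2 + b ^ 2).natDegree ≠ 0 ∧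
      P = (a ^ 2 + b ^ 2) * Q by
    obtain ⟨a, b, Q, hab0, hab, rfl⟩ := this
    have hQ0 : Q ≠ 0 := right_ne_zero_of_mul hP0
    have hQ := eval_nonneg_of_mul hab0 (fun t => by simp; positivity) hP
    have hdeg := natDegree_mul hab0 hQ0
    obtain ⟨u, v, rfl⟩ := ih Q.natDegree (by omega) Q hQ rfl
    exact ⟨a * u - b * v, a * v + b * u, by ring⟩
  obtain ⟨z, hz⟩ := Complex.exists_root (f := P.map (algebraMap ℝ ℂ)) (by
    rw [degree_map]; exact natDegree_pos_iff_degree_pos.1 (Nat.pos_of_ne_zero h0))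
  have hz' : aeval z P = 0 := by
    rwa [IsRoot, eval_map_algebraMap] at hz
  by_cases him : z.im = 0
  · obtain ⟨r, rfl⟩ : ∃ r : ℝ, z = r := ⟨z.re, Complex.ext rfl (by simpa using him)⟩
    have hr : P.eval r = 0 := by
      have := aeval_algebraMap_apply ℂ r P
      rw [Complex.coe_algebraMap, hz'] at this
      simpa using this.symm
    obtain ⟨R, hR⟩ := dvd_iff_isRoot.2 hr
    have hRr : R.eval r = 0 := by
      have key : ∀ t, 0 ≤ (t - r) * R.eval t := fun t => by simpa [hR] using hP t
      apply le_antisymm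
      · have hcl : IsClosed {t : ℝ | R.eval t ≤ 0} := isClosed_le R.continuous continuous_const
        have : Set.Iio r ⊆ {t : ℝ | R.eval t ≤ 0} := fun t ht =>
          nonpos_of_mul_nonneg_right (key t) (sub_neg.2 ht)
        have := hcl.closure_subset_iff.2 this
        rw [closure_Iio] at this
        exact this Set.self_mem_Iic
      · have hcl : IsClosed {t : ℝ | 0 ≤ R.eval t} := isClosed_le continuous_const R.continuous
        have : Set.Ioi r ⊆ {t : ℝ | 0 ≤ R.eval t} := fun t ht =>
          nonneg_of_mul_nonneg_right (key t) (sub_pos.2 ht)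
        have := hcl.closure_subset_iff.2 this
        rw [closure_Ioi] at this
        exact this Set.self_mem_Ici
    obtain ⟨Q, hQ⟩ := dvd_iff_isRoot.2 hRr
    have hs : (X - C r : ℝ[X]) ^ 2 + 0 ^ 2 = (X - C r) ^ 2 := by ring
    refine ⟨X - C r, 0, Q, ?_, ?_, ?_⟩
    · rw [hs]; exact pow_ne_zero _ (X_sub_C_ne_zero r)
    · rw [hs, natDegree_pow, natDegree_X_sub_C]; norm_num
    · rw [hR, hQ]; ring
  · obtain ⟨Q, hQ⟩ := P.quadratic_dvd_of_aeval_eq_zero_im_ne_zero hz' him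
    have hs : X ^ 2 - C (2 * z.re) * X + C (‖z‖ ^ 2) = (X - C z.re) ^ 2 + (C z.im) ^ 2 := by
      rw [Complex.sq_norm, Complex.normSq_apply]
      simp only [C_add, C_mul, C_ofNat]
      ring
    have hd : (X ^ 2 - C (2 * z.re) * X + C (‖z‖ ^ 2)).natDegree = 2 := by
      compute_degree!
    rw [hs] at hd hQ
    exact ⟨X - C z.re, C z.im, Q, fun h => by simp [h] at hd, by omega, hQ⟩

lemma exists_quaternion_eq {R : Type*} [CommRing R] (a b c d : R) :
    ∃ x : ℍ[R], x.re = a ∧ x.imI = b ∧ x.imJ = c ∧ x.imK = d :=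
  ⟨(⟨a, b, c, d⟩ : QuaternionAlgebra R (-1) 0 (-1)), rfl, rfl, rfl, rfl⟩

lemma eq_zero_of_normSq_eq_zero {β : ℍ[ℝ[X]]} (h : Quaternion.normSq β = 0) : β = 0 := by
  rw [Quaternion.normSq_def'] at h
  have h' : ∀ t, β.re.eval t ^ 2 + β.imI.eval t ^ 2 + β.imJ.eval t ^ 2 + β.imK.eval t ^ 2 = 0 :=
    fun t => by simpa using congrArg (Polynomial.eval t) h
  ext1 <;> refine Polynomial.funext fun t => ?_ <;>
    simp only [Quaternion.re_zero, Quaternion.imI_zero, Quaternion.imJ_zero,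
      Quaternion.imK_zero, eval_zero] <;>
    refine pow_eq_zero_iff two_ne_zero |>.1 (le_antisymm ?_ (sq_nonneg _)) <;>
    nlinarith [h' t, sq_nonneg (β.re.eval t), sq_nonneg (β.imI.eval t),
      sq_nonneg (β.imJ.eval t), sq_nonneg (β.imK.eval t)]

lemma eval_normSq_nonneg (β : ℍ[ℝ[X]]) (t : ℝ) : 0 ≤ (Quaternion.normSq β).eval t := by
  rw [Quaternion.normSq_def']
  simp only [eval_add, eval_pow]
  positivity

/-- A rank-one positive semidefinite quaternionic Hermitian `2 × 2` matrix over `ℝ[X]`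
is of the form `v v*`. The proof is by Euclidean descent on the upper left entry. -/
lemma exists_quaternion_factorization (A B : ℝ[X]) (β : ℍ[ℝ[X]])
    (hA : ∀ t, 0 ≤ A.eval t) (hB : ∀ t, 0 ≤ B.eval t)
    (h : A * B = Quaternion.normSq β) :
    ∃ δ γ : ℍ[ℝ[X]], A = Quaternion.normSq δ ∧ B = Quaternion.normSq γ ∧ β = δ * star γ := by
  induction hn : A.degree using WellFoundedLT.induction generalizing A B β with
  | _ n ih =>
  by_cases hA0 : A = 0
  · obtain ⟨u, v, huv⟩ := exists_sq_add_sq_of_nonneg B hB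
    obtain ⟨x, h1, h2, h3, h4⟩ := exists_quaternion_eq u v 0 0
    refine ⟨0, x, by simpa using hA0, by rw [huv, Quaternion.normSq_def', h1, h2, h3, h4]; simp, ?_⟩
    rw [zero_mul]
    exact eq_zero_of_normSq_eq_zero (by rw [← h, hA0, zero_mul])
  obtain ⟨β', hr₁, hr₂, hr₃, hr₄⟩ :=
    exists_quaternion_eq (β.re % A) (β.imI % A) (β.imJ % A) (β.imK % A)
  obtain ⟨q, hq₁, hq₂, hq₃, hq₄⟩ :=
    exists_quaternion_eq (β.re / A) (β.imI / A) (β.imJ / A) (β.imK / A)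
  have hβ : β = β' + A • q := by
    ext1 <;> simp [*, EuclideanDomain.mod_add_div]
  have hdvd : A ∣ Quaternion.normSq β' := by
    have h1 : Quaternion.normSq β' =
        Quaternion.normSq β - A * (2 * (β' * star q).re + A * Quaternion.normSq q) := by
      rw [hβ, Quaternion.normSq_add, Quaternion.normSq_smul]
      simp only [Quaternion.star_smul, mul_smul_comm, Quaternion.re_smul, smul_eq_mul]
      ring
    rw [h1, ← h]
    exact dvd_sub (dvd_mul_right _ _) (dvd_mul_right _ _)
  obtain ⟨B', hB'⟩ := hdvd
  have hB'pos : ∀ t, 0 ≤ B'.eval t :=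
    eval_nonneg_of_mul hA0 hA fun t => hB' ▸ eval_normSq_nonneg β' t
  have hlt : B'.degree < n := by
    by_cases hB'0 : B' = 0
    · rw [hB'0, degree_zero, ← hn]
      exact bot_lt_iff_ne_bot.2 (degree_ne_bot.2 hA0)
    have hsq : ∀ p : ℝ[X], ((p % A) ^ 2).degree < A.degree + A.degree := fun p => by
      have hp : (p % A).degree < A.degree := degree_mod_lt p hA0
      rw [degree_pow, two_nsmul]
      by_cases hp0 : p % A = 0
      · rw [hp0, degree_zero, degree_eq_natDegree hA0]
        exact WithBot.bot_lt_coe _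
      · rw [degree_eq_natDegree hA0, degree_eq_natDegree hp0] at *
        norm_cast at *
        omega
    have hN : (A * B').degree < A.degree + A.degree := by
      rw [← hB', Quaternion.normSq_def', hr₁, hr₂, hr₃, hr₄]
      refine (degree_add_le _ _).trans_lt (max_lt ((degree_add_le _ _).trans_lt (max_lt
        ((degree_add_le _ _).trans_lt (max_lt ?_ ?_)) ?_)) ?_) <;> exact hsq _
    rw [degree_mul, degree_eq_natDegree hA0, degree_eq_natDegree hB'0] at hN
    rw [← hn, degree_eq_natDegree hA0, degree_eq_natDegree hB'0]
    norm_cast at *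
    omega
  obtain ⟨δ, γ, hδ, hγ, hβδ⟩ := ih _ hlt B' A (star β') hB'pos hA
    (by rw [Quaternion.normSq_star, hB', mul_comm]) rfl
  have hβ'γ : β' = γ * star δ := by rw [← star_star β', hβδ]; simp
  have hfac : β = γ * star (δ + star q * γ) := by
    have hstar : star (δ + star q * γ) = star δ + star γ * q := by
      ext1 <;> simp <;> ring
    rw [hstar, mul_add, ← mul_assoc, Quaternion.self_mul_star,
      ← hβ'γ, ← hγ, Quaternion.coe_mul_eq_smul, ← hβ]
  refine ⟨γ, δ + star q * γ, hγ, ?_, hfac⟩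
  apply mul_left_cancel₀ hA0
  rw [h, hfac, map_mul, Quaternion.normSq_star, ← hγ]

/-- A nonnegative polynomial `A s² + 2 B s + D` with `A, B, D ∈ ℝ[t]` is a sum of squares. -/
lemma exists_sum_sq_of_quadratic_nonneg (A B D : ℝ[X])
    (h : ∀ s t : ℝ, 0 ≤ A.eval t * s ^ 2 + 2 * B.eval t * s + D.eval t) :
    ∃ p q : Fin 4 → ℝ[X], A = ∑ i, p i ^ 2 ∧ B = ∑ i, p i * q i ∧ D = ∑ i, q i ^ 2 := by
  have hD : ∀ t, 0 ≤ D.eval t := fun t => by simpa using h 0 t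
  have hdisc : ∀ t, 0 ≤ A.eval t * D.eval t - B.eval t ^ 2 := fun t => by
    have := discrim_le_zero (a := A.eval t) (b := 2 * B.eval t) (c := D.eval t)
      (fun s => by have := h s t; nlinarith)
    rw [discrim] at this
    nlinarith
  have hA : ∀ t, 0 ≤ A.eval t := fun t => by
    by_contra! hneg
    have hBt : B.eval t = 0 := by
      have := hdisc t
      nlinarith [mul_nonneg (neg_nonneg.2 hneg.le) (hD t), sq_nonneg (B.eval t)]
    have h1 := h ((D.eval t + 1) / -A.eval t + 1) t
    have h2 : 0 ≤ (D.eval t + 1) / -A.eval t :=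
      div_nonneg (by linarith [hD t]) (by linarith)
    have h3 : (D.eval t + 1) / -A.eval t * A.eval t = -(D.eval t + 1) := by
      field_simp [hneg.ne]
    rw [hBt] at h1
    nlinarith [mul_nonneg h2 (neg_nonneg.2 hneg.le), hD t]
  obtain ⟨u, v, huv⟩ := exists_sq_add_sq_of_nonneg (A * D - B ^ 2) (fun t => by simpa using hdisc t)
  obtain ⟨β, h1, h2, h3, h4⟩ := exists_quaternion_eq B u v 0
  obtain ⟨δ, γ, hδ, hγ, hβ⟩ := exists_quaternion_factorization A D β hA hD (by
    rw [Quaternion.normSq_def', h1, h2, h3, h4]; linear_combination huv)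
  have hB : B = (δ * star γ).re := by rw [← hβ, h1]
  refine ⟨![δ.re, δ.imI, δ.imJ, δ.imK], ![γ.re, γ.imI, γ.imJ, γ.imK], ?_, ?_, ?_⟩
  · simpa [Fin.sum_univ_four, Quaternion.normSq_def'] using hδ
  · simpa [Fin.sum_univ_four, Quaternion.re_mul] using hB
  · simpa [Fin.sum_univ_four, Quaternion.normSq_def'] using hγ

/-- Leading terms of squares of real polynomials cannot cancel. -/
lemma natDegree_le_of_sum_sq {ι : Type*} [Fintype ι] (p : ι → ℝ[X]) (d : ℕ)
    (h : (∑ i, p i ^ 2).natDegree ≤ 2 * d) (i : ι) : (p i).natDegree ≤ d := by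
  set m := Finset.univ.sup fun i => (p i).natDegree with hm
  have hle : ∀ j, (p j).natDegree ≤ m := fun j =>
    Finset.le_sup (f := fun i => (p i).natDegree) (Finset.mem_univ j)
  by_contra! hi
  have hdm : d < m := hi.trans_le (hle i)
  obtain ⟨j, -, hj⟩ := Finset.exists_mem_eq_sup Finset.univ ⟨i, Finset.mem_univ i⟩
    fun i => (p i).natDegree
  have h0 : (∑ i, p i ^ 2).coeff (2 * m) = 0 := coeff_eq_zero_of_natDegree_lt (by omega)
  rw [finsetSum_coeff, Finset.sum_congr rfl fun k _ => coeff_pow_of_natDegree_le (hle k),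
    Finset.sum_eq_zero_iff_of_nonneg fun k _ => sq_nonneg _] at h0
  have hlead : (p j).leadingCoeff = 0 := by
    rw [leadingCoeff, ← hj, ← hm]
    exact pow_eq_zero_iff two_ne_zero |>.1 (h0 j (Finset.mem_univ j))
  rw [leadingCoeff_eq_zero] at hlead
  rw [← hm, hlead, natDegree_zero] at hj
  omega

end Polynomial

namespace MvPolynomial

/-- The polarization of a polynomial map. -/
def polar (p : MvPolynomial (Fin 3) ℝ) (u v : Fin 3 → ℝ) : ℝ :=
  eval (u + v) p - eval u p - eval v p

lemma IsHomogeneous.eval_linear_combination {p : MvPolynomial (Fin 3) ℝ} (hp : p.IsHomogeneous 2)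
    (u v w : Fin 3 → ℝ) (s t r : ℝ) :
    eval (s • u + t • v + r • w) p = s ^ 2 * eval u p + t ^ 2 * eval v p + r ^ 2 * eval w p +
      s * t * p.polar u v + s * r * p.polar u w + t * r * p.polar v w := by
  simp only [polar, eval_eq', ← Finset.sum_sub_distrib, Finset.mul_sum, ← Finset.sum_add_distrib]
  refine Finset.sum_congr rfl fun d hd => ?_
  have hdeg : d 0 + d 1 + d 2 = 2 := by
    have := hp.degree_eq_sum_deg_support hd
    rw [Finset.sum_subset (Finset.subset_univ d.support) (by simp)] at this
    simpa [Fin.sum_univ_three] using this.symm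
  simp only [Fin.prod_univ_three, Pi.add_apply, Pi.smul_apply, smul_eq_mul]
  have h0 : d 0 ≤ 2 := by omega
  have h1 : d 1 ≤ 2 := by omega
  have h2 : d 2 = 2 - d 0 - d 1 := by omega
  rw [h2] at hdeg ⊢
  interval_cases d 0 <;> interval_cases d 1 <;> first | omega | (norm_num; ring)

lemma IsHomogeneous.eval_smul_eq {p : MvPolynomial (Fin 3) ℝ} (hp : p.IsHomogeneous 2)
    (r : ℝ) (v : Fin 3 → ℝ) : eval (r • v) p = r ^ 2 * eval v p := by
  simpa using hp.eval_linear_combination v 0 0 r 0 0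

lemma eval_homogenize_eq {p : Polynomial ℝ} {n : ℕ} (g : Fin 2 → ℝ) (hg : g 1 ≠ 0)
    (hn : p.natDegree ≤ n) : eval g (p.homogenize n) = g 1 ^ n * p.eval (g 0 / g 1) := by
  refine Polynomial.induction_with_natDegree_le
    (fun p => eval g (p.homogenize n) = g 1 ^ n * p.eval (g 0 / g 1)) n ?_ ?_ ?_ p hn
  · simp
  · intro k r _ hk
    obtain ⟨m, rfl⟩ := Nat.exists_eq_add_of_le hk
    have hpow : g 1 ^ (k + m) * (g 0 / g 1) ^ k = g 0 ^ k * g 1 ^ m := by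
      rw [pow_add, div_pow]
      field_simp
    simp only [Polynomial.homogenize_C_mul, Polynomial.homogenize_X_pow hk, map_mul, map_pow,
      eval_C, eval_X, Polynomial.eval_mul, Polynomial.eval_pow, Polynomial.eval_C,
      Polynomial.eval_X]
    rw [mul_left_comm _ r, hpow, Nat.add_sub_cancel_left, mul_left_comm]
  · intro f q _ _ hf hq
    simp [hf, hq, mul_add]

end MvPolynomial

/-- Linear coordinates adapted to a basis whose first vector is `a`. -/
lemma exists_linear_coordinates (a : Fin 3 → ℝ) (ha : a ≠ 0) :
    ∃ (b c : Fin 3 → ℝ) (ξ : Fin 3 → MvPolynomial (Fin 3) ℝ), (∀ i, (ξ i).IsHomogeneous 1) ∧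
      ξ 2 ≠ 0 ∧ ∀ v, v = eval v (ξ 0) • a + eval v (ξ 1) • b + eval v (ξ 2) • c := by
  obtain ⟨b, hb⟩ := exists_linearIndependent_snoc_of_lt_finrank (R := ℝ) (v := ![a])
    (LinearIndependent.of_subsingleton 0 (by simpa)) (by simp)
  obtain ⟨c, hc⟩ := exists_linearIndependent_snoc_of_lt_finrank (R := ℝ) hb (by simp)
  set w : Fin 3 → (Fin 3 → ℝ) := Fin.snoc (Fin.snoc ![a] b) c with hw
  have hP := Matrix.linearIndependent_rows_iff_isUnit (A := Matrix.of w).1 hc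
  rw [Matrix.isUnit_iff_isUnit_det] at hP
  set P := Matrix.of w
  let ξ : Fin 3 → MvPolynomial (Fin 3) ℝ := fun i => ∑ k, C (P⁻¹ k i) * X k
  have hξ : ∀ v i, eval v (ξ i) = Matrix.vecMul v P⁻¹ i := fun v i => by
    simp [ξ, Matrix.vecMul, dotProduct, mul_comm]
  have hw0 : w 0 = a := rfl
  have hw1 : w 1 = b := rfl
  have hw2 : w 2 = c := rfl
  refine ⟨b, c, ξ, fun i => IsHomogeneous.sum _ _ _ fun k _ => isHomogeneous_C_mul_X _ _,
    fun h => ?_, fun v => ?_⟩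
  · have h1 : eval c (ξ 2) = 1 := by
      have : c = Matrix.vecMul (Pi.single 2 1) P := by
        rw [Matrix.single_one_vecMul]
        exact hw2.symm
      rw [hξ, this, Matrix.vecMul_vecMul, Matrix.mul_nonsing_inv _ hP, Matrix.vecMul_one]
      simp
    simp [h] at h1
  · have h1 : v = Matrix.vecMul (Matrix.vecMul v P⁻¹) P := by
      rw [Matrix.vecMul_vecMul, Matrix.nonsing_inv_mul _ hP, Matrix.vecMul_one]
    conv_lhs => rw [h1]
    ext k
    simp only [hξ, ← hw0, ← hw1, ← hw2]
    rw [Matrix.vecMul, dotProduct, Fin.sum_univ_three]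
    simp [P]

lemma eq_zero_of_forall_mul_add_nonneg {l k : ℝ} (h : ∀ s : ℝ, 0 ≤ l * s + k) : l = 0 := by
  by_contra hl
  have := h (-(k + 1) / l)
  rw [mul_div_cancel₀ _ hl] at this
  linarith

/-- A real function on `ℝ³`, given by a sextic form, which in suitable linear coordinates is
quadratic in the first one and nonnegative, is a sum of squares of cubic forms. -/
lemma exists_sum_sq_of_quadratic_in_coordinate (F : MvPolynomial (Fin 3) ℝ)
    (hF : ∀ (r : ℝ) (v : Fin 3 → ℝ), eval (r • v) F = r ^ 6 * eval v F)
    (hpos : ∀ v, 0 ≤ eval v F)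
    (a b c : Fin 3 → ℝ) (ξ : Fin 3 → MvPolynomial (Fin 3) ℝ) (hξ : ∀ i, (ξ i).IsHomogeneous 1)
    (hξ2 : ξ 2 ≠ 0) (hv : ∀ v, v = eval v (ξ 0) • a + eval v (ξ 1) • b + eval v (ξ 2) • c)
    (A B D : Polynomial ℝ) (hA : A.natDegree ≤ 4) (hD : D.natDegree ≤ 6)
    (hABD : ∀ s t : ℝ, eval (s • a + t • b + c) F =
      A.eval t * s ^ 2 + 2 * B.eval t * s + D.eval t) :
    ∃ g : Fin 4 → MvPolynomial (Fin 3) ℝ, (∀ i, (g i).IsHomogeneous 3) ∧ F = ∑ i, g i ^ 2 := by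
  obtain ⟨p, q, rfl, rfl, rfl⟩ := Polynomial.exists_sum_sq_of_quadratic_nonneg A B D
    fun s t => hABD s t ▸ hpos _
  have hp := Polynomial.natDegree_le_of_sum_sq p 2 hA
  have hq := Polynomial.natDegree_le_of_sum_sq q 3 hD
  have hhom : ∀ (P : Polynomial ℝ) n,
      (aeval ![ξ 1, ξ 2] (P.homogenize n)).IsHomogeneous n := fun P n => by
    simpa using (Polynomial.isHomogeneous_homogenize (n := n) P).aeval ![ξ 1, ξ 2] (n := 1)
      (by intro i; fin_cases i <;> simp [hξ])
  have heval : ∀ (P : Polynomial ℝ) n v, P.natDegree ≤ n → eval v (ξ 2) ≠ 0 →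
      eval v (aeval ![ξ 1, ξ 2] (P.homogenize n)) =
        eval v (ξ 2) ^ n * P.eval (eval v (ξ 1) / eval v (ξ 2)) := fun P n v hP h2 => by
    have h := eval_homogenize_eq ![eval v (ξ 1), eval v (ξ 2)] h2 hP
    have hg : ![eval v (ξ 1), eval v (ξ 2)] = fun i => aeval v (![ξ 1, ξ 2] i) := by
      ext i; fin_cases i <;> rfl
    rw [← coe_aeval_eq_eval v, RingHom.coe_coe, comp_aeval_apply, ← hg, ← RingHom.coe_coe,
      coe_aeval_eq_eval]
    exact h
  refine ⟨fun i => ξ 0 * aeval ![ξ 1, ξ 2] ((p i).homogenize 2) +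
    aeval ![ξ 1, ξ 2] ((q i).homogenize 3),
    fun i => ((hξ 0).mul (hhom (p i) 2)).add (hhom (q i) 3), ?_⟩
  apply mul_right_cancel₀ hξ2
  refine MvPolynomial.funext fun v => ?_
  simp only [map_mul, map_sum, map_pow, map_add]
  by_cases h2 : eval v (ξ 2) = 0
  · simp [h2]
  congr 1
  set s := eval v (ξ 0) with hs
  set t := eval v (ξ 1) with ht
  set r := eval v (ξ 2) with hr
  have hvr : v = r • ((s / r) • a + (t / r) • b + c) := by
    conv_lhs => rw [hv v]
    rw [smul_add, smul_add, smul_smul, smul_smul, mul_div_cancel₀ _ h2, mul_div_cancel₀ _ h2]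
  have hFv : eval v F = ∑ i, (r ^ 3 * ((p i).eval (t / r) * (s / r) + (q i).eval (t / r))) ^ 2 := by
    conv_lhs => rw [hvr, hF, hABD]
    simp only [Fin.sum_univ_four, Polynomial.eval_add, Polynomial.eval_mul, Polynomial.eval_pow]
    ring
  rw [hFv]
  refine Finset.sum_congr rfl fun i _ => ?_
  rw [heval (p i) 2 v (hp i) h2, heval (q i) 3 v (hq i) h2, ← hr, ← ht]
  field_simp

/-- The case where `M(a)` vanishes off its upper left entry: then `det M` has degree at most two
along the direction `a`. -/
lemma exists_sum_sq_det_of_eval_eq_zero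
    (M : Matrix (Fin 3) (Fin 3) (MvPolynomial (Fin 3) ℝ))
    (hsymm : M.IsSymm)
    (hhom : ∀ i j, (M i j).IsHomogeneous 2)
    (hpsd : ∀ b : Fin 3 → ℝ, (M.map (eval b)).PosSemidef)
    (a : Fin 3 → ℝ) (ha : a ≠ 0) (hMa : ∀ i j, j ≠ 0 → eval a (M i j) = 0) :
    ∃ g : Fin 4 → MvPolynomial (Fin 3) ℝ,
      (∀ i, (g i).IsHomogeneous 3) ∧ M.det = ∑ i, g i ^ 2 := by
  obtain ⟨b, c, ξ, hξ, hξ2, hv⟩ := exists_linear_coordinates a ha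
  let L : Fin 3 → Fin 3 → Polynomial ℝ := fun i j =>
    Polynomial.C ((M i j).polar a b) * Polynomial.X + Polynomial.C ((M i j).polar a c)
  let K : Fin 3 → Fin 3 → Polynomial ℝ := fun i j =>
    Polynomial.C (eval b (M i j)) * Polynomial.X ^ 2 +
      Polynomial.C ((M i j).polar b c) * Polynomial.X + Polynomial.C (eval c (M i j))
  have hM : ∀ i j s t, eval (s • a + t • b + c) (M i j) =
      eval a (M i j) * s ^ 2 + (L i j).eval t * s + (K i j).eval t := fun i j s t => by
    have := (hhom i j).eval_linear_combination a b c s t 1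
    rw [one_smul] at this
    rw [this]
    simp [L, K]
    ring
  have hsymm' : ∀ i j, M i j = M j i := fun i j => hsymm.apply j i
  have hdiag : ∀ i, i ≠ 0 → ∀ t, (L i i).eval t = 0 := fun i hi t =>
    eq_zero_of_forall_mul_add_nonneg (k := (K i i).eval t) fun s => by
      have := (hpsd (s • a + t • b + c)).diag_nonneg (i := i)
      simpa [hM, hMa i i hi] using this
  have h11 := hdiag 1 (by decide)
  have h22 := hdiag 2 (by decide)
  have hL21 : L 2 1 = L 1 2 := by simp only [L, hsymm' 2 1]
  have hK21 : K 2 1 = K 1 2 := by simp only [K, hsymm' 2 1]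
  have h12 : ∀ t, (L 1 2).eval t = 0 := fun t => by
    have : 2 * (L 1 2).eval t = 0 := eq_zero_of_forall_mul_add_nonneg
        (k := (K 1 1).eval t + 2 * (K 1 2).eval t + (K 2 2).eval t) fun s => by
      have := (hpsd (s • a + t • b + c)).dotProduct_mulVec_nonneg ![0, 1, 1]
      simp [dotProduct, Matrix.mulVec, Fin.sum_univ_three, hM, hL21, hK21, hMa, h11,
        h22] at this
      linarith
    linarith
  let Δ := K 1 1 * K 2 2 - K 1 2 ^ 2
  let A := Polynomial.C (eval a (M 0 0)) * Δ - L 0 1 ^ 2 * K 2 2 + 2 * (L 0 1 * L 0 2 * K 1 2)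
    - L 0 2 ^ 2 * K 1 1
  let B := Polynomial.C (1 / 2) * (L 0 0 * Δ) - L 0 1 * K 0 1 * K 2 2 +
    (L 0 1 * K 0 2 + L 0 2 * K 0 1) * K 1 2 - L 0 2 * K 0 2 * K 1 1
  let D := K 0 0 * Δ - K 0 1 ^ 2 * K 2 2 + 2 * (K 0 1 * K 0 2 * K 1 2) - K 0 2 ^ 2 * K 1 1
  have hevaldet : ∀ v, eval v M.det = (M.map (eval v)).det := fun v => by
    rw [RingHom.map_det]; rfl
  refine exists_sum_sq_of_quadratic_in_coordinate M.det (fun r v => ?_)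
    (fun v => hevaldet v ▸ (hpsd v).det_nonneg) a b c ξ hξ hξ2 hv A B D ?_ ?_ fun s t => ?_
  · have : M.map (eval (r • v)) = r ^ 2 • M.map (eval v) := by
      ext i j
      simp [(hhom i j).eval_smul_eq]
    rw [hevaldet, hevaldet, this, Matrix.det_smul, Fintype.card_fin, ← pow_mul]
  · simp only [A, Δ, L, K]
    compute_degree
  · simp only [D, Δ, K]
    compute_degree
  · rw [hevaldet, Matrix.det_fin_three]
    simp only [Matrix.map_apply, hM, hsymm' 1 0, hsymm' 2 0, hsymm' 2 1, h11, h22, h12,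
      hMa _ 1 (by decide), hMa _ 2 (by decide)]
    simp [A, B, D, Δ]
    ring

/-- A subspace of dimension at least two contains the last two vectors of some basis of `ℝ³`. -/
lemma exists_isUnit_det_row_mem (W : Submodule ℝ (Fin 3 → ℝ)) (hW : 2 ≤ Module.finrank ℝ W) :
    ∃ Q : Matrix (Fin 3) (Fin 3) ℝ, IsUnit Q.det ∧ ∀ i, i ≠ 0 → Q i ∈ W := by
  obtain ⟨f, hf⟩ := exists_linearIndependent_of_le_finrank hW
  have hf' := hf.map' W.subtype W.ker_subtype
  obtain ⟨u, hu⟩ := exists_linearIndependent_cons_of_lt_finrank (R := ℝ) hf' (by simp)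
  refine ⟨Matrix.of (Fin.cons u (W.subtype ∘ f)), ?_, fun i hi => ?_⟩
  · rw [← Matrix.isUnit_iff_isUnit_det]
    exact Matrix.linearIndependent_rows_iff_isUnit.1 hu
  · obtain ⟨j, rfl⟩ := Fin.exists_succ_eq.2 hi
    exact (f j).2

/-- If `M` is a symmetric `3 × 3` matrix of real homogeneous quadratic forms which is positive
semidefinite at every real point, whose determinant `F` is not identically zero, and if `M(a)`
has kernel of dimension at least two at some real point `0 ≠ a ∈ ℝ³`, then `F` is a sum of
squares of real homogeneous cubic forms. -/
theorem sos_of_real_kernel_dim_ge_two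
    (M : Matrix (Fin 3) (Fin 3) (MvPolynomial (Fin 3) ℝ))
    (hsymm : M.IsSymm)
    (hhom : ∀ i j, (M i j).IsHomogeneous 2)
    (hpsd : ∀ b : Fin 3 → ℝ, (M.map (MvPolynomial.eval b)).PosSemidef)
    (hF : M.det ≠ 0)
    (a : Fin 3 → ℝ) (ha : a ≠ 0)
    (hker : 2 ≤ Module.finrank ℝ
      (LinearMap.ker (Matrix.mulVecLin (M.map (MvPolynomial.eval a))))) :
    ∃ (k : ℕ) (g : Fin k → MvPolynomial (Fin 3) ℝ),
      (∀ i, (g i).IsHomogeneous 3) ∧ M.det = ∑ i, g i ^ 2 := by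
  obtain ⟨Q, hQ, hQker⟩ := exists_isUnit_det_row_mem _ hker
  let N := Q.map C * M * (Q.map C).transpose
  have hN : ∀ b, N.map (eval b) = Q * M.map (eval b) * Q.transpose := fun b => by
    have hC : (Q.map C).map (eval b) = Q := by ext; simp
    rw [Matrix.map_mul, Matrix.map_mul, Matrix.transpose_map, hC]
  have hNsymm : N.IsSymm := by
    simp only [N, Matrix.IsSymm, Matrix.transpose_mul, Matrix.transpose_transpose, hsymm.eq,
      Matrix.mul_assoc]
  have hNhom : ∀ i j, (N i j).IsHomogeneous 2 := by
    intro i j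
    simp only [N, Matrix.mul_apply, Matrix.map_apply, Matrix.transpose_apply]
    refine IsHomogeneous.sum _ _ _ fun k _ => ?_
    rw [mul_comm]
    refine (IsHomogeneous.sum _ _ _ fun l _ => ?_).C_mul _
    exact (hhom l k).C_mul _
  have hNpsd : ∀ b, (N.map (eval b)).PosSemidef := by
    intro b
    rw [hN]
    simpa using (hpsd b).mul_mul_conjTranspose_same Q
  have hNa : ∀ i j, j ≠ 0 → eval a (N i j) = 0 := by
    intro i j hj
    have h0 : (M.map (eval a)).mulVec (Q j) = 0 := hQker j hj
    have h1 : eval a (N i j) = (Q * M.map (eval a) * Q.transpose) i j := by rw [← hN]; rfl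
    rw [h1, Matrix.mul_assoc, Matrix.mul_apply]
    refine Finset.sum_eq_zero fun k _ => ?_
    have h2 : (M.map (eval a) * Q.transpose) k j = (M.map (eval a)).mulVec (Q j) k := rfl
    rw [h2, h0]
    simp
  obtain ⟨g, hg, hdet⟩ := exists_sum_sq_det_of_eval_eq_zero N hNsymm hNhom hNpsd a ha hNa
  refine ⟨4, fun i => C (Q.det)⁻¹ * g i, fun i => (hg i).C_mul _, ?_⟩
  have hdetQ : (Q.map C).det = (C Q.det : MvPolynomial (Fin 3) ℝ) := by
    rw [RingHom.map_det]; rfl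
  have hNdet : N.det = C Q.det ^ 2 * M.det := by
    rw [Matrix.det_mul, Matrix.det_mul, Matrix.det_transpose, hdetQ]
    ring
  simp only [mul_pow, ← Finset.mul_sum, ← hdet, hNdet]
  rw [← mul_assoc, ← mul_pow, ← C_mul, inv_mul_cancel₀ hQ.ne_zero]
  simp
end
end

section
/- Let M be a symmetric 3×3 matrix whose entries are real homogeneous polynomials of degree two in x₀, x₁, x₂, such that M(b) is positive semidefinite for all b ∈ ℝ³ and F = det(M) is not identically zero. Assume that F is not a sum of squares of real polynomials, and that every singular point of the zero set of F is real, i.e., for every 0 ≠ a ∈ ℂ³ with F(a) = 0 and all partial derivatives of F vanishing at a, there exist λ ∈ ℂ and b ∈ ℝ³ with a = λb. Then for all 0 ≠ a ∈ ℂ³ the kernel of the complex matrix M(a) has dimension at most one. -/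
open MvPolynomial

noncomputable section

/-- The binary quadratic form `A u² + 2 B u v + C v²` is a sum of squares of linear forms
`p u + q v`. -/
inductive IsSumSqForm {R : Type*} [CommRing R] : R → R → R → Prop
  | zero : IsSumSqForm 0 0 0
  | add_sq {A B C : R} (p q : R) (h : IsSumSqForm A B C) :
      IsSumSqForm (A + p ^ 2) (B + p * q) (C + q ^ 2)

namespace IsSumSqForm

variable {R : Type*} [CommRing R] {A B C A' B' C' : R}

theorem add (h : IsSumSqForm A B C) (h' : IsSumSqForm A' B' C') :
    IsSumSqForm (A + A') (B + B') (C + C') := by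
  induction h' with
  | zero => simpa using h
  | add_sq p q _ ih => simpa only [add_assoc] using ih.add_sq p q

theorem single (p q : R) : IsSumSqForm (p ^ 2) (p * q) (q ^ 2) := by
  simpa using (zero (R := R)).add_sq p q

theorem substitute (h : IsSumSqForm A B C) (a b c d : R) :
    IsSumSqForm (a ^ 2 * A + 2 * (a * b) * B + b ^ 2 * C)
      (a * c * A + (a * d + b * c) * B + b * d * C)
      (c ^ 2 * A + 2 * (c * d) * B + d ^ 2 * C) := by
  induction h with
  | zero => simpa using zero (R := R)
  | add_sq p q _ ih =>
    convert ih.add_sq (a * p + b * q) (c * p + d * q) using 1 <;> ring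

theorem swap (h : IsSumSqForm A B C) : IsSumSqForm C B A := by
  simpa using h.substitute 0 1 1 0

end IsSumSqForm

namespace Polynomial

theorem eval_nonneg_of_ne {P : ℝ[X]} {t₀ : ℝ} (h : ∀ t ≠ t₀, 0 ≤ P.eval t) (t : ℝ) :
    0 ≤ P.eval t := by
  have hc : IsClosed {t : ℝ | 0 ≤ P.eval t} := isClosed_le continuous_const P.continuous
  have hd : closure ({t₀}ᶜ : Set ℝ) ⊆ {t : ℝ | 0 ≤ P.eval t} :=
    hc.closure_subset_iff.2 fun t ht => h t ht
  rw [(dense_compl_singleton t₀).closure_eq] at hd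
  exact hd (Set.mem_univ t)

theorem exists_eq_sq_mul_of_nonneg {P : ℝ[X]} (hP : ∀ t, 0 ≤ P.eval t) {t₀ : ℝ}
    (h : P.eval t₀ = 0) :
    ∃ Q : ℝ[X], P = (X - C t₀) ^ 2 * Q ∧ ∀ t, 0 ≤ Q.eval t := by
  obtain ⟨Q, hQ⟩ := dvd_iff_isRoot.2 h
  have hmin : IsLocalMin (fun t => P.eval t) t₀ :=
    Filter.Eventually.of_forall fun t => by simpa [h] using hP t
  have hder := hmin.hasDerivAt_eq_zero (P.hasDerivAt t₀)
  have hQ0 : Q.eval t₀ = 0 := by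
    simpa [hQ, derivative_mul] using hder
  obtain ⟨S, hS⟩ := dvd_iff_isRoot.2 hQ0
  have hPS : P = (X - C t₀) ^ 2 * S := by rw [hQ, hS]; ring
  refine ⟨S, hPS, eval_nonneg_of_ne (t₀ := t₀) fun t ht => ?_⟩
  have h1 := hP t
  have h2 : 0 < (t - t₀) ^ 2 := by
    have := sub_ne_zero.2 ht
    positivity
  rw [hPS] at h1
  simp only [eval_mul, eval_pow, eval_sub, eval_X, eval_C] at h1
  exact nonneg_of_mul_nonneg_right h1 h2

theorem natDegree_X_sub_C_sq_mul {Q : ℝ[X]} (hQ : Q ≠ 0) (t₀ : ℝ) :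
    ((X - C t₀) ^ 2 * Q).natDegree = Q.natDegree + 2 := by
  rw [natDegree_mul (pow_ne_zero _ (X_sub_C_ne_zero t₀)) hQ, natDegree_pow, natDegree_X_sub_C]
  ring

theorem isSumSqForm_of_nonneg (P : ℝ[X]) (hP : ∀ t, 0 ≤ P.eval t) : IsSumSqForm 0 0 P := by
  induction hn : P.natDegree using Nat.strong_induction_on generalizing P with
  | _ n ih =>
  have const (c : ℝ) (hc : 0 ≤ c) : IsSumSqForm (0 : ℝ[X]) 0 (C c) := by
    have := IsSumSqForm.single (0 : ℝ[X]) (C √c)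
    simpa [← C_pow, Real.sq_sqrt hc] using this
  obtain ⟨t₀, ht₀⟩ := P.exists_forall_norm_le
  replace ht₀ : ∀ t, P.eval t₀ ≤ P.eval t := fun t => by
    simpa [abs_of_nonneg, hP] using ht₀ t
  obtain ⟨Q, hQ, hQ0⟩ := exists_eq_sq_mul_of_nonneg (P := P - C (P.eval t₀)) (t₀ := t₀)
    (fun t => by simpa using ht₀ t) (by simp)
  have hsum : IsSumSqForm 0 0 (P - C (P.eval t₀)) := by
    rcases eq_or_ne Q 0 with rfl | hne
    · simpa [hQ] using IsSumSqForm.zero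
    have hdeg : Q.natDegree < n := by
      rw [← hn, ← natDegree_sub_C (p := P) (a := P.eval t₀), hQ, natDegree_X_sub_C_sq_mul hne]
      lia
    rw [hQ]
    simpa using (ih _ hdeg Q hQ0 rfl).substitute 0 0 0 (X - C t₀)
  simpa using hsum.add (const _ (hP t₀))

theorem tendsto_abs_div_cocompact {P Q : ℝ[X]} (h : Q.degree < P.degree) (hQ : Q ≠ 0) :
    Filter.Tendsto (fun t => |P.eval t / Q.eval t|) (Filter.cocompact ℝ) Filter.atTop := by
  rw [cocompact_eq_atBot_atTop, Filter.tendsto_sup]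
  exact ⟨abs_div_tendsto_atBot_atTop_of_degree_gt P Q h hQ,
    abs_div_tendsto_atTop_atTop_of_degree_gt P Q h hQ⟩

/-- A positive semidefinite binary quadratic form over `ℝ[X]` is a sum of squares. -/
theorem isSumSqForm_of_posSemidef (P Q R : ℝ[X]) (hP : ∀ t, 0 ≤ P.eval t)
    (hR : ∀ t, 0 ≤ R.eval t) (hdet : ∀ t, 0 ≤ (P * R - Q ^ 2).eval t) :
    IsSumSqForm P Q R := by
  induction hn : (P * R - Q ^ 2).natDegree using Nat.strong_induction_on
    generalizing P Q R with
  | _ n ihn =>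
  induction hm : P.natDegree using Nat.strong_induction_on generalizing P Q R with
  | _ m ihm =>
  have split_root : ∀ (P Q R : ℝ[X]) (t₀ : ℝ), (∀ t, 0 ≤ P.eval t) → (∀ t, 0 ≤ R.eval t) →
      (∀ t, 0 ≤ (P * R - Q ^ 2).eval t) → (P * R - Q ^ 2).natDegree = n →
      P * R - Q ^ 2 ≠ 0 → P.eval t₀ = 0 → IsSumSqForm P Q R := by
    intro P Q R t₀ hP hR hdet hn hne h0
    have hQ0 : Q.eval t₀ = 0 := by
      have := hdet t₀
      simp only [eval_sub, eval_mul, eval_pow, h0] at this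
      nlinarith
    obtain ⟨P', rfl, hP'⟩ := exists_eq_sq_mul_of_nonneg hP h0
    obtain ⟨Q', rfl⟩ := dvd_iff_isRoot.2 hQ0
    have hfac : (X - C t₀) ^ 2 * P' * R - ((X - C t₀) * Q') ^ 2
        = (X - C t₀) ^ 2 * (P' * R - Q' ^ 2) := by ring
    rw [hfac] at hdet hn hne
    have hne' := right_ne_zero_of_mul hne
    rw [natDegree_X_sub_C_sq_mul hne'] at hn
    have hdet' : ∀ t, 0 ≤ (P' * R - Q' ^ 2).eval t :=
      eval_nonneg_of_ne (t₀ := t₀) fun t ht => by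
        have h1 := hdet t
        have h2 : 0 < (t - t₀) ^ 2 := by
          have := sub_ne_zero.2 ht
          positivity
        rw [eval_mul] at h1
        simp only [eval_pow, eval_sub, eval_X, eval_C] at h1
        refine nonneg_of_mul_nonneg_right ?_ h2
        simpa using h1
    simpa using (ihn _ (by lia) P' Q' R hP' hR hdet' rfl).substitute (X - C t₀) 0 0 1
  rcases eq_or_ne P 0 with rfl | hP0
  · have hQ : Q = 0 := by
      refine funext fun t => ?_
      have := hdet t
      simp only [zero_mul, zero_sub, eval_neg, eval_pow] at this
      simpa using (pow_eq_zero_iff two_ne_zero).1 (le_antisymm (by linarith) (sq_nonneg _))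
    simpa [hQ] using isSumSqForm_of_nonneg R hR
  obtain ⟨q, r, hqr, hrdeg⟩ : ∃ q r : ℝ[X], Q = q * P + r ∧ r.degree < P.degree :=
    ⟨Q / P, Q % P, by rw [mul_comm]; exact (EuclideanDomain.div_add_mod Q P).symm,
      degree_mod_lt Q hP0⟩
  obtain ⟨S, hS⟩ : ∃ S, S = R - 2 * q * Q + q ^ 2 * P := ⟨_, rfl⟩
  have hdetS : P * S - r ^ 2 = P * R - Q ^ 2 := by rw [hS, hqr]; ring
  suffices hred : IsSumSqForm P r S by
    convert hred.substitute 1 0 q 1 using 1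
    · ring
    · rw [hqr]; ring
    · rw [hS, hqr]; ring
  have hSnn : ∀ t, 0 ≤ S.eval t := by
    intro t
    rcases (hP t).eq_or_lt with h0 | hpos
    · have h1 := hdet t
      simp only [eval_sub, eval_mul, eval_pow, ← h0] at h1
      have h2 : Q.eval t = 0 := by nlinarith
      simpa [hS, ← h0, h2] using hR t
    · have h1 := hdet t
      rw [← hdetS] at h1
      simp only [eval_sub, eval_mul, eval_pow] at h1
      exact nonneg_of_mul_nonneg_right (by nlinarith [sq_nonneg (r.eval t)]) hpos
  rw [← hdetS] at hdet hn
  clear hdetS hS hqr hR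
  rcases eq_or_ne S 0 with rfl | hS0
  · have hr : r = 0 := by
      refine funext fun t => ?_
      have := hdet t
      simp only [mul_zero, zero_sub, eval_neg, eval_pow] at this
      simpa using (pow_eq_zero_iff two_ne_zero).1 (le_antisymm (by linarith) (sq_nonneg _))
    simpa [hr] using (isSumSqForm_of_nonneg P hP).swap
  rcases lt_or_ge S.natDegree P.natDegree with hlt | hge
  · exact (ihm _ (hm ▸ hlt) S r P hSnn hP (by simpa [mul_comm] using hdet)
      (by rw [mul_comm, hn]) rfl).swap
  rcases Nat.eq_zero_or_pos S.natDegree with hS1 | hS1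
  · have hr : r = 0 := by
      by_contra hr0
      have := natDegree_lt_natDegree hr0 hrdeg
      lia
    simpa [hr] using (isSumSqForm_of_nonneg P hP).swap.add (isSumSqForm_of_nonneg S hSnn)
  have hPS : P.degree ≤ S.degree := by
    rw [degree_eq_natDegree hP0, degree_eq_natDegree hS0]; exact_mod_cast hge
  have hSpos : 0 < S.degree := natDegree_pos_iff_degree_pos.1 hS1
  have hdegD : (P * S - r ^ 2).degree = P.degree + S.degree := by
    rw [← degree_mul]
    refine degree_sub_eq_left_of_degree_lt ?_
    rw [pow_two, degree_mul, degree_mul]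
    rcases eq_or_ne r 0 with rfl | hr0
    · simp [degree_eq_natDegree hP0, degree_eq_natDegree hS0]
    rw [degree_eq_natDegree hr0, degree_eq_natDegree hP0, degree_eq_natDegree hS0] at *
    norm_cast at *
    lia
  have hDP : P.degree < (P * S - r ^ 2).degree := by
    rw [hdegD, degree_eq_natDegree hP0, degree_eq_natDegree hS0]
    norm_cast
    lia
  have hD0 : P * S - r ^ 2 ≠ 0 := ne_zero_of_degree_gt hDP
  by_cases hroot : ∃ t₀, P.eval t₀ = 0
  · obtain ⟨t₀, ht₀⟩ := hroot
    exact split_root P r S t₀ hP hSnn hdet hn hD0 ht₀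
  push Not at hroot
  replace hP : ∀ t, 0 < P.eval t := fun t => (hP t).lt_of_ne' (hroot t)
  obtain ⟨t₀, ht₀⟩ := (((P * S - r ^ 2).continuous.div P.continuous hroot).abs).exists_forall_le
    (tendsto_abs_div_cocompact hDP hP0)
  obtain ⟨l, hl⟩ : ∃ l, l = (P * S - r ^ 2).eval t₀ / P.eval t₀ := ⟨_, rfl⟩
  have hl0 : 0 ≤ l := hl ▸ div_nonneg (hdet t₀) (hP t₀).le
  have hle : ∀ t, l * P.eval t ≤ (P * S - r ^ 2).eval t := fun t => by
    have := ht₀ t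
    simp only [Pi.div_apply] at this
    rw [abs_of_nonneg (div_nonneg (hdet t₀) (hP t₀).le),
      abs_of_nonneg (div_nonneg (hdet t) (hP t).le), ← hl, le_div_iff₀ (hP t)] at this
    exact this
  have hleq : l * P.eval t₀ = (P * S - r ^ 2).eval t₀ := by
    rw [hl, div_mul_cancel₀ _ (hroot t₀)]
  obtain ⟨c, hc⟩ : ∃ c, c = r.eval t₀ / P.eval t₀ := ⟨_, rfl⟩
  have hc' : r.eval t₀ = c * P.eval t₀ := by rw [hc, div_mul_cancel₀ _ (hroot t₀)]
  obtain ⟨T, hT⟩ : ∃ T, T = S - C l - 2 * C c * r + C c ^ 2 * P := ⟨_, rfl⟩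
  have hdetT : T * P - (r - C c * P) ^ 2 = P * S - r ^ 2 - C l * P := by rw [hT]; ring
  have hdetT0 : ∀ t, 0 ≤ (T * P - (r - C c * P) ^ 2).eval t := fun t => by
    rw [hdetT]; simpa using hle t
  have hTnn : ∀ t, 0 ≤ T.eval t := fun t => by
    have := hdetT0 t
    simp only [eval_sub, eval_mul, eval_pow] at this
    refine nonneg_of_mul_nonneg_left (b := P.eval t) ?_ (hP t)
    nlinarith [sq_nonneg (r.eval t - (C c).eval t * P.eval t)]
  have hTroot : T.eval t₀ = 0 := by
    have : (T * P - (r - C c * P) ^ 2).eval t₀ = 0 := by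
      rw [hdetT, eval_sub, ← hleq]; simp
    simp only [eval_sub, eval_mul, eval_pow, eval_C, hc', sub_self] at this
    simpa [hroot t₀] using this
  have hCl : (C l * P).degree < (P * S - r ^ 2).degree :=
    (degree_le_of_natDegree_le (natDegree_C_mul_le l P)).trans_lt (by rwa [← degree_eq_natDegree hP0])
  have hdegT : (T * P - (r - C c * P) ^ 2).degree = (P * S - r ^ 2).degree := by
    rw [hdetT, degree_sub_eq_left_of_degree_lt hCl]
  have hform := split_root T (r - C c * P) P t₀ hTnn (fun t => (hP t).le) hdetT0
    (by rw [← hn]; exact natDegree_eq_of_degree_eq hdegT)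
    (fun h => hD0 (degree_eq_bot.1 (by rw [← hdegT, h, degree_zero]))) hTroot
  have hCform : IsSumSqForm 0 0 (C l) := isSumSqForm_of_nonneg _ (by simpa using hl0)
  convert (hform.substitute 0 1 1 (C c)).add hCform using 1
  · ring
  · ring
  · rw [hT]; ring

theorem degree_le_degree_add_of_nonneg {P Q : ℝ[X]} (hP : ∀ t, 0 ≤ P.eval t)
    (hQ : ∀ t, 0 ≤ Q.eval t) : P.degree ≤ (P + Q).degree := by
  by_contra! h
  rcases eq_or_ne (P + Q) 0 with h0 | h0
  · refine h.ne ?_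
    have : P = 0 := funext fun t => by
      have := congrArg (eval t) h0
      simp only [eval_add, eval_zero] at this ⊢
      linarith [hP t, hQ t]
    rw [h0, this]
  obtain ⟨t, ht⟩ := ((abs_div_tendsto_atTop_atTop_of_degree_gt P (P + Q) h h0).eventually_gt_atTop
    1).exists
  rw [abs_of_nonneg (div_nonneg (hP t) (by simpa using add_nonneg (hP t) (hQ t)))] at ht
  refine ht.not_ge (div_le_one_of_le₀ ?_ ?_) <;> simp <;> linarith [hP t, hQ t]

end Polynomial

namespace IsSumSqForm

theorem nonneg {R : Type*} [CommRing R] [LinearOrder R] [IsStrictOrderedRing R] {A B C : R}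
    (h : IsSumSqForm A B C) : 0 ≤ A ∧ 0 ≤ C := by
  induction h with
  | zero => simp
  | add_sq p q _ ih => exact ⟨add_nonneg ih.1 (sq_nonneg p), add_nonneg ih.2 (sq_nonneg q)⟩

theorem map {R S : Type*} [CommRing R] [CommRing S] (f : R →+* S) {A B C : R}
    (h : IsSumSqForm A B C) : IsSumSqForm (f A) (f B) (f C) := by
  induction h with
  | zero => simpa using zero
  | add_sq p q _ ih => simpa using ih.add_sq (f p) (f q)

end IsSumSqForm

theorem IsSumSq.map_ringHom {R S : Type*} [CommRing R] [CommRing S] (f : R →+* S) {a : R}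
    (h : IsSumSq a) : IsSumSq (f a) := by
  induction h with
  | zero => simp
  | sq_add a _ ih => simpa using (IsSumSq.mul_self (f a)).add ih

theorem IsSumSq.exists_eq_sum_sq {R : Type*} [CommRing R] {a : R} (h : IsSumSq a) :
    ∃ (k : ℕ) (g : Fin k → R), a = ∑ i, g i ^ 2 := by
  induction h with
  | zero => exact ⟨0, Fin.elim0, by simp⟩
  | sq_add a _ ih =>
    obtain ⟨k, g, rfl⟩ := ih
    exact ⟨k + 1, Fin.cons a g, by simp [Fin.sum_univ_succ, pow_two]⟩

namespace Polynomial

theorem natDegree_le_of_natDegree_add_sq_le {P p : ℝ[X]} {d : ℕ} (hP : ∀ t, 0 ≤ P.eval t)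
    (h : (P + p ^ 2).natDegree ≤ 2 * d) : P.natDegree ≤ 2 * d ∧ p.natDegree ≤ d := by
  have hp : ∀ t, 0 ≤ (p ^ 2).eval t := fun t => by simpa using sq_nonneg (p.eval t)
  have h1 := natDegree_le_natDegree (degree_le_degree_add_of_nonneg hP hp)
  have h2 := natDegree_le_natDegree (degree_le_degree_add_of_nonneg hp hP)
  rw [add_comm, natDegree_pow] at h2
  exact ⟨h1.trans h, by lia⟩

theorem exists_eval_eq_pow_mul_eval_div {p : ℝ[X]} {d : ℕ} (hp : p.natDegree ≤ d) :
    ∃ P : MvPolynomial (Fin 3) ℝ, ∀ x : Fin 3 → ℝ, x 2 ≠ 0 →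
      MvPolynomial.eval x P = x 2 ^ d * p.eval (x 1 / x 2) := by
  refine ⟨∑ k ∈ Finset.range (d + 1),
    MvPolynomial.C (p.coeff k) * MvPolynomial.X 1 ^ k * MvPolynomial.X 2 ^ (d - k),
    fun x hx => ?_⟩
  rw [eval_eq_sum_range' (Nat.lt_succ_of_le hp), map_sum, Finset.mul_sum]
  refine Finset.sum_congr rfl fun k hk => ?_
  have hk : k ≤ d := by simpa [Nat.lt_succ_iff] using hk
  simp only [map_mul, map_pow, MvPolynomial.eval_C, MvPolynomial.eval_X, div_pow]
  rw [← Nat.sub_add_cancel hk, pow_add, Nat.add_sub_cancel]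
  field_simp

end Polynomial

open Polynomial in
theorem IsSumSqForm.exists_isSumSq_eval_eq {A B C : ℝ[X]} (h : IsSumSqForm A B C) {d : ℕ}
    (hA : A.natDegree ≤ 2 * d) (hC : C.natDegree ≤ 2 * (d + 1)) :
    ∃ G : MvPolynomial (Fin 3) ℝ, IsSumSq G ∧ ∀ x : Fin 3 → ℝ, x 2 ≠ 0 →
      MvPolynomial.eval x G = x 2 ^ (2 * d) * (A.eval (x 1 / x 2) * x 0 ^ 2
        + 2 * x 2 * B.eval (x 1 / x 2) * x 0 + x 2 ^ 2 * C.eval (x 1 / x 2)) := by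
  induction h with
  | zero => exact ⟨0, .zero, by simp⟩
  | add_sq p q hf ih =>
    have hnn (t : ℝ) := (hf.map (evalRingHom t)).nonneg
    obtain ⟨hA', hp⟩ := natDegree_le_of_natDegree_add_sq_le (fun t => (hnn t).1) hA
    obtain ⟨hC', hq⟩ := natDegree_le_of_natDegree_add_sq_le (fun t => (hnn t).2) hC
    obtain ⟨G, hG, hGe⟩ := ih hA' hC'
    obtain ⟨P, hP⟩ := exists_eval_eq_pow_mul_eval_div hp
    obtain ⟨Q, hQ⟩ := exists_eval_eq_pow_mul_eval_div hq
    refine ⟨_, .sq_add (P * MvPolynomial.X 0 + Q) hG, fun x hx => ?_⟩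
    simp only [map_add, map_mul, MvPolynomial.eval_X, hGe x hx, hP x hx, hQ x hx,
      Polynomial.eval_add, Polynomial.eval_mul, Polynomial.eval_pow]
    ring

namespace MvPolynomial

theorem funext_of_ne_zero {F G : MvPolynomial (Fin 3) ℝ}
    (h : ∀ x : Fin 3 → ℝ, x 2 ≠ 0 → eval x F = eval x G) : F = G := by
  have : X 2 * F = X 2 * G := MvPolynomial.funext fun x => by
    rcases eq_or_ne (x 2) 0 with h0 | h0
    · simp [h0]
    · simp [h x h0]
  exact mul_left_cancel₀ (X_ne_zero 2) this

open Polynomial in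
/-- A nonnegative ternary form which is at most quadratic in the first variable is a sum of
squares. -/
theorem isSumSq_of_quadratic {F : MvPolynomial (Fin 3) ℝ} (hF : ∀ x, 0 ≤ eval x F)
    {P Q R : ℝ[X]} {d : ℕ} (hP : P.natDegree ≤ 2 * d) (hR : R.natDegree ≤ 2 * (d + 1))
    (h : ∀ x : Fin 3 → ℝ, x 2 ≠ 0 → eval x F = x 2 ^ (2 * d) * (P.eval (x 1 / x 2) * x 0 ^ 2
        + 2 * x 2 * Q.eval (x 1 / x 2) * x 0 + x 2 ^ 2 * R.eval (x 1 / x 2))) :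
    IsSumSq F := by
  have hq (t s : ℝ) : 0 ≤ P.eval t * (s * s) + (2 * Q.eval t) * s + R.eval t := by
    have h1 := h ![s, t, 1] (by simp)
    have h2 := hF ![s, t, 1]
    rw [h1] at h2
    simp at h2
    linarith
  have hdet (t : ℝ) : 0 ≤ (P * R - Q ^ 2).eval t := by
    have := discrim_le_zero (hq t)
    rw [discrim] at this
    simp only [Polynomial.eval_sub, Polynomial.eval_mul, Polynomial.eval_pow]
    linarith
  have hRn (t : ℝ) : 0 ≤ R.eval t := by simpa using hq t 0
  have hPn (t : ℝ) : 0 ≤ P.eval t := by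
    by_contra! hneg
    have h1 := hdet t
    simp only [Polynomial.eval_sub, Polynomial.eval_mul, Polynomial.eval_pow] at h1
    have hR0 : R.eval t = 0 := by nlinarith [hRn t, sq_nonneg (Q.eval t)]
    have h2 := hq t 1
    have h3 := hq t (-1)
    linarith
  obtain ⟨G, hG, hGe⟩ :=
    (isSumSqForm_of_posSemidef P Q R hPn hRn hdet).exists_isSumSq_eval_eq hP hR
  rwa [funext_of_ne_zero fun x hx => (h x hx).trans (hGe x hx).symm]

theorem IsHomogeneous.exists_eq_of_two {R : Type*} [CommRing R] {q : MvPolynomial (Fin 3) R}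
    (hq : q.IsHomogeneous 2) :
    ∃ a b c d e f : R, q = C a * X 0 ^ 2 + X 0 * (C b * X 1 + C c * X 2)
      + (C d * X 1 ^ 2 + C e * X 1 * X 2 + C f * X 2 ^ 2) := by
  rw [← q.support_sum_monomial_coeff]
  refine Finset.sum_induction _ (fun q => ∃ a b c d e f : R, q = C a * X 0 ^ 2
      + X 0 * (C b * X 1 + C c * X 2) + (C d * X 1 ^ 2 + C e * X 1 * X 2 + C f * X 2 ^ 2)) ?_ ?_ ?_
  · rintro _ _ ⟨a, b, c, d, e, f, rfl⟩ ⟨a', b', c', d', e', f', rfl⟩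
    refine ⟨a + a', b + b', c + c', d + d', e + e', f + f', ?_⟩
    simp only [map_add]
    ring
  · exact ⟨0, 0, 0, 0, 0, 0, by simp⟩
  · intro v hv
    have hdeg : v 0 + v 1 + v 2 = 2 := by
      have := hq.degree_eq_sum_deg_support hv
      rw [Finset.sum_subset (Finset.subset_univ v.support) (by simp)] at this
      simpa [Fin.sum_univ_three] using this.symm
    have hmon : monomial v (coeff v q) = C (coeff v q) * (X 0 ^ v 0 * X 1 ^ v 1 * X 2 ^ v 2) := by
      rw [monomial_eq, Finsupp.prod_fintype _ _ (by simp), Fin.prod_univ_three]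
    rw [hmon]
    generalize coeff v q = r
    have h0 : v 0 ≤ 2 := by lia
    have h1 : v 1 ≤ 2 := by lia
    have h2 : v 2 = 2 - v 0 - v 1 := by lia
    rw [h2] at hdeg ⊢
    clear h2 hmon hv
    generalize v 0 = i at *
    generalize v 1 = j at *
    interval_cases i <;> interval_cases j <;> try exact absurd hdeg (by decide)
    · exact ⟨0, 0, 0, 0, 0, r, by simp⟩
    · exact ⟨0, 0, 0, 0, r, 0, by simp [mul_assoc]⟩
    · exact ⟨0, 0, 0, r, 0, 0, by simp⟩
    · exact ⟨0, 0, r, 0, 0, 0, by simp [mul_left_comm]⟩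
    · exact ⟨0, r, 0, 0, 0, 0, by simp [mul_left_comm]⟩
    · exact ⟨r, 0, 0, 0, 0, 0, by simp⟩

/-- A quadratic form that does not involve `x₀²` and is nonnegative does not involve `x₀`. -/
theorem coeff_eq_zero_of_nonneg {b c d e f : ℝ}
    (h : ∀ x : Fin 3 → ℝ, 0 ≤ x 0 * (b * x 1 + c * x 2)
      + (d * x 1 ^ 2 + e * x 1 * x 2 + f * x 2 ^ 2)) : b = 0 ∧ c = 0 := by
  have key {u v : ℝ} (huv : ∀ s : ℝ, 0 ≤ s * u + v) : u = 0 := by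
    by_contra hu
    have := huv (-(v + 1) / u)
    rw [div_mul_cancel₀ _ hu] at this
    linarith
  exact ⟨key (v := d) fun s => by simpa using h ![s, 1, 0],
    key (v := f) fun s => by simpa using h ![s, 0, 1]⟩

open Polynomial in
/-- The determinant of a positive semidefinite symmetric matrix of ternary quadratic forms is a
sum of squares if the matrix vanishes at `(1, 0, 0)` outside the upper left corner. -/
theorem isSumSq_det_of_eval_single {N : Matrix (Fin 3) (Fin 3) (MvPolynomial (Fin 3) ℝ)}
    (hsymm : N.IsSymm) (hhom : ∀ i j, (N i j).IsHomogeneous 2)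
    (hpsd : ∀ x : Fin 3 → ℝ, (N.map (MvPolynomial.eval x)).PosSemidef)
    (hzero : ∀ i j, (i, j) ≠ (0, 0) → MvPolynomial.eval (Pi.single 0 1) (N i j) = 0) :
    IsSumSq N.det := by
  have hdiag (i : Fin 3) (x : Fin 3 → ℝ) : 0 ≤ MvPolynomial.eval x (N i i) :=
    (hpsd x).diag_nonneg (i := i)
  have hsum (x : Fin 3 → ℝ) : 0 ≤ MvPolynomial.eval x (N 1 1 + 2 * N 1 2 + N 2 2) := by
    have := (hpsd x).dotProduct_mulVec_nonneg ![0, 1, 1]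
    simp [Matrix.mulVec, dotProduct, Fin.sum_univ_three, hsymm.apply 1 2] at this
    simp
    linarith
  have hdet : N.det = N 0 0 * (N 1 1 * N 2 2 - N 1 2 ^ 2) - N 0 1 ^ 2 * N 2 2
      + 2 * N 0 1 * N 0 2 * N 1 2 - N 0 2 ^ 2 * N 1 1 := by
    rw [Matrix.det_fin_three, hsymm.apply 0 1, hsymm.apply 0 2, hsymm.apply 1 2]
    ring
  have hdetnn (x : Fin 3 → ℝ) : 0 ≤ MvPolynomial.eval x N.det := by
    have := (hpsd x).det_nonneg
    rwa [← RingHom.mapMatrix_apply, ← RingHom.map_det] at this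
  obtain ⟨a, b₀, c₀, d₀, e₀, f₀, h00⟩ := (hhom 0 0).exists_eq_of_two
  obtain ⟨a₁, b₁, c₁, d₁, e₁, f₁, h01⟩ := (hhom 0 1).exists_eq_of_two
  obtain ⟨a₂, b₂, c₂, d₂, e₂, f₂, h02⟩ := (hhom 0 2).exists_eq_of_two
  obtain ⟨a₃, b₃, c₃, d₃, e₃, f₃, h11⟩ := (hhom 1 1).exists_eq_of_two
  obtain ⟨a₄, b₄, c₄, d₄, e₄, f₄, h12⟩ := (hhom 1 2).exists_eq_of_two
  obtain ⟨a₅, b₅, c₅, d₅, e₅, f₅, h22⟩ := (hhom 2 2).exists_eq_of_two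
  obtain rfl : a₁ = 0 := by simpa [h01] using hzero 0 1 (by decide)
  obtain rfl : a₂ = 0 := by simpa [h02] using hzero 0 2 (by decide)
  obtain rfl : a₃ = 0 := by simpa [h11] using hzero 1 1 (by decide)
  obtain rfl : a₄ = 0 := by simpa [h12] using hzero 1 2 (by decide)
  obtain rfl : a₅ = 0 := by simpa [h22] using hzero 2 2 (by decide)
  obtain ⟨rfl, rfl⟩ := coeff_eq_zero_of_nonneg (b := b₃) (c := c₃) (d := d₃) (e := e₃) (f := f₃)
    fun x => by simpa [h11] using hdiag 1 x
  obtain ⟨rfl, rfl⟩ := coeff_eq_zero_of_nonneg (b := b₅) (c := c₅) (d := d₅) (e := e₅) (f := f₅)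
    fun x => by simpa [h22] using hdiag 2 x
  obtain ⟨hb, hc⟩ := coeff_eq_zero_of_nonneg (b := 2 * b₄) (c := 2 * c₄)
    (d := d₃ + 2 * d₄ + d₅) (e := e₃ + 2 * e₄ + e₅) (f := f₃ + 2 * f₄ + f₅) fun x => by
      have := hsum x
      simp only [h11, h12, h22, map_add, map_mul, map_pow, MvPolynomial.eval_X,
        MvPolynomial.eval_C, map_ofNat] at this
      linarith
  obtain rfl : b₄ = 0 := by linarith
  obtain rfl : c₄ = 0 := by linarith
  obtain ⟨lin, hlin⟩ : ∃ lin : ℝ → ℝ → ℝ[X], ∀ b c, lin b c = .C b * .X + .C c :=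
    ⟨_, fun _ _ => rfl⟩
  obtain ⟨quad, hquad⟩ : ∃ quad : ℝ → ℝ → ℝ → ℝ[X],
      ∀ d e f, quad d e f = .C d * .X ^ 2 + .C e * .X + .C f := ⟨_, fun _ _ _ => rfl⟩
  have hline {b c t u : ℝ} (hu : u ≠ 0) : b * t + c * u = u * (lin b c).eval (t / u) := by
    simp [hlin]; field_simp
  have hquade {d e f t u : ℝ} (hu : u ≠ 0) :
      d * t ^ 2 + e * t * u + f * u ^ 2 = u ^ 2 * (quad d e f).eval (t / u) := by
    simp [hquad]; field_simp
  refine isSumSq_of_quadratic hdetnn (d := 2)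
    (P := .C a * (quad d₃ e₃ f₃ * quad d₅ e₅ f₅ - quad d₄ e₄ f₄ ^ 2)
      - lin b₁ c₁ ^ 2 * quad d₅ e₅ f₅ + .C 2 * lin b₁ c₁ * lin b₂ c₂ * quad d₄ e₄ f₄
      - lin b₂ c₂ ^ 2 * quad d₃ e₃ f₃)
    (Q := .C (1 / 2) * lin b₀ c₀ * (quad d₃ e₃ f₃ * quad d₅ e₅ f₅ - quad d₄ e₄ f₄ ^ 2)
      - lin b₁ c₁ * quad d₁ e₁ f₁ * quad d₅ e₅ f₅
      + (lin b₁ c₁ * quad d₂ e₂ f₂ + lin b₂ c₂ * quad d₁ e₁ f₁) * quad d₄ e₄ f₄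
      - lin b₂ c₂ * quad d₂ e₂ f₂ * quad d₃ e₃ f₃)
    (R := quad d₀ e₀ f₀ * (quad d₃ e₃ f₃ * quad d₅ e₅ f₅ - quad d₄ e₄ f₄ ^ 2)
      - quad d₁ e₁ f₁ ^ 2 * quad d₅ e₅ f₅ + .C 2 * quad d₁ e₁ f₁ * quad d₂ e₂ f₂ * quad d₄ e₄ f₄
      - quad d₂ e₂ f₂ ^ 2 * quad d₃ e₃ f₃) ?_ ?_ ?_
  · simp only [hlin, hquad]
    compute_degree
  · simp only [hquad]
    compute_degree
  intro x hx
  rw [hdet, h00, h01, h02, h11, h12, h22]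
  simp only [map_add, map_sub, map_mul, map_pow, MvPolynomial.eval_X, MvPolynomial.eval_C,
    map_ofNat, hquade hx, Polynomial.eval_add, Polynomial.eval_sub, Polynomial.eval_mul,
    Polynomial.eval_pow, Polynomial.eval_C, Polynomial.eval_ofNat, map_zero, zero_mul, add_zero,
    zero_add]
  simp only [hline hx]
  ring

end MvPolynomial

namespace Matrix

theorem mul_eq_mul_of_rank_le_one {K m n : Type*} [Field K] [Fintype n] {A : Matrix m n K}
    (h : A.rank ≤ 1) (i j : m) (k l : n) : A i k * A j l = A i l * A j k := by
  by_contra hne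
  have hdet : (A.submatrix ![i, j] ![k, l]).det ≠ 0 := by
    rw [det_fin_two]
    simpa [sub_eq_zero] using hne
  have h2 := rank_of_isUnit _ ((isUnit_iff_isUnit_det _).2 hdet.isUnit)
  have h1 := rank_submatrix_le A ![i, j] ![k, l]
  simp only [Fintype.card_fin] at h2
  lia

theorem exists_eq_mul_mul_of_minors_eq_zero {K n : Type*} [Field K] [Nonempty n]
    {A : Matrix n n K} (hA : A.IsSymm) (h : ∀ i j k l, A i k * A j l = A i l * A j k) :
    ∃ (c : K) (w : n → K), w ≠ 0 ∧ ∀ i j, A i j = c * w i * w j := by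
  by_cases hdiag : ∃ k, A k k ≠ 0
  · obtain ⟨k, hk⟩ := hdiag
    refine ⟨(A k k)⁻¹, A k, fun h0 => hk (congrFun h0 k), fun i j => ?_⟩
    have := h i k j k
    rw [hA.apply k i] at this
    field_simp
    linear_combination this
  · push Not at hdiag
    refine ⟨0, fun _ => 1, fun h0 => one_ne_zero (congrFun h0 (Classical.arbitrary n)),
      fun i j => ?_⟩
    have := h i j j i
    rw [hdiag, zero_mul, hA.apply i j] at this
    simpa using this

theorem exists_isUnit_det_mulVec_single_eq {n : Type*} [Fintype n] [DecidableEq n]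
    {w : n → ℝ} (hw : w ≠ 0) (i : n) :
    ∃ T : Matrix n n ℝ, IsUnit T.det ∧ T *ᵥ Pi.single i 1 = w := by
  have hi : (Pi.single i 1 : n → ℝ) ≠ 0 := by simp
  obtain ⟨e, he⟩ := SeparatingDual.exists_continuousLinearEquiv_apply_eq (R := ℝ) hi hw
  refine ⟨LinearMap.toMatrix' (e : (n → ℝ) →ₗ[ℝ] n → ℝ), ?_, ?_⟩
  · rw [LinearMap.det_toMatrix']
    exact e.toLinearEquiv.isUnit_det'
  · rw [LinearMap.toMatrix'_mulVec]
    exact he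

end Matrix

namespace MvPolynomial

open Matrix

/-- Linear substitution of the variables. -/
def linearSubst {R n : Type*} [CommRing R] [Fintype n] (T : Matrix n n R) :
    MvPolynomial n R →ₐ[R] MvPolynomial n R :=
  aeval fun i => ∑ j, C (T i j) * X j

theorem eval_linearSubst {R n : Type*} [CommRing R] [Fintype n] (T : Matrix n n R) (x : n → R)
    (p : MvPolynomial n R) : eval x (linearSubst T p) = eval (T *ᵥ x) p := by
  induction p using MvPolynomial.induction_on with
  | C r => simp [linearSubst]
  | add p q hp hq => simp [hp, hq]
  | mul_X p i hp =>
    rw [map_mul, map_mul, map_mul, hp]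
    simp [linearSubst, mulVec, dotProduct]

theorem IsHomogeneous.linearSubst {R n : Type*} [CommRing R] [Fintype n] (T : Matrix n n R)
    {p : MvPolynomial n R} {d : ℕ} (hp : p.IsHomogeneous d) :
    (linearSubst T p).IsHomogeneous d := by
  simpa only [MvPolynomial.linearSubst, one_mul] using
    hp.aeval _ fun i => IsHomogeneous.sum _ _ 1 fun j _ => isHomogeneous_C_mul_X _ _

/-- The determinant of a positive semidefinite symmetric matrix of ternary quadratic forms is a
sum of squares if the matrix has rank at most one at some nonzero real point. -/
theorem isSumSq_det_of_minors_eq_zero {M : Matrix (Fin 3) (Fin 3) (MvPolynomial (Fin 3) ℝ)}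
    (hsymm : M.IsSymm) (hhom : ∀ i j, (M i j).IsHomogeneous 2)
    (hpsd : ∀ x : Fin 3 → ℝ, (M.map (eval x)).PosSemidef) {b : Fin 3 → ℝ} (hb : b ≠ 0)
    (hminors : ∀ i j k l, eval b (M i k) * eval b (M j l) = eval b (M i l) * eval b (M j k)) :
    IsSumSq M.det := by
  obtain ⟨c, w, hw, hMw⟩ := exists_eq_mul_mul_of_minors_eq_zero (A := M.map (eval b))
    (hsymm.map _) hminors
  obtain ⟨T, hT, hTb⟩ := exists_isUnit_det_mulVec_single_eq hb 0
  obtain ⟨S, hS, hSw⟩ := exists_isUnit_det_mulVec_single_eq hw 0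
  obtain ⟨N, hN⟩ : ∃ N : Matrix (Fin 3) (Fin 3) (MvPolynomial (Fin 3) ℝ),
      N = S⁻¹.map C * M.map (linearSubst T) * (S⁻¹.map C)ᵀ := ⟨_, rfl⟩
  have hNeval (x : Fin 3 → ℝ) : N.map (eval x) = S⁻¹ * M.map (eval (T *ᵥ x)) * S⁻¹ᵀ := by
    ext i j
    simp [hN, Matrix.mul_apply, eval_linearSubst]
  have hNsum : IsSumSq N.det := by
    refine isSumSq_det_of_eval_single ?_ ?_ ?_ ?_
    · rw [hN, Matrix.IsSymm, transpose_mul, transpose_mul, transpose_transpose,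
        (hsymm.map _).eq, Matrix.mul_assoc]
    · intro i j
      rw [hN, Matrix.mul_apply]
      refine IsHomogeneous.sum _ _ _ fun k _ => ?_
      rw [Matrix.mul_apply, transpose_apply, map_apply, mul_comm]
      refine IsHomogeneous.C_mul (IsHomogeneous.sum _ _ _ fun l _ => ?_) _
      exact ((hhom l k).linearSubst T).C_mul _
    · intro x
      rw [hNeval]
      simpa using (hpsd (T *ᵥ x)).mul_mul_conjTranspose_same S⁻¹
    · intro i j hij
      have hrank : M.map (eval b) = c • vecMulVec w w := by
        ext i j
        rw [hMw]
        simp [vecMulVec_apply, mul_assoc]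
      have hSe : S⁻¹ *ᵥ w = Pi.single 0 1 := by
        rw [← hSw, mulVec_mulVec, nonsing_inv_mul _ hS, one_mulVec]
      have := congrFun (congrFun (hNeval (Pi.single 0 1)) i) j
      rw [map_apply, hTb, hrank, Matrix.mul_smul, mul_vecMulVec, Matrix.smul_mul, vecMulVec_mul,
        vecMul_transpose, hSe] at this
      rw [this, Matrix.smul_apply, vecMulVec_apply]
      have : i ≠ 0 ∨ j ≠ 0 := by
        by_contra! h
        exact hij (by rw [h.1, h.2])
      rcases this with h | h <;> simp [h]
  have hdet : M.det = C S.det * C S.det * linearSubst T⁻¹ N.det := by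
    refine MvPolynomial.funext fun x => ?_
    have hx : T *ᵥ (T⁻¹ *ᵥ x) = x := by rw [mulVec_mulVec, mul_nonsing_inv _ hT, one_mulVec]
    rw [map_mul, map_mul, eval_C, eval_linearSubst, RingHom.map_det, RingHom.map_det,
      RingHom.mapMatrix_apply, RingHom.mapMatrix_apply, hNeval, hx, det_mul, det_mul,
      det_transpose, det_nonsing_inv, Ring.inverse_eq_inv']
    have := hS.ne_zero
    field_simp
  rw [hdet]
  exact (IsSumSq.mul_self _).mul (hNsum.map_ringHom (linearSubst T⁻¹).toRingHom)

end MvPolynomial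

/-- If `M` is a symmetric `3 × 3` matrix of real homogeneous quadratic forms which is positive
semidefinite at every real point, whose determinant `F` is not identically zero and not a sum
of squares, and if all singular points of the zero set of `F` are real, then the kernel of
`M(a)` has dimension at most one for every `0 ≠ a ∈ ℂ³`. -/
theorem kernel_dim_le_one
    (M : Matrix (Fin 3) (Fin 3) (MvPolynomial (Fin 3) ℝ))
    (hsymm : M.IsSymm)
    (hhom : ∀ i j, (M i j).IsHomogeneous 2)
    (hpsd : ∀ b : Fin 3 → ℝ, (M.map (MvPolynomial.eval b)).PosSemidef)
    (hF : M.det ≠ 0)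
    (hnotsos : ¬ ∃ (k : ℕ) (g : Fin k → MvPolynomial (Fin 3) ℝ), M.det = ∑ i, g i ^ 2)
    (hsingreal : ∀ a : Fin 3 → ℂ, a ≠ 0 →
      MvPolynomial.aeval a M.det = 0 →
      (∀ i : Fin 3, MvPolynomial.aeval a (MvPolynomial.pderiv i M.det) = 0) →
      ∃ (c : ℂ) (b : Fin 3 → ℝ), a = fun i => c * (b i : ℂ)) :
    ∀ a : Fin 3 → ℂ, a ≠ 0 →
      Module.finrank ℂ
        (LinearMap.ker (Matrix.mulVecLin (M.map (fun p => MvPolynomial.aeval a p)))) ≤ 1 := by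
  intro a ha
  by_contra! hker
  have hrank : (M.map (fun p => MvPolynomial.aeval a p)).rank ≤ 1 := by
    have := LinearMap.finrank_range_add_finrank_ker
      (Matrix.mulVecLin (M.map (fun p => MvPolynomial.aeval a p)))
    rw [Module.finrank_fin_fun] at this
    rw [Matrix.rank]
    lia
  have hminors (i j k l : Fin 3) : aeval a (M i k) * aeval a (M j l)
      = aeval a (M i l) * aeval a (M j k) := Matrix.mul_eq_mul_of_rank_le_one hrank i j k l
  obtain ⟨c, b, rfl⟩ := hsingreal a ha
    (by
      rw [Matrix.det_fin_three]
      simp only [map_add, map_sub, map_mul]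
      linear_combination aeval a (M 0 0) * hminors 1 2 1 2 - aeval a (M 0 1) * hminors 1 2 0 2
        + aeval a (M 0 2) * hminors 1 2 0 1)
    (fun i => by
      rw [Matrix.det_fin_three]
      simp only [map_add, map_sub, map_mul, Derivation.leibniz, smul_eq_mul]
      linear_combination aeval a (pderiv i (M 0 0)) * hminors 1 2 1 2
        - aeval a (pderiv i (M 0 1)) * hminors 1 2 0 2
        + aeval a (pderiv i (M 0 2)) * hminors 1 2 0 1
        - aeval a (pderiv i (M 1 0)) * hminors 0 2 1 2
        + aeval a (pderiv i (M 1 1)) * hminors 0 2 0 2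
        - aeval a (pderiv i (M 1 2)) * hminors 0 2 0 1
        + aeval a (pderiv i (M 2 0)) * hminors 0 1 1 2
        - aeval a (pderiv i (M 2 1)) * hminors 0 1 0 2
        + aeval a (pderiv i (M 2 2)) * hminors 0 1 0 1)
  have hc : c ≠ 0 := by
    rintro rfl
    exact ha (by ext; simp)
  have hb : b ≠ 0 := by
    rintro rfl
    exact ha (by ext; simp)
  have hscale (i j : Fin 3) :
      aeval (fun i => c * (b i : ℂ)) (M i j) = c ^ 2 * (eval b (M i j) : ℝ) := by
    obtain ⟨a₁, a₂, a₃, a₄, a₅, a₆, h⟩ := (hhom i j).exists_eq_of_two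
    rw [h]
    simp
    ring
  refine hnotsos (isSumSq_det_of_minors_eq_zero hsymm hhom hpsd hb fun i j k l =>
    ?_).exists_eq_sum_sq
  have h := hminors i j k l
  rw [hscale, hscale, hscale, hscale] at h
  have h' : c ^ 4 * ((eval b (M i k) * eval b (M j l) : ℝ) : ℂ)
      = c ^ 4 * ((eval b (M i l) * eval b (M j k) : ℝ) : ℂ) := by
    push_cast
    linear_combination h
  exact_mod_cast mul_left_cancel₀ (pow_ne_zero 4 hc) h'
end
end
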